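/- There exist an irrational number α ∈ ℝ, a radius r > 0, and a holomorphic injective map f defined on an open neighborhood of the closed disk D̄_r with f(0) = 0 and f'(0) = e^{2πiα}, such that f is non-linearizable and f admits a hedgehog K on D̄_r with the property that for every cross-cut γ of ℂ ∖ K one has K ⊆ closure(G(γ)). (This is the precise form, proved in the paper, of the assertion that the impression of every prime end of the complement of K is all of K.) -/

import Mathlib

open Complex Metric Set Filter

noncomputable section

/-- `f` is linearizable at the origin with rotation number `α`. -/
def Linearizable (α : ℝ) (f : ℂ → ℂ) : Prop :=
  ∃ (h : ℂ → ℂ) (V : Set ℂ), IsOpen V ∧ (0 : ℂ) ∈ V ∧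
    DifferentiableOn ℂ h V ∧ Set.InjOn h V ∧ h 0 = 0 ∧
    ∀ᶠ z in nhds (0 : ℂ), f (h z) = h (Complex.exp (2 * Real.pi * Complex.I * α) * z)

/-- `K` is a hedgehog for `f` on the closed disk of radius `r`. -/
def IsHedgehog (r : ℝ) (f : ℂ → ℂ) (K : Set ℂ) : Prop :=
  IsCompact K ∧ IsConnected K ∧ (0 : ℂ) ∈ K ∧ K ⊆ Metric.closedBall 0 r ∧
    (K ∩ Metric.sphere 0 r).Nonempty ∧ f '' K = K ∧ IsConnected Kᶜ

/-- `γ : [0,1] → ℂ` is a cross-cut of `ℂ ∖ K`: an injective arc with endpoints in `K`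
and interior disjoint from `K`. -/
def CrossCut (K : Set ℂ) (γ : ℝ → ℂ) : Prop :=
  ContinuousOn γ (Set.Icc 0 1) ∧ Set.InjOn γ (Set.Icc 0 1) ∧
    γ 0 ∈ K ∧ γ 1 ∈ K ∧ γ 0 ≠ γ 1 ∧ ∀ t ∈ Set.Ioo (0 : ℝ) 1, γ t ∉ K

/-- `G(γ)`: the union of the bounded connected components of
`ℂ ∖ (K ∪ γ([0,1]))`. -/
def CrossCutRegion (K : Set ℂ) (γ : ℝ → ℂ) : Set ℂ :=
  {z | z ∉ K ∪ γ '' Set.Icc 0 1 ∧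
    Bornology.IsBounded (connectedComponentIn (K ∪ γ '' Set.Icc 0 1)ᶜ z)}

lemma eqOn_of_exp_eqOn {X : Type*} [TopologicalSpace X] {S : Set X} (hS : IsPreconnected S)
    {L M : X → ℂ} (hL : ContinuousOn L S) (hM : ContinuousOn M S)
    (h : ∀ x ∈ S, exp (L x) = exp (M x)) {a : X} (ha : a ∈ S) (e : L a = M a) : EqOn L M S :=
  isCoveringMap_exp.eqOn_of_comp_eqOn hS hL hM (fun x hx => Subtype.ext (h x hx)) ha e

lemma exists_continuous_log {X : Type*} [TopologicalSpace X] [SimplyConnectedSpace X]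
    [LocallyPathConnectedSpace X] {u : X → ℂ} (hu : Continuous u) (h0 : ∀ x, u x ≠ 0) :
    ∃ L : X → ℂ, Continuous L ∧ ∀ x, exp (L x) = u x := by
  obtain ⟨x0⟩ : Nonempty X := inferInstance
  obtain ⟨L, ⟨-, hL⟩, -⟩ := isCoveringMapOn_exp.existsUnique_continuousMap_lifts ⟨u, hu⟩
    (exp_log (h0 x0)) h0
  exact ⟨L, L.continuous, fun x => congrFun hL x⟩

/-- A nonvanishing path on a compact interval has a continuous logarithm with prescribed
initial value. -/
lemma exists_log_path {a b : ℝ} (hab : a ≤ b) {w : ℝ → ℂ} (hw : ContinuousOn w (Icc a b))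
    (h0 : ∀ t ∈ Icc a b, w t ≠ 0) {c : ℂ} (hc : exp c = w a) :
    ∃ L : ℝ → ℂ, ContinuousOn L (Icc a b) ∧ (∀ t ∈ Icc a b, exp (L t) = w t) ∧ L a = c := by
  have hcont : Continuous (fun t : ℝ => w (projIcc a b hab t)) :=
    hw.comp_continuous (continuous_subtype_val.comp continuous_projIcc)
      (fun t => (projIcc a b hab t).2)
  obtain ⟨L, hL, hLu⟩ := exists_continuous_log hcont (fun t => h0 _ (projIcc a b hab t).2)
  have hproj : ∀ t ∈ Icc a b, ((projIcc a b hab t : Icc a b) : ℝ) = t := fun t ht => by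
    rw [projIcc_of_mem hab ht]
  refine ⟨fun t => L t - L a + c, by fun_prop, fun t ht => ?_, by ring⟩
  have ha : exp (L a) = w a := by rw [hLu, hproj a ⟨le_rfl, hab⟩]
  rw [exp_add, exp_sub, hLu, hproj t ht, ha, hc, div_mul_cancel₀]
  exact h0 a ⟨le_rfl, hab⟩

/-- A continuous real function on a connected set whose shifted cosine stays nonnegative takes its
values in a single period window. -/
lemma im_window_of_preconnected {X : Type*} [TopologicalSpace X] {S : Set X}
    (hS : IsPreconnected S) {f : X → ℝ} (hf : ContinuousOn f S)
    {c : ℝ} (h : ∀ x ∈ S, 0 ≤ Real.cos (f x - c)) (hne : S.Nonempty) :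
    ∃ m : ℤ, ∀ x ∈ S, |f x - c - 2 * Real.pi * m| ≤ Real.pi / 2 := by
  have hpi := Real.pi_pos
  obtain ⟨x0, hx0⟩ := hne
  -- choose m with f x0 - c - 2πm ∈ [-π, π)
  obtain ⟨m, hm⟩ : ∃ m : ℤ, |f x0 - c - 2 * Real.pi * m| ≤ Real.pi := by
    refine ⟨round ((f x0 - c) / (2 * Real.pi)), ?_⟩
    have := abs_sub_round ((f x0 - c) / (2 * Real.pi))
    have h2 : f x0 - c - 2 * Real.pi * (round ((f x0 - c) / (2 * Real.pi)) : ℤ) =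
      2 * Real.pi * ((f x0 - c) / (2 * Real.pi) - round ((f x0 - c) / (2 * Real.pi))) := by
      field_simp
    rw [h2, abs_mul, abs_of_pos (by positivity : 0 < 2 * Real.pi)]
    nlinarith
  refine ⟨m, fun x hx => ?_⟩
  have key : ∀ y ∈ S, |f y - c - 2 * Real.pi * m| ≤ Real.pi →
      |f y - c - 2 * Real.pi * m| ≤ Real.pi / 2 := by
    intro y hy hy1
    by_contra hlt
    push Not at hlt
    have h1 := h y hy
    have h2 : Real.cos (f y - c) = Real.cos |f y - c - 2 * Real.pi * m| := by
      rw [Real.cos_abs, show f y - c - 2 * Real.pi * m = f y - c - m * (2 * Real.pi) by ring,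
        Real.cos_sub_int_mul_two_pi]
    have := Real.cos_neg_of_pi_div_two_lt_of_lt hlt (by linarith)
    linarith
  by_contra hlt
  push Not at hlt
  -- intermediate value
  have hg : ContinuousOn (fun y => |f y - c - 2 * Real.pi * m|) S := by fun_prop
  have hx1 : Real.pi < |f x - c - 2 * Real.pi * m| := by
    by_contra h3
    push Not at h3
    linarith [key x hx h3]
  have := hS.intermediate_value hx0 hx hg
  obtain ⟨y, hy, hyv⟩ := this (show (3 * Real.pi / 4) ∈ Icc _ _ from
    ⟨by linarith [key x0 hx0 hm], by linarith⟩)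
  have := key y hy (by simp only at hyv; rw [hyv]; linarith)
  simp only at hyv
  rw [hyv] at this
  linarith

/-- The Poincaré-Miranda theorem in the plane, in complex form. -/
lemma exists_zero_of_sides {u : ℝ × ℝ → ℂ} (hu : ContinuousOn u (Icc 0 1 ×ˢ Icc 0 1))
    (h1 : ∀ t ∈ Icc (0 : ℝ) 1, 0 ≤ (u (0, t)).re) (h2 : ∀ t ∈ Icc (0 : ℝ) 1, (u (1, t)).re ≤ 0)
    (h3 : ∀ s ∈ Icc (0 : ℝ) 1, 0 ≤ (u (s, 0)).im) (h4 : ∀ s ∈ Icc (0 : ℝ) 1, (u (s, 1)).im ≤ 0) :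
    ∃ s ∈ Icc (0 : ℝ) 1, ∃ t ∈ Icc (0 : ℝ) 1, u (s, t) = 0 := by
  by_contra hcon
  push Not at hcon
  have hpi := Real.pi_pos
  let P : ℝ → ℝ := fun t => projIcc (0 : ℝ) 1 zero_le_one t
  have hP : ∀ t, P t ∈ Icc (0 : ℝ) 1 := fun t => (projIcc (0 : ℝ) 1 zero_le_one t).2
  have hPc : Continuous P := continuous_subtype_val.comp continuous_projIcc
  have hPe : ∀ t ∈ Icc (0 : ℝ) 1, P t = t := fun t ht => by
    simp only [P]; rw [projIcc_of_mem _ ht]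
  obtain ⟨L, hL, hLu⟩ := exists_continuous_log (X := ℝ × ℝ) (u := fun p => u (P p.1, P p.2))
    (hu.comp_continuous (by fun_prop) (fun p => ⟨hP _, hP _⟩))
    (fun p => hcon _ (hP _) _ (hP _))
  have hLu' : ∀ s ∈ Icc (0 : ℝ) 1, ∀ t ∈ Icc (0 : ℝ) 1, u (s, t) = exp (L (s, t)) := by
    intro s hs t ht
    rw [hLu]; simp [hPe s hs, hPe t ht]
  have hcI : IsPreconnected (Icc (0 : ℝ) 1) := isPreconnected_Icc
  have hneI : (Icc (0 : ℝ) 1).Nonempty := ⟨0, by simp⟩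
  have m0 : (0 : ℝ) ∈ Icc (0 : ℝ) 1 := by simp
  have m1 : (1 : ℝ) ∈ Icc (0 : ℝ) 1 := by simp
  obtain ⟨a, ha⟩ := im_window_of_preconnected hcI (f := fun t => (L (0, t)).im) (c := 0)
    (by fun_prop) (fun t ht => by
      have := h1 t ht
      rw [hLu' 0 m0 t ht, exp_re] at this
      simpa using nonneg_of_mul_nonneg_right this (Real.exp_pos _)) hneI
  obtain ⟨b, hb⟩ := im_window_of_preconnected hcI (f := fun t => (L (1, t)).im) (c := Real.pi)
    (by fun_prop) (fun t ht => by
      have := h2 t ht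
      rw [hLu' 1 m1 t ht, exp_re] at this
      rw [Real.cos_sub_pi]
      have h5 : 0 ≤ Real.exp (L (1, t)).re * -Real.cos (L (1, t)).im := by linarith
      exact nonneg_of_mul_nonneg_right h5 (Real.exp_pos _)) hneI
  obtain ⟨c, hc⟩ := im_window_of_preconnected hcI (f := fun s => (L (s, 0)).im)
    (c := Real.pi / 2) (by fun_prop) (fun t ht => by
      have := h3 t ht
      rw [hLu' t ht 0 m0, exp_im] at this
      rw [Real.cos_sub_pi_div_two]
      exact nonneg_of_mul_nonneg_right this (Real.exp_pos _)) hneI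
  obtain ⟨d, hd⟩ := im_window_of_preconnected hcI (f := fun s => (L (s, 1)).im)
    (c := 3 * Real.pi / 2) (by fun_prop) (fun t ht => by
      have := h4 t ht
      rw [hLu' t ht 1 m1, exp_im] at this
      have h6 : Real.cos ((L (t, 1)).im - 3 * Real.pi / 2) = - Real.sin (L (t, 1)).im := by
        rw [show (L (t, 1)).im - 3 * Real.pi / 2 = (L (t, 1)).im - Real.pi / 2 - Real.pi by ring,
          Real.cos_sub_pi, Real.cos_sub_pi_div_two]
      rw [h6]
      have h5 : 0 ≤ Real.exp (L (t, 1)).re * -Real.sin (L (t, 1)).im := by linarith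
      exact nonneg_of_mul_nonneg_right h5 (Real.exp_pos _)) hneI
  have a0 := abs_le.1 (ha 0 m0)
  have c0 := abs_le.1 (hc 0 m0)
  have a1 := abs_le.1 (ha 1 m1)
  have d0 := abs_le.1 (hd 0 m0)
  have b0 := abs_le.1 (hb 0 m0)
  have c1 := abs_le.1 (hc 1 m1)
  have b1 := abs_le.1 (hb 1 m1)
  have d1 := abs_le.1 (hd 1 m1)
  have intlt : ∀ (x y : ℤ), 2 * Real.pi * ((x : ℝ) - y) < 2 * Real.pi * 1 → x ≤ y := by
    intro x y h
    have := lt_of_mul_lt_mul_left h (by positivity)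
    have h' : ((x - y : ℤ) : ℝ) < ((1 : ℤ) : ℝ) := by push_cast; linarith
    have := Int.cast_lt.1 h'
    omega
  have e1 : a ≤ c := intlt _ _ (by linarith [a0.1, a0.2, c0.1, c0.2])
  have e3 : c ≤ b := intlt _ _ (by linarith [b0.1, b0.2, c1.1, c1.2])
  have e4 : b ≤ d := intlt _ _ (by linarith [b1.1, b1.2, d1.1, d1.2])
  have e5 : d ≤ a - 1 := by
    have := intlt d (a - 1) (by push_cast; linarith [a1.1, a1.2, d0.1, d0.2])
    exact this
  omega

/-- Along an arc `σ`, the function `(z - σ 0) / (z - σ 1)` has a continuous logarithm off the arc,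
which is small near infinity. -/
lemma exists_log_off_arc {σ : ℝ → ℂ} (hσ : ContinuousOn σ (Icc 0 1)) :
    ∃ M : ℂ → ℂ, ContinuousOn M (σ '' Icc 0 1)ᶜ ∧
      (∀ z ∉ σ '' Icc 0 1, exp (M z) = (z - σ 0) / (z - σ 1)) ∧
      ∃ B : ℝ, ∀ z, B < ‖z‖ → z ∉ σ '' Icc 0 1 ∧ ‖M z‖ < 1 := by
  classical
  let A := ((σ '' Icc 0 1)ᶜ : Set ℂ)
  have hσu : Continuous (fun t : unitInterval => σ t) :=
    hσ.comp_continuous continuous_subtype_val (fun t => t.2)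
  have hne : ∀ (t : unitInterval) (z : A), (z : ℂ) - σ t ≠ 0 := by
    rintro t ⟨z, hz⟩ h
    exact hz ⟨t, t.2, (sub_eq_zero.1 h).symm⟩
  have hH0 : Continuous (fun p : unitInterval × A => ((p.2 : ℂ) - σ 0) / (p.2 - σ p.1)) := by
    refine Continuous.div (by fun_prop) ?_ (fun p => hne p.1 p.2)
    exact (continuous_subtype_val.comp continuous_snd).sub (hσu.comp continuous_fst)
  let H : C(unitInterval × A, {z : ℂ // z ≠ 0}) :=
    ⟨fun p => ⟨((p.2 : ℂ) - σ 0) / (p.2 - σ p.1),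
      div_ne_zero (by simpa using hne 0 p.2) (hne p.1 p.2)⟩, hH0.subtype_mk _⟩
  have H0 : ∀ a, H (0, a) = (fun z : ℂ ↦ (⟨_, z.exp_ne_zero⟩ : {z : ℂ // z ≠ 0}))
      ((ContinuousMap.const A (0 : ℂ)) a) := by
    intro a
    apply Subtype.ext
    simp only [H, ContinuousMap.coe_mk, ContinuousMap.const_apply, exp_zero]
    have := hne 0 a
    simp only [Set.Icc.coe_zero] at this ⊢
    exact div_self this
  let N := isCoveringMap_exp.liftHomotopy H (ContinuousMap.const A (0 : ℂ)) H0
  have hN : ∀ p, exp (N p) = ((p.2 : ℂ) - σ 0) / (p.2 - σ p.1) := fun p =>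
    congrArg Subtype.val
      (congrFun (isCoveringMap_exp.liftHomotopy_lifts H (ContinuousMap.const A (0 : ℂ)) H0) p)
  have hN0 : ∀ a, N (0, a) = 0 := fun a => isCoveringMap_exp.liftHomotopy_zero _ _ H0 a
  let M : ℂ → ℂ := fun z => if hz : z ∈ A then N (1, ⟨z, hz⟩) else 0
  have hM : ∀ z (hz : z ∈ A), M z = N (1, ⟨z, hz⟩) := fun z hz => dif_pos hz
  refine ⟨M, ?_, ?_, ?_⟩
  · rw [continuousOn_iff_continuous_domRestrict]
    have : A.domRestrict M = fun a => N (1, a) := by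
      funext a; exact hM a.1 a.2
    rw [this]
    exact N.continuous.comp (by fun_prop)
  · intro z hz
    rw [hM z hz, hN]; simp
  · obtain ⟨C, hC⟩ := (isCompact_Icc.image_of_continuousOn hσ).isBounded.exists_norm_le
    have hC' : ∀ t : unitInterval, ‖σ t‖ ≤ C := fun t => hC _ ⟨t, t.2, rfl⟩
    have hC0 : 0 ≤ C := (norm_nonneg _).trans (hC' 0)
    refine ⟨10 * C + 1, fun z hz => ?_⟩
    have hzA : z ∉ σ '' Icc 0 1 := fun h => by linarith [hC z h]
    refine ⟨hzA, ?_⟩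
    have hlow : ∀ t : unitInterval, 9 * C + 1 ≤ ‖z - σ t‖ := fun t => by
      have := norm_sub_norm_le z (σ t)
      linarith [hC' t]
    have hq : ∀ t : unitInterval, ‖(σ t - σ 0) / (z - σ t)‖ ≤ 1 / 4 := fun t => by
      rw [norm_div, div_le_iff₀ (by linarith [hlow t])]
      have h1 := norm_sub_le (σ t) (σ 0)
      have h2 := hC' t
      have h3 := hC' 0
      simp only [Set.Icc.coe_zero] at h3
      linarith [hlow t]
    have hrat : ∀ t : unitInterval, (z - σ 0) / (z - σ t) = 1 + (σ t - σ 0) / (z - σ t) := by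
      intro t
      have := hne t ⟨z, hzA⟩
      simp only at this
      field_simp
      ring
    have hlogc : Continuous (fun t : unitInterval => log (1 + (σ t - σ 0) / (z - σ t))) := by
      refine Continuous.clog ?_ (fun t => ?_)
      · exact continuous_const.add ((hσu.sub continuous_const).div (continuous_const.sub hσu)
          (fun t => hne t ⟨z, hzA⟩))
      · left
        have := abs_le.1 ((abs_re_le_norm ((σ t - σ 0) / (z - σ t))).trans (hq t))
        simp only [add_re, one_re]
        linarith
    have heq : EqOn (fun t : unitInterval => N (t, ⟨z, hzA⟩))
        (fun t : unitInterval => log (1 + (σ t - σ 0) / (z - σ t))) univ := by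
      refine eqOn_of_exp_eqOn isPreconnected_univ (Continuous.continuousOn (by fun_prop))
        hlogc.continuousOn ?_ (mem_univ 0) ?_
      · intro t _
        rw [hN, exp_log]
        · exact hrat t
        · rw [← hrat]
          refine div_ne_zero ?_ (hne t ⟨z, hzA⟩)
          simpa using hne 0 ⟨z, hzA⟩
      · simp only [hN0, Set.Icc.coe_zero, sub_self, zero_div, add_zero, log_one]
    rw [hM z hzA, show N (1, ⟨z, hzA⟩) = _ from heq (mem_univ 1)]
    have := norm_log_one_add_half_le_self (z := (σ (1 : unitInterval) - σ 0) / (z - σ (1 : unitInterval)))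
      ((hq 1).trans (by norm_num))
    linarith [hq 1]

/-- There is no continuous logarithm of `z - a` on a circle around `a`. -/
lemma no_log_on_circle {a : ℂ} {r : ℝ} (hr : 0 < r) {L : ℂ → ℂ} (hL : ContinuousOn L (sphere a r))
    (h : ∀ z ∈ sphere a r, exp (L z) = z - a) : False := by
  have hmem : ∀ t : ℝ, a + exp (Real.log r + t * I) ∈ sphere a r := by
    intro t
    simp [norm_exp, Real.exp_log hr]
  have hc : Continuous (fun t : ℝ => L (a + exp (Real.log r + t * I))) :=
    hL.comp_continuous (by fun_prop) hmem
  have h1 := eqOn_of_exp_eqOn (S := univ)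
    (L := fun t : ℝ => L (a + exp (Real.log r + t * I)))
    (M := fun t : ℝ => Real.log r + t * I + (L (a + exp (Real.log r + (0 : ℝ) * I)) - Real.log r))
    isPreconnected_univ hc.continuousOn (Continuous.continuousOn (by fun_prop))
    (fun t _ => by
      have e1 := h _ (hmem t)
      have e2 := h _ (hmem 0)
      rw [e1, add_sub_cancel_left, exp_add, exp_add, exp_sub, e2]
      simp only [ofReal_zero, zero_mul, add_zero, add_sub_cancel_left]
      rw [div_self (exp_ne_zero _), mul_one, exp_add]) (mem_univ 0) (by simp)
  have h2 := h1 (mem_univ (2 * Real.pi))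
  simp only at h2
  rw [show exp (Real.log r + ((2 * Real.pi : ℝ) : ℂ) * I) = exp (Real.log r + ((0 : ℝ) : ℂ) * I) by
    rw [exp_eq_exp_iff_exists_int]; exact ⟨1, by push_cast; ring⟩] at h2
  have h3 : ((2 * Real.pi : ℝ) : ℂ) * I = 0 := by linear_combination (-1 : ℂ) * h2
  simp [Real.pi_ne_zero] at h3

/-- If `a ∈ A`, `b ∈ A'` with `A`, `A'` disjoint compact sets, then `(z - a) / (z - b)` has no
continuous logarithm off `A ∪ A'`. -/
lemma no_log_off_separated {A A' : Set ℂ} (hA : IsCompact A) (hA' : IsCompact A')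
    (hd : Disjoint A A') {a b : ℂ} (ha : a ∈ A) (hb : b ∈ A') {L : ℂ → ℂ}
    (hL : ContinuousOn L (A ∪ A')ᶜ)
    (h : ∀ z ∈ (A ∪ A')ᶜ, exp (L z) = (z - a) / (z - b)) : False := by
  classical
  obtain ⟨k, hk, hkc, hAk, hkA'⟩ := exists_compact_closed_between hA hA'.isClosed.isOpen_compl
    hd.subset_compl_right
  obtain ⟨l, hl, hlc, hkl, hlA'⟩ := exists_compact_closed_between hk hA'.isClosed.isOpen_compl hkA'
  obtain ⟨χ, hχ1, hχ0, -, -⟩ := exists_continuous_one_zero_of_isCompact hk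
    isOpen_interior.isClosed_compl (disjoint_compl_right_iff_subset.mpr hkl)
  have hab : ∀ z ∈ (A ∪ A')ᶜ, z - a ≠ 0 ∧ z - b ≠ 0 := fun z hz =>
    ⟨fun e => hz (Or.inl (by rwa [sub_eq_zero.1 e])), fun e => hz (Or.inr (by rwa [sub_eq_zero.1 e]))⟩
  let F : ℂ → ℂ := fun z => if z ∈ A then z - b else if z ∈ A' then z - a
    else (z - a) * exp (-(χ z : ℂ) * L z)
  have F1 : ∀ z ∈ k, F z = z - b := by
    intro z hz
    by_cases h1 : z ∈ A
    · simp [F, h1]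
    have h2 : z ∉ A' := fun h => hkA' hz h
    have h3 : z ∈ (A ∪ A')ᶜ := by simp [h1, h2]
    have h4 : χ z = 1 := hχ1 hz
    obtain ⟨h5, h6⟩ := hab z h3
    simp only [F, h1, h2, if_false, h4]
    rw [ofReal_one, neg_one_mul, exp_neg, h z h3]
    field_simp
  have F0 : ∀ z ∉ interior l, F z = z - a := by
    intro z hz
    have h1 : z ∉ A := fun h => hz (hkl (interior_subset (hAk h)))
    have h4 : χ z = 0 := hχ0 hz
    by_cases h2 : z ∈ A'
    · simp [F, h1, h2]
    simp [F, h1, h2, h4]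
  have Fc : Continuous F := by
    rw [continuous_iff_continuousAt]
    intro z
    by_cases h1 : z ∈ A
    · have : F =ᶠ[nhds z] fun z => z - b := by
        filter_upwards [isOpen_interior.mem_nhds (hAk h1)] with y hy using F1 y (interior_subset hy)
      exact ContinuousAt.congr (by fun_prop) this.symm
    by_cases h2 : z ∈ A'
    · have : F =ᶠ[nhds z] fun z => z - a := by
        filter_upwards [hlc.isOpen_compl.mem_nhds (fun h => hlA' h h2)] with y hy
          using F0 y (fun h => hy (interior_subset h))
      exact ContinuousAt.congr (by fun_prop) this.symm
    have h3 : z ∈ (A ∪ A')ᶜ := by simp [h1, h2]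
    have ho : IsOpen (A ∪ A')ᶜ := (hA.isClosed.union hA'.isClosed).isOpen_compl
    have : F =ᶠ[nhds z] fun z => (z - a) * exp (-(χ z : ℂ) * L z) := by
      filter_upwards [ho.mem_nhds h3] with y hy
      simp only [mem_compl_iff, mem_union, not_or] at hy
      simp [F, hy.1, hy.2]
    refine ContinuousAt.congr ?_ this.symm
    have hLz : ContinuousAt L z := hL.continuousAt (ho.mem_nhds h3)
    fun_prop
  have Fne : ∀ z, F z ≠ 0 := by
    intro z
    by_cases h1 : z ∈ A
    · rw [F1 z (interior_subset (hAk h1)), sub_ne_zero]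
      rintro rfl
      exact disjoint_left.1 hd h1 hb
    by_cases h2 : z ∈ A'
    · rw [F0 z (fun h => hlA' (interior_subset h) h2), sub_ne_zero]
      rintro rfl
      exact h1 ha
    have h3 : z ∈ (A ∪ A')ᶜ := by simp [h1, h2]
    simp only [F, h1, h2, if_false]
    exact mul_ne_zero (hab z h3).1 (exp_ne_zero _)
  obtain ⟨ℓ, hℓ, hℓF⟩ := exists_continuous_log Fc Fne
  obtain ⟨r, hr⟩ := hl.isBounded.subset_closedBall a
  refine no_log_on_circle (a := a) (r := |r| + 1) (by positivity) (L := ℓ) hℓ.continuousOn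
    fun z hz => ?_
  rw [hℓF, F0]
  intro hzl
  have := hr (interior_subset hzl)
  rw [mem_closedBall, mem_sphere.1 hz] at this
  linarith [le_abs_self r]

/-- If a cross-cut joins two points that are separated in `K ∖ B` for an open set `B`, then `B`
meets the region cut off. -/
lemma crossCutRegion_inter_nonempty {K : Set ℂ} (hK : IsCompact K) {γ : ℝ → ℂ}
    (hγ : CrossCut K γ) {L : ℂ → ℂ} (hL : ContinuousOn L Kᶜ)
    (hLe : ∀ z ∉ K, exp (L z) = (z - γ 0) / (z - γ 1))
    (hLi : ∃ R : ℝ, ∀ z, R < ‖z‖ → z ∉ K ∧ ‖L z‖ < 1)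
    {B O₁ O₂ : Set ℂ} (hB : IsOpen B) (hO₁ : IsOpen O₁) (hO₂ : IsOpen O₂)
    (hd : Disjoint O₁ O₂) (hcov : K \ B ⊆ O₁ ∪ O₂) (h0 : γ 0 ∈ O₁ \ B) (h1 : γ 1 ∈ O₂ \ B) :
    (B ∩ CrossCutRegion K γ).Nonempty := by
  classical
  by_contra hemp
  obtain ⟨hγc, hγi, ha, hb, hne, hγK⟩ := hγ
  obtain ⟨M, hMc, hMe, R', hR'⟩ := exists_log_off_arc hγc
  obtain ⟨R, hR⟩ := hLi
  set Γ := γ '' Icc 0 1 with hΓ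
  have hΓc : IsClosed Γ := (isCompact_Icc.image_of_continuousOn hγc).isClosed
  have hLM : ∀ z ∈ B, z ∉ K ∪ Γ → L z = M z := by
    intro z hzB hz
    have hnb : ¬ Bornology.IsBounded (connectedComponentIn (K ∪ Γ)ᶜ z) := fun h =>
      hemp ⟨z, hzB, hz, h⟩
    set C := connectedComponentIn (K ∪ Γ)ᶜ z
    have hCs : C ⊆ (K ∪ Γ)ᶜ := connectedComponentIn_subset _ _
    obtain ⟨y, hy, hyn⟩ : ∃ y ∈ C, max R R' < ‖y‖ := by
      by_contra hcon
      push Not at hcon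
      exact hnb (isBounded_iff_forall_norm_le.2 ⟨_, hcon⟩)
    have hyK : y ∉ K := fun h => hCs hy (Or.inl h)
    have hyΓ : y ∉ Γ := fun h => hCs hy (Or.inr h)
    have he : ∀ x ∈ C, exp (L x) = exp (M x) := fun x hx => by
      rw [hLe x (fun h => hCs hx (Or.inl h)), hMe x (fun h => hCs hx (Or.inr h))]
    refine eqOn_of_exp_eqOn isPreconnected_connectedComponentIn
      (hL.mono (hCs.trans (compl_subset_compl.2 subset_union_left)))
      (hMc.mono (hCs.trans (compl_subset_compl.2 subset_union_right))) he hy ?_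
      (mem_connectedComponentIn hz)
    obtain ⟨n, hn⟩ := exp_eq_exp_iff_exists_int.1 (he y hy)
    have l1 := (hR y ((le_max_left _ _).trans_lt hyn)).2
    have l2 := (hR' y ((le_max_right _ _).trans_lt hyn)).2
    have l3 : ‖L y - M y‖ < 2 := (norm_sub_le _ _).trans_lt (by linarith)
    rw [hn, add_sub_cancel_left] at l3
    have hn0 : n = 0 := by
      by_contra hn0
      have h1n : (1 : ℝ) ≤ |(n : ℝ)| := by exact_mod_cast Int.one_le_abs hn0
      rw [norm_mul] at l3
      simp [abs_of_pos Real.pi_pos] at l3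
      nlinarith [Real.pi_gt_three]
    rw [hn, hn0]; simp
  have hA1 : IsCompact ((K \ B) \ O₂) := (hK.diff hB).diff hO₂
  have hA2 : IsCompact ((K \ B) \ O₁) := (hK.diff hB).diff hO₁
  have hdis : Disjoint ((K \ B) \ O₂) ((K \ B) \ O₁) := by
    rw [disjoint_left]
    rintro x ⟨hx, hx2⟩ ⟨-, hx1⟩
    rcases hcov hx with h | h
    exacts [hx1 h, hx2 h]
  have hun : ((K \ B) \ O₂ ∪ (K \ B) \ O₁)ᶜ = Kᶜ ∪ B := by
    ext x
    have hdx : x ∈ O₁ → x ∉ O₂ := fun h => disjoint_left.1 hd h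
    simp only [mem_compl_iff, mem_union, Set.mem_sdiff]
    tauto
  have hopen : IsOpen Kᶜ := hK.isClosed.isOpen_compl
  have hKΓ : ∀ x ∈ K, x ∈ B → x ∉ Γ := by
    rintro x hx hxB ⟨t, ht, rfl⟩
    rcases eq_or_lt_of_le ht.1 with h | h
    · rw [← h] at hxB; exact h0.2 hxB
    rcases eq_or_lt_of_le ht.2 with h' | h'
    · rw [h'] at hxB; exact h1.2 hxB
    exact hγK t ⟨h, h'⟩ hx
  let N : ℂ → ℂ := fun z => if z ∈ K then M z else L z
  have hNL : ∀ z ∉ K, N z = L z := fun z hz => if_neg hz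
  have hNM : ∀ z ∈ B, z ∉ Γ → N z = M z := by
    intro z hzB hz
    by_cases hzK : z ∈ K
    · simp [N, hzK]
    · rw [hNL z hzK, hLM z hzB (by simp [hzK, hz])]
  refine no_log_off_separated hA1 hA2 hdis (a := γ 0) (b := γ 1)
    ⟨⟨ha, h0.2⟩, disjoint_left.1 hd h0.1⟩ ⟨⟨hb, h1.2⟩, fun h => disjoint_left.1 hd h h1.1⟩
    (L := N) ?_ ?_
  · rw [hun]
    intro z hz
    refine ContinuousAt.continuousWithinAt ?_
    by_cases hzK : z ∈ K
    · have hzB : z ∈ B := hz.resolve_left (fun h => h hzK)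
      have hzΓ := hKΓ z hzK hzB
      refine (hMc.continuousAt (hΓc.isOpen_compl.mem_nhds hzΓ)).congr ?_
      filter_upwards [hB.mem_nhds hzB, hΓc.isOpen_compl.mem_nhds hzΓ] with y hy hy'
        using (hNM y hy hy').symm
    · refine (hL.continuousAt (hopen.mem_nhds hzK)).congr ?_
      filter_upwards [hopen.mem_nhds hzK] with y hy using (hNL y hy).symm
  · rw [hun]
    intro z hz
    by_cases hzK : z ∈ K
    · have hzB : z ∈ B := hz.resolve_left (fun h => h hzK)
      have hzΓ := hKΓ z hzK hzB
      rw [hNM z hzB hzΓ, hMe z hzΓ]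
    · rw [hNL z hzK, hLe z hzK]

/-- Off a decreasing intersection of path-connected compact sets with connected complements there is
a continuous logarithm of `(z - a) / (z - b)`, small near infinity. -/
lemma exists_log_off_inter {K : ℕ → Set ℂ} (hKa : Antitone K) (hKc : ∀ n, IsCompact (K n))
    (hKp : ∀ n, IsPathConnected (K n)) (hco : ∀ n, IsConnected (K n)ᶜ) {a b : ℂ}
    (ha : ∀ n, a ∈ K n) (hb : ∀ n, b ∈ K n) :
    ∃ L : ℂ → ℂ, ContinuousOn L (⋂ n, K n)ᶜ ∧
      (∀ z ∉ ⋂ n, K n, exp (L z) = (z - a) / (z - b)) ∧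
      ∃ R : ℝ, ∀ z, R < ‖z‖ → z ∉ ⋂ n, K n ∧ ‖L z‖ < 1 := by
  classical
  have key : ∀ n, ∃ L : ℂ → ℂ, ContinuousOn L (K n)ᶜ ∧
      (∀ z ∉ K n, exp (L z) = (z - a) / (z - b)) ∧
      ∃ R : ℝ, ∀ z, R < ‖z‖ → z ∉ K n ∧ ‖L z‖ < 1 := by
    intro n
    obtain ⟨p, hp⟩ := (hKp n).joinedIn a (ha n) b (hb n)
    have hpe : Continuous p.extend := p.continuous_extend
    obtain ⟨M, hM, hMe, R, hR⟩ := exists_log_off_arc (σ := p.extend) hpe.continuousOn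
    have hsub : p.extend '' Icc 0 1 ⊆ K n := by
      rintro _ ⟨t, ht, rfl⟩
      rw [p.extend_apply ht]
      exact hp _
    obtain ⟨C, hC⟩ := (hKc n).isBounded.exists_norm_le
    refine ⟨M, hM.mono (compl_subset_compl.2 hsub), fun z hz => ?_, max C R, fun z hz => ⟨fun h => ?_,
      (hR z ((le_max_right _ _).trans_lt hz)).2⟩⟩
    · have := hMe z (fun h => hz (hsub h))
      simpa using this
    · exact absurd (hC z h) (not_le.2 ((le_max_left _ _).trans_lt hz))
  choose L hLc hLe R hR using key
  have agree : ∀ m n, m ≤ n → ∀ z ∉ K m, L n z = L m z := by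
    intro m n hmn
    have hs : (K m)ᶜ ⊆ (K n)ᶜ := compl_subset_compl.2 (hKa hmn)
    obtain ⟨y, hy⟩ : ∃ y : ℂ, max (R m) (R n) < ‖y‖ :=
      ⟨((|max (R m) (R n)| + 1 : ℝ) : ℂ), by
        rw [norm_real, Real.norm_of_nonneg (by positivity)]; linarith [le_abs_self (max (R m) (R n))]⟩
    have hm := hR m y ((le_max_left _ _).trans_lt hy)
    have hn := hR n y ((le_max_right _ _).trans_lt hy)
    have he : ∀ x ∈ (K m)ᶜ, exp (L n x) = exp (L m x) := fun x hx => by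
      rw [hLe m x hx, hLe n x (hs hx)]
    refine fun z hz => eqOn_of_exp_eqOn (hco m).isPreconnected ((hLc n).mono hs) (hLc m) he hm.1 ?_ hz
    obtain ⟨k, hk⟩ := exp_eq_exp_iff_exists_int.1 (he y hm.1)
    have l3 : ‖L n y - L m y‖ < 2 := (norm_sub_le _ _).trans_lt (by linarith [hm.2, hn.2])
    rw [hk, add_sub_cancel_left] at l3
    have hn0 : k = 0 := by
      by_contra hn0
      have h1n : (1 : ℝ) ≤ |(k : ℝ)| := by exact_mod_cast Int.one_le_abs hn0
      rw [norm_mul] at l3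
      simp [abs_of_pos Real.pi_pos] at l3
      nlinarith [Real.pi_gt_three]
    rw [hk, hn0]; simp
  have hex : ∀ z, z ∉ ⋂ n, K n → ∃ n, z ∉ K n := fun z hz => by simpa using hz
  let N : ℂ → ℂ := fun z => if h : z ∉ ⋂ n, K n then L (Nat.find (hex z h)) z else 0
  have hN : ∀ n, ∀ z ∉ K n, N z = L n z := by
    intro n z hz
    have h : z ∉ ⋂ n, K n := fun h => hz (mem_iInter.1 h n)
    simp only [N, dif_pos h]
    exact (agree _ n (Nat.find_min' (hex z h) hz) z (Nat.find_spec (hex z h))).symm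
  refine ⟨N, fun z hz => ?_, fun z hz => ?_, R 0, fun z hz => ⟨fun h => (hR 0 z hz).1
    (mem_iInter.1 h 0), ?_⟩⟩
  · obtain ⟨n, hn⟩ := hex z hz
    have ho : IsOpen (K n)ᶜ := (hKc n).isClosed.isOpen_compl
    refine (((hLc n).continuousAt (ho.mem_nhds hn)).congr ?_).continuousWithinAt
    filter_upwards [ho.mem_nhds hn] with y hy using (hN n y hy).symm
  · obtain ⟨n, hn⟩ := hex z hz
    rw [hN n z hn, hLe n z hn]
  · rw [hN 0 z (hR 0 z hz).1]
    exact (hR 0 z hz).2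

lemma isOpen_image_of_deriv_ne_zero {G : ℂ → ℂ} {U V : Set ℂ} (hU : IsOpen U)
    (hG : DifferentiableOn ℂ G U) (hG' : ∀ z ∈ U, deriv G z ≠ 0) (hV : IsOpen V) (hVU : V ⊆ U) :
    IsOpen (G '' V) := by
  rw [isOpen_iff_mem_nhds]
  rintro _ ⟨z, hz, rfl⟩
  have h1 : HasStrictDerivAt G (deriv G z) z :=
    (hG.analyticAt (hU.mem_nhds (hVU hz))).hasStrictDerivAt
  rw [← h1.map_nhds_eq (hG' z (hVU hz))]
  exact image_mem_map (hV.mem_nhds hz)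

lemma isConnected_annulus {r R : ℝ} (hr : 0 < r) (hrR : r < R) :
    IsConnected (ball (0 : ℂ) R \ closedBall 0 r) := by
  have h1 : (ball (0 : ℂ) R \ closedBall 0 r) = exp '' {z | z.re ∈ Ioo (Real.log r) (Real.log R)} := by
    ext z
    simp only [Set.mem_sdiff, mem_ball, mem_closedBall, dist_zero_right, not_le, mem_image, mem_ofPred_eq,
      mem_Ioo]
    constructor
    · rintro ⟨h1, h2⟩
      have hz : z ≠ 0 := norm_pos_iff.1 (hr.trans h2)
      refine ⟨log z, ?_, exp_log hz⟩
      rw [log_re]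
      exact ⟨Real.log_lt_log hr h2, Real.log_lt_log (hr.trans h2) h1⟩
    · rintro ⟨w, ⟨h1, h2⟩, rfl⟩
      rw [norm_exp]
      exact ⟨(Real.lt_log_iff_exp_lt (hr.trans hrR)).1 h2, (Real.log_lt_iff_lt_exp hr).1 h1⟩
  rw [h1]
  refine IsConnected.image ?_ _ continuous_exp.continuousOn
  refine ⟨?_, ?_⟩
  · obtain ⟨x, hx⟩ := exists_between (Real.log_lt_log hr hrR)
    exact ⟨x, by simpa using hx⟩
  · exact ((convex_Ioo (Real.log r) (Real.log R)).linear_preimage reLm).isPreconnected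

/-- The complement of the image of a closed disk under a univalent map is connected. -/
lemma isConnected_compl_image_closedBall {G : ℂ → ℂ} {r R : ℝ} (hr : 0 < r) (hrR : r < R)
    (hG : DifferentiableOn ℂ G (ball 0 R)) (hG' : ∀ z ∈ ball 0 R, deriv G z ≠ 0)
    (hi : InjOn G (ball 0 R)) : IsConnected (G '' closedBall 0 r)ᶜ := by
  have hK : IsCompact (G '' closedBall 0 r) := (isCompact_closedBall 0 r).image_of_continuousOn
    (hG.continuousOn.mono (closedBall_subset_ball hrR))
  set S := (G '' closedBall 0 r)ᶜ with hS
  have hSo : IsOpen S := hK.isClosed.isOpen_compl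
  have hsub : closedBall (0 : ℂ) r ⊆ ball 0 R := closedBall_subset_ball hrR
  have hC := (isConnected_annulus hr hrR).image G
    (hG.continuousOn.mono sdiff_subset)
  set C := G '' (ball (0 : ℂ) R \ closedBall 0 r) with hCdef
  have hCS : C ⊆ S := by
    rintro _ ⟨z, hz, rfl⟩ ⟨w, hw, hwz⟩
    exact hz.2 (hi (hsub hw) hz.1 hwz ▸ hw)
  refine ⟨hC.nonempty.mono hCS, ?_⟩
  -- one of two separating sets must contain the collar
  have key : ∀ u v : Set ℂ, IsOpen u → IsOpen v → S ⊆ u ∪ v → (S ∩ v).Nonempty →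
      (S ∩ u ∩ (S ∩ v)) = ∅ → C ⊆ u → False := by
    intro u v hu hv hcov hvn hd hCu
    have hVo : IsOpen (S ∩ u ∪ G '' (ball 0 R \ {0})) :=
      (hSo.inter hu).union (isOpen_image_of_deriv_ne_zero isOpen_ball hG hG'
        (isOpen_ball.sdiff isClosed_singleton) sdiff_subset)
    have h0 := (isConnected_compl_singleton_of_one_lt_rank (E := ℂ) (by simp) (G 0)).isPreconnected
    obtain ⟨x, -, hx1, hx2⟩ := h0 _ _ hVo (hSo.inter hv) (by
      intro x hx
      by_cases hxS : x ∈ S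
      · rcases hcov hxS with h | h
        exacts [Or.inl (Or.inl ⟨hxS, h⟩), Or.inr ⟨hxS, h⟩]
      · obtain ⟨z, hz, rfl⟩ := not_not.1 hxS
        exact Or.inl (Or.inr ⟨z, ⟨hsub hz, fun h => hx (by rw [mem_singleton_iff.1 h]; rfl)⟩, rfl⟩))
      (by
        obtain ⟨x, hx⟩ := hC.nonempty
        refine ⟨x, fun h => ?_, Or.inl ⟨hCS hx, hCu hx⟩⟩
        rw [mem_singleton_iff.1 h] at hx
        exact hCS hx ⟨0, by simp [hr.le], rfl⟩)
      (by
        obtain ⟨x, hx⟩ := hvn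
        refine ⟨x, fun h => ?_, hx⟩
        exact hx.1 ⟨0, by simp [hr.le], (mem_singleton_iff.1 h).symm⟩)
    rcases hx1 with h | ⟨z, hz, rfl⟩
    · exact (eq_empty_iff_forall_notMem.1 hd) x ⟨h, hx2⟩
    · by_cases hzr : z ∈ closedBall (0 : ℂ) r
      · exact hx2.1 ⟨z, hzr, rfl⟩
      · have hzC : G z ∈ C := ⟨z, ⟨hz.1, hzr⟩, rfl⟩
        exact (eq_empty_iff_forall_notMem.1 hd) _ ⟨⟨hx2.1, hCu hzC⟩, hx2⟩
  intro u v hu hv hcov hun hvn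
  by_contra hd
  rw [not_nonempty_iff_eq_empty] at hd
  have hd1 : (S ∩ u ∩ (S ∩ v)) = ∅ := by rw [← hd]; ext; simp only [mem_inter_iff]; tauto
  have hd2 : (S ∩ v ∩ (S ∩ u)) = ∅ := by rw [← hd]; ext; simp only [mem_inter_iff]; tauto
  by_cases hCu : C ⊆ u
  · exact key u v hu hv hcov hvn hd1 hCu
  · obtain ⟨x, hx, hxu⟩ := not_subset.1 hCu
    refine key v u hv hu (by rwa [union_comm]) hun hd2 fun y hy => ?_
    by_contra hyv
    have hxv := (hcov (hCS hx)).resolve_left hxu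
    have hyu := (hcov (hCS hy)).resolve_right hyv
    obtain ⟨z, hz, hzu, hzv⟩ := hC.isPreconnected u v hu hv (hCS.trans hcov) ⟨y, hy, hyu⟩ ⟨x, hx, hxv⟩
    exact (eq_empty_iff_forall_notMem.1 hd) z ⟨hCS hz, hzu, hzv⟩

/-- A nonvanishing holomorphic function on a disk has a holomorphic logarithm. -/
lemma exists_holomorphic_log {f : ℂ → ℂ} {R : ℝ} (hR : 0 < R) (hf : DifferentiableOn ℂ f (ball 0 R))
    (h0 : ∀ z ∈ ball 0 R, f z ≠ 0) :
    ∃ ℓ : ℂ → ℂ, DifferentiableOn ℂ ℓ (ball 0 R) ∧ ∀ z ∈ ball 0 R, exp (ℓ z) = f z := by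
  have h1 : DifferentiableOn ℂ (fun z => deriv f z / f z) (ball 0 R) :=
    (hf.deriv isOpen_ball).div hf h0
  obtain ⟨ℓ, hℓ0, hℓ⟩ := h1.isExactOn_ball.with_val_at 0 (log (f 0))
  have m0 : (0 : ℂ) ∈ ball (0 : ℂ) R := mem_ball_self hR
  refine ⟨ℓ, fun z hz => (hℓ z hz).differentiableAt.differentiableWithinAt, fun z hz => ?_⟩
  have hd : ∀ w ∈ ball (0 : ℂ) R, HasDerivAt (fun w => f w * exp (-ℓ w)) 0 w := by
    intro w hw
    have hfw : HasDerivAt f (deriv f w) w :=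
      (hf.differentiableAt (isOpen_ball.mem_nhds hw)).hasDerivAt
    have := hfw.mul (hℓ w hw).neg.cexp
    convert! this using 1
    have := h0 w hw
    field_simp
    ring
  have hc := isOpen_ball.is_const_of_deriv_eq_zero (convex_ball (0 : ℂ) R).isPreconnected
    (fun w hw => (hd w hw).differentiableAt.differentiableWithinAt) (fun w hw => (hd w hw).deriv)
    m0 hz
  simp only [hℓ0, exp_neg, exp_log (h0 0 m0), mul_inv_cancel₀ (h0 0 m0)] at hc
  rw [eq_comm, ← div_eq_mul_inv, div_eq_one_iff_eq (exp_ne_zero _)] at hc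
  exact hc.symm

/-- Runge approximation: functions holomorphic near a closed disk are uniform limits on it of
polynomials in a given univalent function. -/
lemma exists_polynomial_comp_approx {G : ℂ → ℂ} {r R : ℝ} (hr : 0 < r) (hrR : r < R)
    (hG : DifferentiableOn ℂ G (ball 0 R)) (hG' : ∀ z ∈ ball 0 R, deriv G z ≠ 0)
    (hi : InjOn G (ball 0 R)) {F : ℂ → ℂ} (hF : DifferentiableOn ℂ F (ball 0 R))
    {η : ℝ} (hη : 0 < η) :
    ∃ P : Polynomial ℂ, ∀ s ∈ closedBall (0 : ℂ) r, ‖P.eval (G s) - F s‖ < η := by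
  obtain ⟨ρ, hrρ, hρR⟩ := exists_between hrR
  have hsub : closedBall (0 : ℂ) r ⊆ ball 0 R := closedBall_subset_ball hrR
  have hsubρ : closedBall (0 : ℂ) ρ ⊆ ball 0 R := closedBall_subset_ball hρR
  have hsph : sphere (0 : ℂ) ρ ⊆ ball 0 R := sphere_subset_closedBall.trans hsubρ
  have hρ0 : 0 < ρ := hr.trans hrρ
  have : CompactSpace (closedBall (0 : ℂ) r) := isCompact_iff_compactSpace.1 (isCompact_closedBall 0 r)
  let x : C(closedBall (0 : ℂ) r, ℂ) :=
    ⟨fun s => G s, continuousOn_iff_continuous_domRestrict.1 (hG.continuousOn.mono hsub)⟩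
  let S : Subalgebra ℂ C(closedBall (0 : ℂ) r, ℂ) := Algebra.elemental ℂ x
  have hSc : IsClosed (S : Set C(closedBall (0 : ℂ) r, ℂ)) := Algebra.elemental.isClosed ℂ x
  have : CompleteSpace S := hSc.completeSpace_coe
  let x' : S := ⟨x, Algebra.elemental.self_mem ℂ x⟩
  have hspec : spectrum ℂ x = G '' closedBall 0 r := by
    rw [ContinuousMap.spectrum_eq_range]
    ext z
    constructor
    · rintro ⟨s, rfl⟩
      exact ⟨s, s.2, rfl⟩
    · rintro ⟨s, hs, rfl⟩
      exact ⟨⟨s, hs⟩, rfl⟩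
  have hspec' : spectrum ℂ x' = G '' closedBall 0 r := by
    rw [← hspec]
    refine Subalgebra.spectrum_eq_of_isPreconnected_compl S x' ?_
    change IsPreconnected (spectrum ℂ x)ᶜ
    rw [hspec]
    exact (isConnected_compl_image_closedBall hr hrR hG hG' hi).isPreconnected
  have hunit : ∀ σ ∈ sphere (0 : ℂ) ρ, IsUnit (algebraMap ℂ S (G σ) - x') := by
    intro σ hσ
    have : G σ ∉ spectrum ℂ x' := by
      rw [hspec']
      rintro ⟨z, hz, hzσ⟩
      have := hi (hsub hz) (hsph hσ) hzσ
      rw [this, mem_closedBall, mem_sphere.1 hσ] at hz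
      linarith
    exact spectrum.notMem_iff.1 this
  let y : ℂ → S := fun σ => Ring.inverse (algebraMap ℂ S (G σ) - x')
  have hyc : ContinuousOn y (sphere (0 : ℂ) ρ) := by
    intro σ hσ
    obtain ⟨u, hu⟩ := hunit σ hσ
    have h1 : ContinuousAt Ring.inverse (algebraMap ℂ S (G σ) - x') := by
      rw [← hu]; exact NormedRing.inverse_continuousAt u
    have h2 : ContinuousWithinAt (fun σ => algebraMap ℂ S (G σ) - x') (sphere (0 : ℂ) ρ) σ :=
      ((continuous_algebraMap ℂ S).continuousAt.comp_continuousWithinAt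
        ((hG.continuousOn.mono hsph) σ hσ)).sub continuousWithinAt_const
    exact ContinuousAt.comp_continuousWithinAt (f := fun σ => algebraMap ℂ S (G σ) - x') h1 h2
  let ev : closedBall (0 : ℂ) r → (S →L[ℂ] ℂ) := fun s =>
    (ContinuousMap.evalCLM ℂ s).comp S.toSubmodule.subtypeL
  have hevy : ∀ s, ∀ σ ∈ sphere (0 : ℂ) ρ, ev s (y σ) = (G σ - G s)⁻¹ := by
    intro s σ hσ
    have h1 : (algebraMap ℂ S (G σ) - x') * y σ = 1 := Ring.mul_inverse_cancel _ (hunit σ hσ)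
    have h2 := congrArg (fun a : S => (a : C(closedBall (0 : ℂ) r, ℂ)) s) h1
    have h3 : (G σ - G s) * ((y σ : C(closedBall (0 : ℂ) r, ℂ)) s) = 1 := h2
    change (y σ : C(closedBall (0 : ℂ) r, ℂ)) s = _
    exact eq_inv_of_mul_eq_one_right h3
  have hG1 : DifferentiableOn ℂ (deriv G) (ball 0 R) := hG.deriv isOpen_ball
  have hFint : ContinuousOn (fun σ => (F σ * deriv G σ) • y σ) (sphere (0 : ℂ) ρ) :=
    ((hF.continuousOn.mono hsph).mul (hG1.continuousOn.mono hsph)).smul hyc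
  let J : S := (2 * Real.pi * I : ℂ)⁻¹ • ∮ σ in C(0, ρ), (F σ * deriv G σ) • y σ
  have hJ : ∀ s : closedBall (0 : ℂ) r, ((J : S) : C(closedBall (0 : ℂ) r, ℂ)) s = F s := by
    intro s
    have hs : (s : ℂ) ∈ ball (0 : ℂ) R := hsub s.2
    have h1 : ((J : S) : C(closedBall (0 : ℂ) r, ℂ)) s = ev s J := rfl
    have hci : CircleIntegrable (fun σ => (F σ * deriv G σ) • y σ) 0 ρ :=
      hFint.circleIntegrable hρ0.le
    have h2 : ev s (∮ σ in C(0, ρ), (F σ * deriv G σ) • y σ) =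
        ∮ σ in C(0, ρ), ev s ((F σ * deriv G σ) • y σ) := by
      rw [circleIntegral, circleIntegral, ← ContinuousLinearMap.intervalIntegral_comp_comm _ hci.out]
      simp only [map_smul]
    let φ : ℂ → ℂ := fun σ => F σ * deriv G σ / dslope G s σ
    have hne : ∀ σ ∈ ball (0 : ℂ) R, dslope G s σ ≠ 0 := by
      intro σ hσ
      by_cases h : σ = s
      · rw [h, dslope_same]; exact hG' _ hs
      · rw [dslope_of_ne _ h, slope_def_field]
        exact div_ne_zero (sub_ne_zero.2 fun e => h (hi hσ hs e)) (sub_ne_zero.2 h)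
    have hφ : DifferentiableOn ℂ φ (ball 0 R) :=
      (hF.mul hG1).div ((differentiableOn_dslope (isOpen_ball.mem_nhds hs)).2 hG) hne
    have h3 : (∮ σ in C(0, ρ), ev s ((F σ * deriv G σ) • y σ)) =
        ∮ σ in C(0, ρ), (σ - s)⁻¹ • φ σ := by
      refine circleIntegral.integral_congr hρ0.le fun σ hσ => ?_
      have hσs : σ ≠ s := by
        rintro rfl
        have := s.2
        rw [mem_closedBall, mem_sphere.1 hσ] at this
        linarith
      have h4 := hevy s σ hσ
      simp only [map_smul, h4, φ, smul_eq_mul]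
      rw [dslope_of_ne _ hσs, slope_def_field]
      have h5 : G σ - G s ≠ 0 := sub_ne_zero.2 fun e => hσs (hi (hsph hσ) hs e)
      have h6 := sub_ne_zero.2 hσs
      field_simp
    have hsρ : (s : ℂ) ∈ ball (0 : ℂ) ρ := closedBall_subset_ball hrρ s.2
    rw [h1]
    simp only [J, map_smul]
    rw [h2, h3, (hφ.mono hsubρ).circleIntegral_sub_inv_smul hsρ]
    simp only [φ, dslope_same, smul_eq_mul]
    have := hG' _ hs
    field_simp
  have hmem : (J : C(closedBall (0 : ℂ) r, ℂ)) ∈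
      closure ((Algebra.adjoin ℂ {x} : Subalgebra ℂ _) : Set C(closedBall (0 : ℂ) r, ℂ)) := J.2
  obtain ⟨p, hp, hpJ⟩ := Metric.mem_closure_iff.1 hmem η hη
  have hp' : p ∈ Algebra.adjoin ℂ {x} := hp
  rw [Algebra.adjoin_singleton_eq_range_aeval] at hp'
  obtain ⟨P, hP⟩ := hp'
  refine ⟨P, fun s hs => ?_⟩
  have h1 : p ⟨s, hs⟩ = P.eval (G s) := by
    rw [← hP]
    change ContinuousMap.evalAlgHom ℂ ℂ (⟨s, hs⟩ : closedBall (0 : ℂ) r) (Polynomial.aeval x P) = _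
    rw [← Polynomial.aeval_algHom_apply, Polynomial.coe_aeval_eq_eval]
    rfl
  rw [← h1, ← hJ ⟨s, hs⟩, ← dist_eq_norm, dist_comm]
  exact (ContinuousMap.dist_apply_le_dist _).trans_lt hpJ

theorem exists_spiral_parameters {κ δ : ℝ} (hκ : 0 < κ) (hδ : 0 < δ) (q : ℕ) :
    ∃ A L τ : ℝ, 0 < A ∧ 0 < τ ∧ τ < 1 / 4 ∧ A * (1 + κ ^ 2) * Real.pi ≤ δ / 4 ∧
      A * Real.log (4 / τ) + κ * A * Real.pi + δ / 4 = L ∧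
      Real.exp (-L) ≤ δ ^ q * (δ / (16 * (1 + κ))) ∧ Real.exp (-L) + Real.exp (-(δ / 4)) < 1 ∧
      κ * A * Real.pi + A * Real.log 8 ≤ 3 * δ / 4 := by
  have hπ := Real.pi_gt_three
  let A := δ / (4 * Real.pi * (1 + κ ^ 2))
  have hA : 0 < A := by positivity
  have hA1 : A * (1 + κ ^ 2) * Real.pi = δ / 4 := by
    simp only [A]; field_simp
  let ε := min (δ ^ q * (δ / (16 * (1 + κ)))) ((1 - Real.exp (-(δ / 4))) / 2)
  have hlt : Real.exp (-(δ / 4)) < 1 := by rw [Real.exp_lt_one_iff]; linarith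
  have hε : 0 < ε := lt_min (by positivity) (by linarith)
  let M := max 3 (-Real.log ε / A)
  have hM : 3 ≤ M := le_max_left _ _
  have hM' : -Real.log ε ≤ A * M := by
    have : -Real.log ε / A ≤ M := le_max_right _ _
    rwa [div_le_iff₀ hA, mul_comm] at this
  have hlog : Real.log (4 / (4 * Real.exp (-M))) = M := by
    rw [Real.exp_neg]
    have : (4 : ℝ) / (4 * (Real.exp M)⁻¹) = Real.exp M := by field_simp
    rw [this, Real.log_exp]
  have he : (16 : ℝ) < Real.exp M := by
    have h1 := Real.exp_one_gt_d9
    have h2 : Real.exp 3 = Real.exp 1 ^ 3 := by rw [← Real.exp_nat_mul]; norm_num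
    have h3 : (2.7 : ℝ) ^ 3 ≤ Real.exp 1 ^ 3 := by gcongr; linarith
    have h4 := Real.exp_le_exp.2 hM
    norm_num at h3
    linarith
  have hLe : Real.exp (-(A * M + κ * A * Real.pi + δ / 4)) ≤ ε := by
    rw [← Real.le_log_iff_exp_le hε]
    have : 0 < κ * A * Real.pi := by positivity
    linarith
  have hκA : κ * A * Real.pi ≤ δ / 8 := by
    have : 0 ≤ A * Real.pi * (1 - κ) ^ 2 := by positivity
    nlinarith
  refine ⟨A, A * M + κ * A * Real.pi + δ / 4, 4 * Real.exp (-M), hA, by positivity, ?_, hA1.le,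
    by rw [hlog], hLe.trans (min_le_left _ _), ?_, ?_⟩
  · rw [Real.exp_neg, ← div_eq_mul_inv, div_lt_iff₀ (by positivity)]
    linarith
  · have := hLe.trans (min_le_right _ _)
    linarith
  · have h8 : Real.log 8 < 3 := by
      have : (8 : ℝ) = 2 ^ 3 := by norm_num
      rw [this, Real.log_pow]
      have := Real.log_two_lt_d9
      norm_num
      linarith
    have h9 : A * 12 ≤ δ := by
      have : A * Real.pi ≤ δ / 4 := by
        have : 0 ≤ A * κ ^ 2 * Real.pi := by positivity
        nlinarith
      nlinarith
    nlinarith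

theorem norm_log_one_add_le_two {z : ℂ} (hz : ‖z‖ ≤ 1 / 2) : ‖log (1 + z)‖ ≤ 2 * ‖z‖ := by
  have := norm_log_one_add_half_le_self hz
  have h0 := norm_nonneg z
  linarith

set_option maxHeartbeats 1000000 in
theorem exists_spiral_map {κ δ : ℝ} (hκ : 0 < κ) (hδ : 0 < δ) (hδ1 : δ < 1) {q : ℕ} (hq : 1 ≤ q) :
    ∃ (r₁ R₁ R₀ : ℝ) (G : ℂ → ℂ), 0 < r₁ ∧ r₁ < 1 ∧ 1 < R₁ ∧ R₁ < R₀ ∧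
      DifferentiableOn ℂ G (ball 0 R₀) ∧ InjOn G (ball 0 R₀) ∧
      (∀ s ∈ ball (0 : ℂ) R₀, deriv G s ≠ 0) ∧ G 0 = 0 ∧
      (∀ s ∈ closedBall (0 : ℂ) R₁, ‖G s‖ < 1) ∧
      (∀ s ∈ closedBall (0 : ℂ) R₁, ∀ z : ℂ, z ^ q = G s → ‖z‖ < δ ∨
        ∃ (k : ℤ) (ω : ℂ), exp ω = z ∧ |ω.im - κ * ω.re - 2 * Real.pi * k / q| < δ / q) ∧
      (∀ (k : ℤ), ∀ x ∈ Icc (Real.log δ) (-δ), ∃ s ∈ closedBall (0 : ℂ) r₁, ∃ z : ℂ, z ^ q = G s ∧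
        ‖z - exp ((1 + κ * I) * x + (2 * Real.pi * k / q : ℝ) * I)‖ < δ) := by
  obtain ⟨A, L, τ, hA, hτ, hτ1, hA1, hL, hp1, hp2, hA2⟩ := exists_spiral_parameters hκ hδ q
  have hπ := Real.pi_gt_three
  have hq0 : (0 : ℝ) < q := by exact_mod_cast hq
  have hqc : (q : ℂ) ≠ 0 := by exact_mod_cast hq0.ne'
  obtain ⟨ρ, hρ⟩ : ∃ ρ : ℝ, ρ = 1 - τ := ⟨_, rfl⟩
  have hρ0 : 0 < ρ := by linarith
  set c : ℂ := 1 + κ * I with hc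
  have hc0 : c ≠ 0 := by
    intro h
    have := congrArg Complex.re h
    simp [hc] at this
  set p : ℂ := exp (-(c * L)) with hp
  have hpn : ‖p‖ = Real.exp (-L) := by
    rw [hp, norm_exp]; simp [hc]
  let Y : ℂ → ℂ := fun s => A * (log (1 + ρ * s) - log (1 - ρ * s))
  let G : ℂ → ℂ := fun s => exp (c * (Y s - L)) - p
  have hρs : ∀ s ∈ ball (0 : ℂ) (1 / ρ), ‖ρ * s‖ < 1 := by
    intro s hs
    rw [mem_ball_zero_iff, lt_div_iff₀ hρ0] at hs
    rw [norm_mul, norm_real, Real.norm_of_nonneg hρ0.le]; linarith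
  have hre : ∀ s ∈ ball (0 : ℂ) (1 / ρ), 0 < (1 + ρ * s).re ∧ 0 < (1 - ρ * s).re := by
    intro s hs
    have := (abs_le.1 (abs_re_le_norm (ρ * s)))
    have h1 := hρs s hs
    constructor
    · rw [add_re, one_re]; linarith
    · rw [sub_re, one_re]; linarith
  have hsl : ∀ s ∈ ball (0 : ℂ) (1 / ρ), (1 + ρ * s) ∈ slitPlane ∧ (1 - ρ * s) ∈ slitPlane :=
    fun s hs => ⟨Or.inl (hre s hs).1, Or.inl (hre s hs).2⟩
  have hYd : ∀ s ∈ ball (0 : ℂ) (1 / ρ),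
      HasDerivAt Y (A * (ρ / (1 + ρ * s) + ρ / (1 - ρ * s))) s := by
    intro s hs
    have h1 : HasDerivAt (fun s : ℂ => 1 + ρ * s) ρ s := by
      simpa using ((hasDerivAt_id s).const_mul (ρ : ℂ)).const_add 1
    have h2 : HasDerivAt (fun s : ℂ => 1 - ρ * s) (-ρ) s := by
      simpa using ((hasDerivAt_id s).const_mul (ρ : ℂ)).const_sub 1
    have h3 := ((h1.clog (hsl s hs).1).sub (h2.clog (hsl s hs).2)).const_mul (A : ℂ)
    refine h3.congr_deriv ?_
    ring
  have hGd : ∀ s ∈ ball (0 : ℂ) (1 / ρ),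
      HasDerivAt G (exp (c * (Y s - L)) * (c * (A * (ρ / (1 + ρ * s) + ρ / (1 - ρ * s))))) s :=
    fun s hs => ((((hYd s hs).sub_const _).const_mul c).cexp).sub_const p
  have hYim : ∀ s ∈ ball (0 : ℂ) (1 / ρ), |(Y s).im| < A * Real.pi := by
    intro s hs
    have h1 := abs_lt.1 (abs_arg_lt_pi_div_two_iff.2 (Or.inl (hre s hs).1))
    have h2 := abs_lt.1 (abs_arg_lt_pi_div_two_iff.2 (Or.inl (hre s hs).2))
    simp only [Y, im_ofReal_mul, sub_im, log_im]
    rw [abs_mul, abs_of_pos hA]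
    refine mul_lt_mul_of_pos_left ?_ hA
    rw [abs_lt]
    constructor <;> linarith [h1.1, h1.2, h2.1, h2.2]
  have hcre : ∀ y : ℂ, (c * y).re = y.re - κ * y.im := by intro y; simp [hc]
  have hcim : ∀ y : ℂ, (c * y).im = y.im + κ * y.re := by intro y; simp [hc]
  have hG0 : G 0 = 0 := by
    simp [G, Y, hp]
  have hR : (1 - τ / 2) / ρ < 1 / ρ := by gcongr; linarith
  have hYre : ∀ s ∈ closedBall (0 : ℂ) ((1 - τ / 2) / ρ), (Y s).re ≤ A * Real.log (4 / τ) := by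
    intro s hs
    have hsb := hre s (closedBall_subset_ball hR hs)
    rw [mem_closedBall_zero_iff, le_div_iff₀ hρ0] at hs
    have hn : ‖ρ * s‖ ≤ 1 - τ / 2 := by
      rw [norm_mul, norm_real, Real.norm_of_nonneg hρ0.le]; linarith
    have h1 : ‖1 + ρ * s‖ ≤ 2 := (norm_add_le _ _).trans (by rw [norm_one]; linarith)
    have h2 : τ / 2 ≤ ‖1 - ρ * s‖ := by
      have := norm_sub_norm_le 1 (ρ * s)
      rw [norm_one] at this
      linarith
    have h3 : 0 < ‖1 + ρ * s‖ := norm_pos_iff.2 fun h => by simp [h] at hsb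
    have h4 := Real.log_le_log h3 h1
    have h5 := Real.log_le_log (by positivity) h2
    simp only [Y, re_ofReal_mul, sub_re, log_re]
    refine mul_le_mul_of_nonneg_left ?_ hA.le
    have : (4 : ℝ) / τ = 2 / (τ / 2) := by field_simp; norm_num
    rw [this, Real.log_div two_ne_zero (by positivity)]
    linarith
  have hδq : 0 < δ ^ q := by positivity
  have hpδ : Real.exp (-L) / δ ^ q ≤ δ / (16 * (1 + κ)) := by
    rw [div_le_iff₀ hδq]; linarith
  have hsmall : δ / (16 * (1 + κ)) ≤ δ / 16 := by
    apply div_le_div_of_nonneg_left hδ.le (by norm_num); linarith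
  have hpu : ∀ u : ℂ, δ ^ q ≤ ‖u‖ → ‖p / u‖ ≤ δ / (16 * (1 + κ)) := by
    intro u hu
    rw [norm_div, hpn]
    exact (div_le_div_of_nonneg_left (Real.exp_pos _).le hδq hu).trans hpδ
  refine ⟨(1 - 2 * τ) / ρ, (1 - τ / 2) / ρ, 1 / ρ, G, div_pos (by linarith) hρ0,
    by rw [div_lt_one hρ0]; linarith, by rw [one_lt_div hρ0]; linarith, hR,
    fun s hs => (hGd s hs).differentiableAt.differentiableWithinAt, ?_, ?_, hG0, ?_, ?_, ?_⟩
  · intro s hs s' hs' h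
    have h1 : exp (c * (Y s - L)) = exp (c * (Y s' - L)) := sub_left_injective h
    obtain ⟨n, hn⟩ := exp_eq_exp_iff_exists_int.1 h1
    have h2 : c * (Y s - Y s') = n * (2 * Real.pi * I) := by linear_combination hn
    have hre2 := congrArg Complex.re h2
    have him2 := congrArg Complex.im h2
    rw [hcre] at hre2
    rw [hcim] at him2
    simp only [sub_re, sub_im, mul_re, mul_im, intCast_re, intCast_im, I_re, I_im, ofReal_re,
      ofReal_im, re_ofNat, im_ofNat] at hre2 him2
    have h3 : ((Y s).im - (Y s').im) * (1 + κ ^ 2) = 2 * Real.pi * n := by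
      linear_combination him2 - κ * hre2
    have hn0 : n = 0 := by
      by_contra hn0
      have h4 : (1 : ℝ) ≤ |(n : ℝ)| := by
        exact_mod_cast Int.one_le_abs hn0
      have h5 : |(Y s).im - (Y s').im| < 2 * (A * Real.pi) := by
        have := abs_lt.1 (hYim s hs)
        have := abs_lt.1 (hYim s' hs')
        rw [abs_lt]
        constructor <;> linarith
      have h6 := congrArg abs h3
      rw [abs_mul, abs_mul, abs_of_pos (by positivity : (0 : ℝ) < 1 + κ ^ 2),
        abs_of_pos (by positivity : 0 < 2 * Real.pi)] at h6
      have h7 : |(Y s).im - (Y s').im| * (1 + κ ^ 2) < 2 * (A * Real.pi) * (1 + κ ^ 2) :=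
        mul_lt_mul_of_pos_right h5 (by positivity)
      nlinarith
    rw [hn0] at h2
    have h8 : Y s = Y s' := by
      simpa [hc0, sub_eq_zero] using h2
    have hAc : (A : ℂ) ≠ 0 := by exact_mod_cast hA.ne'
    have h9 := mul_left_cancel₀ hAc h8
    have h10 := congrArg exp h9
    have hs1 := slitPlane_ne_zero (hsl s hs).1
    have hs2 := slitPlane_ne_zero (hsl s hs).2
    have hs3 := slitPlane_ne_zero (hsl s' hs').1
    have hs4 := slitPlane_ne_zero (hsl s' hs').2
    rw [exp_sub, exp_sub, exp_log hs1, exp_log hs2, exp_log hs3, exp_log hs4,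
      div_eq_div_iff hs2 hs4] at h10
    have h11 : (2 * ρ : ℂ) * s = 2 * ρ * s' := by linear_combination h10
    have h12 : (2 * ρ : ℂ) ≠ 0 := by
      exact_mod_cast (by positivity : (2 * ρ) ≠ 0)
    exact mul_left_cancel₀ h12 h11
  · intro s hs
    rw [(hGd s hs).deriv]
    have hs1 := slitPlane_ne_zero (hsl s hs).1
    have hs2 := slitPlane_ne_zero (hsl s hs).2
    have hAc : (A : ℂ) ≠ 0 := by exact_mod_cast hA.ne'
    have hρc : (ρ : ℂ) ≠ 0 := by exact_mod_cast hρ0.ne'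
    refine mul_ne_zero (exp_ne_zero _) (mul_ne_zero hc0 (mul_ne_zero hAc ?_))
    have : (ρ : ℂ) / (1 + ρ * s) + ρ / (1 - ρ * s) = 2 * ρ / ((1 + ρ * s) * (1 - ρ * s)) := by
      field_simp; ring
    rw [this]
    exact div_ne_zero (mul_ne_zero two_ne_zero hρc) (mul_ne_zero hs1 hs2)
  · intro s hs
    have h1 := hYre s hs
    have h2 := abs_lt.1 (hYim s (closedBall_subset_ball hR hs))
    refine (norm_sub_le _ _).trans_lt ?_
    rw [hpn, norm_exp, hcre]
    simp only [sub_re, sub_im, ofReal_re, ofReal_im]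
    have h3 : (Y s).re - L - κ * ((Y s).im - 0) ≤ -(δ / 4) := by
      nlinarith [h2.1]
    have := Real.exp_le_exp.2 h3
    linarith
  · intro s hs z hz
    rw [or_iff_not_imp_left, not_lt]
    intro hδz
    set u := G s with hu
    have hun : δ ^ q ≤ ‖u‖ := by
      rw [← hz, norm_pow]; gcongr
    have hu0 : u ≠ 0 := norm_pos_iff.1 (hδq.trans_le hun)
    have hpu' := hpu u hun
    have hpu2 : ‖p / u‖ ≤ 1 / 2 := by linarith
    set ℓ := log (1 + p / u) with hℓ
    have hℓn : ‖ℓ‖ ≤ 2 * (δ / (16 * (1 + κ))) :=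
      (norm_log_one_add_le_two hpu2).trans (by linarith)
    have h1 : 1 + p / u ≠ 0 := by
      intro h
      have : p / u = -1 := by linear_combination h
      rw [this] at hpu2
      norm_num at hpu2
    have h2 : exp (c * (Y s - L)) = u + p := by
      rw [hu]; simp only [G]; ring
    set ω₀ := (c * (Y s - L) - ℓ) / q with hω₀
    have h3 : exp ω₀ ^ q = z ^ q := by
      rw [← exp_nat_mul, hω₀, mul_div_cancel₀ _ hqc, exp_sub, h2, hℓ, exp_log h1, hz,
        div_eq_iff h1]
      field_simp
    have h4 : (z / exp ω₀) ^ q = 1 := by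
      rw [div_pow, h3, div_self]
      rw [hz]; exact hu0
    have : NeZero q := ⟨by omega⟩
    obtain ⟨k, -, hk⟩ := (Complex.mem_rootsOfUnity q (Units.mk0 (z / exp ω₀) (by
      intro h; rw [h, zero_pow (by omega)] at h4; exact zero_ne_one h4))).1 (by
        rw [_root_.mem_rootsOfUnity]; exact Units.ext (by simpa using h4))
    rw [Units.val_mk0] at hk
    refine ⟨k, ω₀ + (2 * Real.pi * k / q : ℝ) * I, ?_, ?_⟩
    · have hk' : ((2 * Real.pi * k / q : ℝ) * I : ℂ) = 2 * Real.pi * I * (k / q) := by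
        push_cast
        ring
      rw [exp_add, hk', hk, mul_div_cancel₀ _ (exp_ne_zero _)]
    · have h5 : (ω₀ + (2 * Real.pi * k / q : ℝ) * I).im
          - κ * (ω₀ + (2 * Real.pi * k / q : ℝ) * I).re - 2 * Real.pi * (k : ℤ) / q =
          ((1 + κ ^ 2) * (Y s).im - (ℓ.im - κ * ℓ.re)) / q := by
        have e : ω₀ = ((1 / q : ℝ) : ℂ) * (c * (Y s - L) - ℓ) := by
          rw [hω₀]; push_cast; ring
        have e1 : ω₀.re = (1 / q) * ((Y s).re - L - κ * (Y s).im - ℓ.re) := by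
          rw [e, re_ofReal_mul, sub_re, hcre]; simp
        have e2 : ω₀.im = (1 / q) * ((Y s).im + κ * ((Y s).re - L) - ℓ.im) := by
          rw [e, im_ofReal_mul, sub_im, hcim]; simp
        rw [add_re, add_im, re_ofReal_mul, im_ofReal_mul, I_re, I_im, e1, e2]
        push_cast
        ring
      rw [h5, abs_div, abs_of_pos hq0]
      refine div_lt_div_of_pos_right ?_ hq0
      have h6 := hYim s (closedBall_subset_ball hR hs)
      have h7 : |(1 + κ ^ 2) * (Y s).im| ≤ δ / 4 := by
        rw [abs_mul, abs_of_pos (by positivity)]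
        nlinarith
      have h8 : |ℓ.im - κ * ℓ.re| ≤ (1 + κ) * ‖ℓ‖ := by
        refine (abs_sub _ _).trans ?_
        rw [abs_mul, abs_of_pos hκ]
        have := abs_re_le_norm ℓ
        have := abs_im_le_norm ℓ
        nlinarith
      have h9 : (1 + κ) * ‖ℓ‖ ≤ δ / 8 := by
        have : (1 + κ) * (2 * (δ / (16 * (1 + κ)))) = δ / 8 := by field_simp; norm_num
        rw [← this]; gcongr
      have := abs_sub ((1 + κ ^ 2) * (Y s).im) (ℓ.im - κ * ℓ.re)
      linarith
  · intro k x hx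
    have hr1 : (1 - 2 * τ) / ρ < 1 / ρ := by gcongr; linarith
    have hr0 : 0 < (1 - 2 * τ) / ρ := div_pos (by linarith) hρ0
    let y : ℝ → ℝ := fun t => A * (Real.log (1 + ρ * t) - Real.log (1 - ρ * t))
    have hρt : ∀ t ∈ Icc 0 ((1 - 2 * τ) / ρ), 0 ≤ ρ * t ∧ ρ * t < 1 := by
      intro t ht
      have h1 := ht.2
      rw [le_div_iff₀ hρ0] at h1
      exact ⟨mul_nonneg hρ0.le ht.1, by linarith⟩
    have hyc : ContinuousOn y (Icc 0 ((1 - 2 * τ) / ρ)) := by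
      refine continuousOn_const.mul (ContinuousOn.sub ?_ ?_)
      · exact ContinuousOn.log (by fun_prop) fun t ht => by linarith [hρt t ht]
      · exact ContinuousOn.log (by fun_prop) fun t ht => by linarith [hρt t ht]
    have hY : ∀ t ∈ Icc 0 ((1 - 2 * τ) / ρ), Y t = y t := by
      intro t ht
      have h1 := hρt t ht
      simp only [Y, y]
      rw [ofReal_mul, ofReal_sub, ofReal_log (by linarith [h1.1]), ofReal_log (by linarith [h1.2])]
      push_cast
      rfl
    have hxL : (L : ℝ) + q * x ∈ Icc (y 0) (y ((1 - 2 * τ) / ρ)) := by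
      constructor
      · have h1 : y 0 = 0 := by simp [y]
        rw [h1]
        have h2 : -L ≤ q * Real.log δ := by
          rw [← Real.log_pow, Real.le_log_iff_exp_le hδq]
          refine hp1.trans ?_
          exact mul_le_of_le_one_right hδq.le (by linarith)
        have h3 := mul_le_mul_of_nonneg_left hx.1 hq0.le
        linarith
      · have h1 : y ((1 - 2 * τ) / ρ) = A * (Real.log (2 - 2 * τ) - Real.log (2 * τ)) := by
          simp only [y]
          rw [mul_div_cancel₀ _ hρ0.ne']
          ring_nf
        have h2 : 0 ≤ Real.log (2 - 2 * τ) := Real.log_nonneg (by linarith)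
        have h3 : Real.log (2 * τ) = Real.log 8 - Real.log (4 / τ) := by
          rw [← Real.log_div (by norm_num) (by positivity)]
          congr 1
          field_simp; norm_num
        rw [h1, h3]
        have hq1 : (1 : ℝ) ≤ q := by exact_mod_cast hq
        have h4 : q * x ≤ -δ := by nlinarith [hx.2]
        have h5 := mul_nonneg hA.le h2
        linarith
    obtain ⟨t, ht, hty⟩ := intermediate_value_Icc hr0.le hyc hxL
    set z₀ := exp (c * x + (2 * Real.pi * k / q : ℝ) * I) with hz₀
    set u := exp (c * (q * x)) with hu
    have hun : δ ^ q ≤ ‖u‖ := by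
      rw [hu, norm_exp, hcre]
      have h1 : ((q : ℂ) * x).re = q * x := by rw [← ofReal_natCast, re_ofReal_mul, ofReal_re]
      have h2 : ((q : ℂ) * x).im = 0 := by rw [← ofReal_natCast, im_ofReal_mul, ofReal_im, mul_zero]
      rw [h1, h2, mul_zero, sub_zero, ← Real.log_le_iff_le_exp hδq, Real.log_pow]
      exact mul_le_mul_of_nonneg_left hx.1 hq0.le
    have hu0 : u ≠ 0 := exp_ne_zero _
    have hpu' := hpu u hun
    have hpu2 : ‖-(p / u)‖ ≤ 1 / 2 := by rw [norm_neg]; linarith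
    set ℓ := log (1 + -(p / u)) with hℓ
    have hℓn : ‖ℓ‖ ≤ δ / 8 :=
      (norm_log_one_add_le_two hpu2).trans (by rw [norm_neg]; linarith)
    have h1 : 1 + -(p / u) ≠ 0 := by
      intro h
      have : -(p / u) = -1 := by linear_combination h
      rw [this] at hpu2
      norm_num at hpu2
    have hGt : G t = u + -p := by
      simp only [G]
      rw [hY t ht, hty, hu]
      push_cast
      ring_nf
    refine ⟨t, ?_, z₀ * exp (ℓ / q), ?_, ?_⟩
    · rw [mem_closedBall_zero_iff, norm_real, Real.norm_of_nonneg ht.1]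
      exact ht.2
    · rw [hGt, mul_pow, ← exp_nat_mul (ℓ / q), mul_div_cancel₀ _ hqc, hℓ, exp_log h1, hz₀, ← exp_nat_mul]
      have : exp (q * (c * x + (2 * Real.pi * k / q : ℝ) * I)) = u := by
        rw [hu, exp_eq_exp_iff_exists_int]
        refine ⟨k, ?_⟩
        push_cast
        field_simp
      rw [this]
      field_simp
    · have h2 : ‖z₀‖ ≤ 1 := by
        rw [hz₀, norm_exp]
        refine Real.exp_le_one_iff.2 ?_
        rw [add_re, hcre, re_ofReal_mul, I_re]
        simp only [ofReal_re, ofReal_im]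
        linarith [hx.2]
      have hq1 : (1 : ℝ) ≤ q := by exact_mod_cast hq
      have h3 : ‖ℓ / q‖ ≤ δ / 8 := by
        rw [norm_div, norm_natCast]
        exact (div_le_self (norm_nonneg _) hq1).trans hℓn
      have h4 := norm_exp_sub_one_le (x := ℓ / q) (by linarith)
      calc ‖z₀ * exp (ℓ / q) - z₀‖ = ‖z₀‖ * ‖exp (ℓ / q) - 1‖ := by rw [← norm_mul]; ring_nf
        _ ≤ 1 * ‖exp (ℓ / q) - 1‖ := by gcongr
        _ < δ := by linarith

theorem exists_inverse_near_id {θ : ℂ → ℂ} {R η : ℝ} (hη0 : 0 ≤ η) (hη : η < 1)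
    (hθ : DifferentiableOn ℂ θ (ball 0 R)) (h0 : θ 0 = 0)
    (hd : ∀ w ∈ ball (0 : ℂ) R, ‖deriv θ w - 1‖ ≤ η) :
    ∃ χ : ℂ → ℂ, DifferentiableOn ℂ χ (ball 0 (R * (1 - η))) ∧
      (∀ w ∈ ball (0 : ℂ) (R * (1 - η)), χ w ∈ ball 0 R ∧ θ (χ w) = w) ∧
      ∀ w ∈ ball (0 : ℂ) R, ‖θ w‖ ≤ (1 + η) * ‖w‖ ∧
        (θ w ∈ ball 0 (R * (1 - η)) → χ (θ w) = w) := by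
  have hda : ∀ w ∈ ball (0 : ℂ) R, DifferentiableAt ℂ θ w :=
    fun w hw => hθ.differentiableAt (isOpen_ball.mem_nhds hw)
  have hlip : ∀ x ∈ ball (0 : ℂ) R, ∀ y ∈ ball (0 : ℂ) R,
      ‖(θ y - y) - (θ x - x)‖ ≤ η * ‖y - x‖ := by
    intro x hx y hy
    refine (convex_ball (0 : ℂ) R).norm_image_sub_le_of_norm_deriv_le (𝕜 := ℂ)
      (f := fun w => θ w - w) (fun w hw => (hda w hw).sub differentiableAt_id) ?_ hx hy
    intro w hw
    have : deriv (fun w => θ w - w) w = deriv θ w - 1 := by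
      rw [deriv_fun_sub (hda w hw) differentiableAt_fun_id, deriv_id'']
    rw [this]
    exact hd w hw
  have hlow : ∀ x ∈ ball (0 : ℂ) R, ∀ y ∈ ball (0 : ℂ) R, (1 - η) * ‖y - x‖ ≤ ‖θ y - θ x‖ := by
    intro x hx y hy
    have h1 := hlip x hx y hy
    have h2 : ‖y - x‖ ≤ ‖θ y - θ x‖ + ‖(θ y - y) - (θ x - x)‖ := by
      have : y - x = (θ y - θ x) - ((θ y - y) - (θ x - x)) := by ring
      rw [this]
      exact norm_sub_le _ _
    linarith
  have hinj : InjOn θ (ball 0 R) := by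
    intro x hx y hy h
    have h1 := hlow x hx y hy
    rw [h, sub_self, norm_zero] at h1
    have h2 : ‖y - x‖ ≤ 0 := by
      by_contra h3
      nlinarith
    exact (sub_eq_zero.1 (norm_le_zero_iff.1 h2)).symm
  have hsurj : ∀ w ∈ ball (0 : ℂ) (R * (1 - η)), ∃ x ∈ ball (0 : ℂ) R, θ x = w := by
    intro w hw
    have h1 : 0 < 1 - η := by linarith
    rw [mem_ball_zero_iff, ← div_lt_iff₀ h1] at hw
    have hsub : closedBall (0 : ℂ) (‖w‖ / (1 - η)) ⊆ ball 0 R := closedBall_subset_ball hw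
    have happ : ApproximatesLinearOn θ (ContinuousLinearMap.id ℂ ℂ) (ball 0 R) ⟨η, hη0⟩ := by
      intro x hx y hy
      have h := hlip y hy x hx
      have e : θ x - θ y - (x - y) = θ x - x - (θ y - y) := by ring
      rw [ContinuousLinearMap.id_apply, e]
      exact h
    let inv : (ContinuousLinearMap.id ℂ ℂ).NonlinearRightInverse := ⟨id, 1, by simp, by simp⟩
    have h2 := happ.surjOn_closedBall_of_nonlinearRightInverse inv (by positivity) hsub
    have h3 : w ∈ closedBall (θ 0) (((inv.nnnorm : ℝ)⁻¹ - (⟨η, hη0⟩ : NNReal)) *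
        (‖w‖ / (1 - η))) := by
      rw [h0, mem_closedBall_zero_iff]
      have : ((inv.nnnorm : ℝ)⁻¹ - (⟨η, hη0⟩ : NNReal)) = 1 - η := by simp [inv]
      rw [this, mul_div_cancel₀ _ h1.ne']
    obtain ⟨x, hx, hxw⟩ := h2 h3
    exact ⟨x, hsub hx, hxw⟩
  choose! χ hχ1 hχ2 using hsurj
  refine ⟨χ, ?_, fun w hw => ⟨hχ1 w hw, hχ2 w hw⟩, ?_⟩
  · intro w hw
    have hcont : ContinuousAt χ w := by
      rw [Metric.continuousAt_iff]
      intro ε hε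
      obtain ⟨ρ, hρ, hρs⟩ := Metric.isOpen_iff.1 isOpen_ball w hw
      refine ⟨min ρ (ε * (1 - η)), lt_min hρ (mul_pos hε (by linarith)), fun {x} hx => ?_⟩
      have hxb := hρs (lt_of_lt_of_le hx (min_le_left _ _))
      have h1 := hlow _ (hχ1 w hw) _ (hχ1 x hxb)
      rw [hχ2 w hw, hχ2 x hxb, ← dist_eq_norm, ← dist_eq_norm] at h1
      have h2 := lt_of_lt_of_le hx (min_le_right _ _)
      by_contra h3
      nlinarith
    have hne : deriv θ (χ w) ≠ 0 := by
      intro h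
      have := hd _ (hχ1 w hw)
      rw [h] at this
      norm_num at this
      linarith
    refine (HasDerivAt.of_local_left_inverse hcont (hda _ (hχ1 w hw)).hasDerivAt hne
      ?_).differentiableAt.differentiableWithinAt
    filter_upwards [isOpen_ball.mem_nhds hw] with x hx using hχ2 x hx
  · intro w hw
    have hR : 0 < R := pos_of_mem_ball hw
    refine ⟨?_, fun h => hinj (hχ1 _ h) hw (hχ2 _ h)⟩
    have h1 := hlip 0 (mem_ball_self hR) w hw
    rw [h0, sub_self, sub_zero, sub_zero] at h1
    have h2 := norm_add_le (θ w - w) w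
    rw [sub_add_cancel] at h2
    linarith

theorem exists_equivariant_primitive (q : ℕ) (P : Polynomial ℂ) :
    ∃ ψ : ℂ → ℂ, (∀ z, HasDerivAt ψ (exp (P.eval (z ^ q))) z) ∧ ψ 0 = 0 ∧
      ∀ ζ z : ℂ, ζ ^ q = 1 → ψ (ζ * z) = ζ * ψ z := by
  have hd : Differentiable ℂ fun z : ℂ => exp (P.eval (z ^ q)) :=
    (P.differentiable.comp (differentiable_id.pow q)).cexp
  obtain ⟨ψ, h0, hψ⟩ := hd.isExactOn_univ.with_val_at 0 0
  have hψ' := fun z => hψ z (mem_univ z)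
  refine ⟨ψ, hψ', h0, fun ζ z hζ => ?_⟩
  have h1 : ∀ z, HasDerivAt (fun z => ψ (ζ * z) - ζ * ψ z) 0 z := by
    intro z
    have h2 : HasDerivAt (fun z => ψ (ζ * z)) (exp (P.eval ((ζ * z) ^ q)) * ζ) z := by
      have h3 : HasDerivAt (fun z : ℂ => ζ * z) ζ z := by
        simpa using (hasDerivAt_id z).const_mul ζ
      exact (hψ' (ζ * z)).comp z h3
    have h4 := h2.sub ((hψ' z).const_mul ζ)
    refine h4.congr_deriv ?_
    rw [mul_pow, hζ, one_mul]
    ring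
  have h5 := is_const_of_deriv_eq_zero (fun z => (h1 z).differentiableAt) (fun z => (h1 z).deriv) z 0
  simp only [mul_zero, h0, sub_zero] at h5
  exact sub_eq_zero.1 h5

set_option maxHeartbeats 600000 in
theorem exists_equivariant_step {κ δ : ℝ} (hκ : 0 < κ) (hδ : 0 < δ) (hδ1 : δ < 1) {q : ℕ}
    (hq : 1 ≤ q) :
    ∃ (ψ g : ℂ → ℂ) (R : ℝ), 1 < R ∧ Differentiable ℂ ψ ∧ (∀ z, deriv ψ z ≠ 0) ∧ ψ 0 = 0 ∧
      (∀ ζ z : ℂ, ζ ^ q = 1 → ψ (ζ * z) = ζ * ψ z) ∧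
      DifferentiableOn ℂ g (ball 0 R) ∧ g 0 = 0 ∧ (∀ w ∈ ball (0 : ℂ) R, ψ (g w) = w) ∧
      (∀ w ∈ ball (0 : ℂ) R, ‖g w‖ < 1) ∧
      (∀ w ∈ ball (0 : ℂ) R, ‖g w‖ < δ ∨
        ∃ (k : ℤ) (ω : ℂ), exp ω = g w ∧ |ω.im - κ * ω.re - 2 * Real.pi * k / q| < δ / q) ∧
      (∀ (k : ℤ), ∀ x ∈ Icc (Real.log δ) (-δ), ∃ w ∈ closedBall (0 : ℂ) 1,
        ‖g w - exp ((1 + κ * I) * x + (2 * Real.pi * k / q : ℝ) * I)‖ < δ) := by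
  obtain ⟨r₁, R₁, R₀, G, hr0, hr1, hR1, hR01, hG, hGi, hG', hG0, hG1, hGb, hGc⟩ :=
    exists_spiral_map hκ hδ hδ1 hq
  have hq0 : q ≠ 0 := by omega
  have hqc : (q : ℂ) ≠ 0 := by exact_mod_cast hq0
  have hR0 : 0 < R₀ := by linarith
  have h0mem : (0 : ℂ) ∈ ball (0 : ℂ) R₀ := mem_ball_self hR0
  have hGd : ∀ s ∈ ball (0 : ℂ) R₀, HasDerivAt G (deriv G s) s :=
    fun s hs => (hG.differentiableAt (isOpen_ball.mem_nhds hs)).hasDerivAt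
  obtain ⟨J, hJ, hJe⟩ := exists_holomorphic_log hR0 (hG.deriv isOpen_ball) hG'
  obtain ⟨B, hB, hBe⟩ := exists_holomorphic_log hR0
    ((differentiableOn_dslope (isOpen_ball.mem_nhds h0mem)).2 hG) (by
      intro s hs
      by_cases h : s = 0
      · rw [h, dslope_same]; exact hG' _ h0mem
      · rw [dslope_of_ne _ h, slope_def_field]
        exact div_ne_zero (sub_ne_zero.2 fun e => h (hGi hs h0mem e)) (sub_ne_zero.2 h))
  have hBG : ∀ s ∈ ball (0 : ℂ) R₀, s * exp (B s) = G s := by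
    intro s hs
    have := sub_smul_dslope G 0 s
    rw [hG0, sub_zero, sub_zero, smul_eq_mul] at this
    rw [hBe s hs, this]
  have hBd : ∀ s ∈ ball (0 : ℂ) R₀, HasDerivAt B (deriv B s) s :=
    fun s hs => (hB.differentiableAt (isOpen_ball.mem_nhds hs)).hasDerivAt
  have hBJ : ∀ s ∈ ball (0 : ℂ) R₀, 1 + s * deriv B s = exp (J s - B s) := by
    intro s hs
    have h1 : HasDerivAt G (1 * exp (B s) + s * (exp (B s) * deriv B s)) s := by
      refine ((hasDerivAt_id s).mul (hBd s hs).cexp).congr_of_eventuallyEq ?_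
      filter_upwards [isOpen_ball.mem_nhds hs] with x hx using (hBG x hx).symm
    rw [exp_sub, hJe s hs, h1.deriv, eq_div_iff (exp_ne_zero _)]
    ring
  obtain ⟨R₂, hR₂, hR₂q⟩ : ∃ R₂ : ℝ, 1 < R₂ ∧ R₂ ^ q = R₁ := by
    refine ⟨R₁ ^ ((q : ℝ)⁻¹), Real.one_lt_rpow hR1 (by positivity), ?_⟩
    exact Real.rpow_inv_natCast_pow (by linarith) hq0
  obtain ⟨r₂, hr₂0, hr₂, hr₂q⟩ : ∃ r₂ : ℝ, 0 < r₂ ∧ r₂ < 1 ∧ r₂ ^ q = r₁ := by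
    refine ⟨r₁ ^ ((q : ℝ)⁻¹), by positivity, Real.rpow_lt_one hr0.le hr1 (by positivity), ?_⟩
    exact Real.rpow_inv_natCast_pow hr0.le hq0
  have hpow : ∀ w ∈ ball (0 : ℂ) R₂, w ^ q ∈ closedBall (0 : ℂ) R₁ := by
    intro w hw
    rw [mem_ball_zero_iff] at hw
    rw [mem_closedBall_zero_iff, norm_pow, ← hR₂q]
    gcongr
  have hpow' : ∀ w ∈ ball (0 : ℂ) R₂, w ^ q ∈ ball (0 : ℂ) R₀ :=
    fun w hw => closedBall_subset_ball hR01 (hpow w hw)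
  let g₀ : ℂ → ℂ := fun w => w * exp (B (w ^ q) / q)
  have hg₀q : ∀ w ∈ ball (0 : ℂ) R₂, g₀ w ^ q = G (w ^ q) := by
    intro w hw
    simp only [g₀]
    rw [mul_pow, ← exp_nat_mul, mul_div_cancel₀ _ hqc, hBG _ (hpow' w hw)]
  let F : ℂ → ℂ := fun s => B s - B s / q - J s
  have hg₀d : ∀ w ∈ ball (0 : ℂ) R₂, HasDerivAt g₀ (exp (-F (w ^ q))) w := by
    intro w hw
    have h1 : HasDerivAt (fun w => B (w ^ q)) (deriv B (w ^ q) * (q * w ^ (q - 1))) w :=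
      (hBd _ (hpow' w hw)).comp w (hasDerivAt_pow q w)
    have h2 := (hasDerivAt_id w).mul (h1.div_const (q : ℂ)).cexp
    refine h2.congr_deriv ?_
    have h3 : -F (w ^ q) = B (w ^ q) / q + (J (w ^ q) - B (w ^ q)) := by simp only [F]; ring
    rw [h3, exp_add, ← hBJ _ (hpow' w hw)]
    have h4 : w ^ q = w * w ^ (q - 1) := by
      rw [← pow_succ']; congr 1; omega
    simp only [id]
    field_simp
    rw [h4]
    ring
  have hF : DifferentiableOn ℂ F (ball 0 R₀) := (hB.sub (hB.div_const _)).sub hJ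
  obtain ⟨η, hη0, hη1, hηR, hηr⟩ : ∃ η : ℝ, 0 < η ∧ 2 * η < 1 ∧ 1 < R₂ * (1 - 2 * η) ∧
      (1 + 2 * η) * r₂ ≤ 1 := by
    refine ⟨min ((R₂ - 1) / (4 * R₂)) ((1 - r₂) / 4), lt_min (div_pos (by linarith) (by linarith))
      (by linarith), ?_, ?_, ?_⟩
    · have := min_le_right ((R₂ - 1) / (4 * R₂)) ((1 - r₂) / 4)
      linarith
    · have := min_le_left ((R₂ - 1) / (4 * R₂)) ((1 - r₂) / 4)
      rw [le_div_iff₀ (by linarith)] at this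
      linarith
    · have := min_le_right ((R₂ - 1) / (4 * R₂)) ((1 - r₂) / 4)
      nlinarith
  obtain ⟨P, hP⟩ := exists_polynomial_comp_approx (by linarith : 0 < R₁) hR01 hG hG' hGi hF hη0
  obtain ⟨ψ, hψd, hψ0, hψe⟩ := exists_equivariant_primitive q P
  have hθd : ∀ w ∈ ball (0 : ℂ) R₂, HasDerivAt (fun w => ψ (g₀ w))
      (exp (P.eval (G (w ^ q)) - F (w ^ q))) w := by
    intro w hw
    refine ((hψd (g₀ w)).comp w (hg₀d w hw)).congr_deriv ?_
    rw [hg₀q w hw, ← exp_add]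
    rfl
  have hg₀0 : g₀ 0 = 0 := by simp [g₀]
  obtain ⟨χ, hχd, hχ, hχθ⟩ := exists_inverse_near_id (θ := fun w => ψ (g₀ w)) (R := R₂)
    (η := 2 * η) (by linarith) hη1
    (fun w hw => (hθd w hw).differentiableAt.differentiableWithinAt) (by simp [hg₀0, hψ0]) (by
      intro w hw
      rw [(hθd w hw).deriv]
      have h1 := hP _ (hpow w hw)
      have h2 := norm_exp_sub_one_le (x := P.eval (G (w ^ q)) - F (w ^ q)) (by linarith)
      linarith)
  have hR2pos : 0 < R₂ := by linarith
  refine ⟨ψ, fun w => g₀ (χ w), R₂ * (1 - 2 * η), hηR, fun z => (hψd z).differentiableAt,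
    fun z => by rw [(hψd z).deriv]; exact exp_ne_zero _, hψ0, hψe, ?_, ?_,
    fun w hw => (hχ w hw).2, ?_, ?_, ?_⟩
  · intro w hw
    have h1 := hχd.differentiableAt (isOpen_ball.mem_nhds hw)
    have h2 := (hg₀d _ (hχ w hw).1).differentiableAt
    exact (h2.comp w h1).differentiableWithinAt
  · have h1 := (hχθ 0 (mem_ball_self hR2pos)).2
    simp only [hg₀0, hψ0] at h1
    change g₀ (χ 0) = 0
    rw [h1 (mem_ball_self (by linarith)), hg₀0]
  · intro w hw
    have h1 := hg₀q _ (hχ w hw).1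
    have h2 := hG1 _ (hpow _ (hχ w hw).1)
    rw [← h1, norm_pow] at h2
    exact (pow_lt_one_iff_of_nonneg (norm_nonneg _) hq0).1 h2
  · intro w hw
    exact hGb _ (hpow _ (hχ w hw).1) _ (hg₀q _ (hχ w hw).1)
  · intro k x hx
    obtain ⟨s, hs, z, hz, hzn⟩ := hGc k x hx
    have hsR : s ∈ ball (0 : ℂ) R₀ := closedBall_subset_ball (by linarith) hs
    let w := z * exp (-(B s / q))
    have hwq : w ^ q = s := by
      simp only [w]
      rw [mul_pow, ← exp_nat_mul, hz, ← hBG s hsR, mul_neg, mul_div_cancel₀ _ hqc, mul_assoc,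
        ← exp_add, add_neg_cancel, exp_zero, mul_one]
    have hgw : g₀ w = z := by
      simp only [g₀]
      rw [hwq]
      simp only [w]
      rw [mul_assoc, ← exp_add, neg_add_cancel, exp_zero, mul_one]
    have hwr : ‖w‖ ≤ r₂ := by
      rw [mem_closedBall_zero_iff, ← hwq, norm_pow, ← hr₂q] at hs
      exact (pow_le_pow_iff_left₀ (norm_nonneg _) hr₂0.le hq0).1 hs
    have hwR : w ∈ ball (0 : ℂ) R₂ := by rw [mem_ball_zero_iff]; linarith
    obtain ⟨h1, h2⟩ := hχθ w hwR
    have h3 : ‖ψ (g₀ w)‖ ≤ 1 := h1.trans ((by gcongr : _ ≤ (1 + 2 * η) * r₂).trans hηr)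
    refine ⟨ψ (g₀ w), mem_closedBall_zero_iff.2 h3, ?_⟩
    simp only
    rw [h2 (mem_ball_zero_iff.2 (by linarith)), hgw]
    exact hzn

theorem exists_pos_forall_of_isCompact {C : Set ℂ} (hC : IsCompact C) {P : ℂ → ℝ → Prop}
    (mono : ∀ z d d', 0 < d' → d' ≤ d → P z d → P z d')
    (loc : ∀ z ∈ C, ∃ d > 0, ∀ᶠ y in nhds z, P y d) : ∃ d > 0, ∀ z ∈ C, P z d := by
  refine hC.induction_on (p := fun S => ∃ d > 0, ∀ z ∈ S, P z d) ⟨1, one_pos, by simp⟩ ?_ ?_ ?_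
  · rintro s t hst ⟨d, hd, h⟩
    exact ⟨d, hd, fun z hz => h z (hst hz)⟩
  · rintro s t ⟨d, hd, h⟩ ⟨d', hd', h'⟩
    refine ⟨min d d', lt_min hd hd', fun z hz => ?_⟩
    rcases hz with hz | hz
    · exact mono z _ _ (lt_min hd hd') (min_le_left _ _) (h z hz)
    · exact mono z _ _ (lt_min hd hd') (min_le_right _ _) (h' z hz)
  · intro z hz
    obtain ⟨d, hd, h⟩ := loc z hz
    exact ⟨_, mem_nhdsWithin_of_mem_nhds h, d, hd, fun y hy => hy⟩

theorem hasStrictDerivAt_of_differentiable {Φ : ℂ → ℂ} (hΦ : Differentiable ℂ Φ) (z : ℂ) :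
    HasStrictDerivAt Φ (deriv Φ z) z :=
  (hΦ.contDiff (n := 1)).contDiffAt.hasStrictDerivAt one_ne_zero

theorem exists_uniform_local_inverse {Φ : ℂ → ℂ} (hΦ : Differentiable ℂ Φ)
    (hΦ' : ∀ z, deriv Φ z ≠ 0) {C : Set ℂ} (hC : IsCompact C) {ε : ℝ} (hε : 0 < ε) :
    ∃ ε' > 0, ε' ≤ ε ∧ ∃ d > 0, ∀ z ∈ C, InjOn Φ (ball z ε') ∧
      ball (Φ z) d ⊆ Φ '' ball z ε' := by
  have hs := fun z => hasStrictDerivAt_of_differentiable hΦ z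
  obtain ⟨ε₁, hε₁, h₁⟩ := exists_pos_forall_of_isCompact hC (P := fun z d => InjOn Φ (ball z d))
    (fun z d d' _ hdd h => h.mono (ball_subset_ball hdd)) (by
      intro z _
      obtain ⟨ρ, hρ, h⟩ := Metric.eventually_nhds_iff_ball.1 ((hs z).eventually_left_inverse (hΦ' z))
      refine ⟨ρ / 2, by positivity, ?_⟩
      filter_upwards [ball_mem_nhds z (by positivity : 0 < ρ / 2)] with y hy
      have hsub : ball y (ρ / 2) ⊆ ball z ρ := by
        refine ball_subset_ball' ?_
        have := mem_ball.1 hy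
        linarith
      intro a ha b hb hab
      rw [← h a (hsub ha), ← h b (hsub hb), hab])
  have hε' : 0 < min ε ε₁ := lt_min hε hε₁
  obtain ⟨d, hd, h₂⟩ := exists_pos_forall_of_isCompact hC
    (P := fun z d => ball (Φ z) d ⊆ Φ '' ball z (min ε ε₁))
    (fun z d d' _ hdd h => (ball_subset_ball hdd).trans h) (by
      intro z _
      have h3 : Φ '' ball z (min ε ε₁ / 2) ∈ nhds (Φ z) := by
        rw [← (hs z).map_nhds_eq (hΦ' z)]
        exact image_mem_map (ball_mem_nhds z (by positivity))
      obtain ⟨ρ, hρ, h⟩ := Metric.mem_nhds_iff.1 h3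
      refine ⟨ρ / 2, by positivity, ?_⟩
      filter_upwards [ball_mem_nhds z (by positivity : 0 < min ε ε₁ / 2),
        hΦ.continuous.continuousAt (ball_mem_nhds (Φ z) (by positivity : 0 < ρ / 2))] with y hy hy'
      have h4 : ball (Φ y) (ρ / 2) ⊆ ball (Φ z) ρ := by
        refine ball_subset_ball' ?_
        have := mem_ball.1 hy'
        linarith
      refine (h4.trans h).trans (image_mono (ball_subset_ball' ?_))
      have := mem_ball'.1 hy
      linarith)
  exact ⟨min ε ε₁, hε', min_le_left _ _, d, hd, fun z hz =>
    ⟨(h₁ z hz).mono (ball_subset_ball (min_le_right _ _)), h₂ z hz⟩⟩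

theorem exists_lift_perturbation {Φ F : ℂ → ℂ} (hΦ : Differentiable ℂ Φ)
    (hΦ' : ∀ z, deriv Φ z ≠ 0) (hΦ0 : Φ 0 = 0) {σ σ' : ℝ} (hσ' : 0 < σ') (hσ : σ' < σ)
    (hF : DifferentiableOn ℂ F (ball 0 σ)) (hF0 : F 0 = 0) {lam : ℂ}
    (hΦF : ∀ z ∈ ball (0 : ℂ) σ, Φ (F z) = lam * Φ z) {ε : ℝ} (hε : 0 < ε) :
    ∃ d > 0, ∀ lam' : ℂ, ‖lam' - lam‖ < d → ∃ F' : ℂ → ℂ, DifferentiableOn ℂ F' (ball 0 σ') ∧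
      F' 0 = 0 ∧ (∀ z ∈ ball (0 : ℂ) σ', Φ (F' z) = lam' * Φ z) ∧
      ∀ z ∈ ball (0 : ℂ) σ', ‖F' z - F z‖ ≤ ε := by
  have hsub : closedBall (0 : ℂ) σ' ⊆ ball 0 σ := closedBall_subset_ball hσ
  have hcb := isCompact_closedBall (0 : ℂ) σ'
  obtain ⟨ε', hε', hεε, d, hd, h⟩ := exists_uniform_local_inverse hΦ hΦ'
    (hcb.image_of_continuousOn (hF.continuousOn.mono hsub)) hε
  obtain ⟨M, hM⟩ := hcb.exists_bound_of_continuousOn hΦ.continuous.continuousOn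
  have hM0 : 0 ≤ M := (norm_nonneg _).trans (hM 0 (mem_closedBall_self hσ'.le))
  refine ⟨d / (M + 1), by positivity, fun lam' hlam => ?_⟩
  have hex : ∀ z ∈ ball (0 : ℂ) σ', ∃ y ∈ ball (F z) ε', Φ y = lam' * Φ z := by
    intro z hz
    have hz' := ball_subset_closedBall hz
    refine (h (F z) (mem_image_of_mem F hz')).2 ?_
    rw [mem_ball, dist_eq_norm, hΦF z (hsub hz'), ← sub_mul, norm_mul]
    rw [lt_div_iff₀ (by positivity)] at hlam
    have := hM z hz'
    have := norm_nonneg (lam' - lam)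
    nlinarith
  choose! F' hF'1 hF'2 using hex
  have huniq : ∀ z ∈ ball (0 : ℂ) σ', ∀ y ∈ ball (F z) ε', Φ y = lam' * Φ z → y = F' z := by
    intro z hz y hy hyz
    exact (h (F z) (mem_image_of_mem F (ball_subset_closedBall hz))).1 hy (hF'1 z hz)
      (hyz.trans (hF'2 z hz).symm)
  have h0 : (0 : ℂ) ∈ ball (0 : ℂ) σ' := mem_ball_self hσ'
  refine ⟨F', fun z hz => ?_, ?_, hF'2, fun z hz => ?_⟩
  · have hΦs := hasStrictDerivAt_of_differentiable hΦ (F' z)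
    have hcont : ContinuousAt F' z := by
      rw [ContinuousAt, Metric.tendsto_nhds]
      intro e he
      have h1 := mem_ball.1 (hF'1 z hz)
      let ρ := min e ((ε' - dist (F' z) (F z)) / 2)
      have hρ : 0 < ρ := lt_min he (by linarith)
      have h2 : Φ '' ball (F' z) ρ ∈ nhds (lam' * Φ z) := by
        rw [← hF'2 z hz, ← hΦs.map_nhds_eq (hΦ' _)]
        exact image_mem_map (ball_mem_nhds _ hρ)
      have h3 : ContinuousAt (fun y => lam' * Φ y) z :=
        continuousAt_const.mul hΦ.continuous.continuousAt
      have h4 : ContinuousAt F z :=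
        (hF.differentiableAt (isOpen_ball.mem_nhds (hsub (ball_subset_closedBall hz)))).continuousAt
      filter_upwards [h3 h2, h4 (ball_mem_nhds _ hρ), isOpen_ball.mem_nhds hz] with y hy1 hy2 hy3
      obtain ⟨x, hx, hxy⟩ := hy1
      have h5 : x = F' y := by
        refine huniq y hy3 x ?_ hxy
        rw [mem_ball] at hx ⊢
        have h6 := mem_ball'.1 hy2
        have h7 := dist_triangle4 x (F' z) (F z) (F y)
        have h8 : ρ ≤ (ε' - dist (F' z) (F z)) / 2 := min_le_right _ _
        linarith
      rw [← h5]
      exact lt_of_lt_of_le hx (min_le_left _ _)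
    have h1 := (hΦs.to_localInverse (hΦ' _)).hasDerivAt
    rw [hF'2 z hz] at h1
    have h2 := h1.comp z ((hΦ z).hasDerivAt.const_mul lam')
    refine (h2.congr_of_eventuallyEq ?_).differentiableAt.differentiableWithinAt
    filter_upwards [hcont.eventually (hΦs.eventually_left_inverse (hΦ' _)),
      isOpen_ball.mem_nhds hz] with y hy hy'
    rw [Function.comp_apply, ← hF'2 y hy', hy]
  · refine (huniq 0 h0 0 ?_ ?_).symm
    · rw [hF0]; exact mem_ball_self hε'
    · rw [hΦ0, mul_zero]
  · rw [← dist_eq_norm]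
    exact (mem_ball.1 (hF'1 z hz)).le.trans hεε

theorem exists_spiral_near {μ δ κ : ℝ} (hμ : 0 < μ) (hμ1 : μ ≤ 1) (hκ : κ = 8 * Real.pi / μ)
    (hδ : 0 < δ) (hδμ : δ ≤ μ / 40) {w : ℂ} (hw : ‖w‖ ≤ 1) (θ : ℝ) :
    ∃ x ∈ Icc (Real.log δ) (-10 * δ), ‖exp ((1 + κ * I) * x + θ * I) - w‖ ≤ μ / 2 := by
  have hpi := Real.pi_pos
  have hκ0 : 0 < κ := by rw [hκ]; positivity
  have hm : 0 < max ‖w‖ (μ / 8) := lt_max_of_lt_right (by positivity)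
  set X := min (Real.log (max ‖w‖ (μ / 8))) (-10 * δ) with hX
  set j := ⌊(κ * X + θ - arg w) / (2 * Real.pi)⌋ with hj
  set x := (arg w + 2 * Real.pi * j - θ) / κ with hx
  have hxκ : κ * x = arg w + 2 * Real.pi * j - θ := by rw [hx]; field_simp
  have h1 : x ≤ X := by
    have := Int.floor_le ((κ * X + θ - arg w) / (2 * Real.pi))
    rw [← hj, le_div_iff₀ (by positivity)] at this
    refine le_of_mul_le_mul_left (a := κ) ?_ hκ0
    linarith
  have h2 : X - μ / 4 < x := by
    have := Int.lt_floor_add_one ((κ * X + θ - arg w) / (2 * Real.pi))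
    rw [← hj, div_lt_iff₀ (by positivity)] at this
    refine lt_of_mul_lt_mul_left (a := κ) ?_ hκ0.le
    have : κ * (μ / 4) = 2 * Real.pi := by rw [hκ]; field_simp; norm_num
    rw [mul_sub, hxκ]
    linarith
  have hexp : ‖exp ((1 + κ * I) * x + θ * I) - w‖ = |Real.exp x - ‖w‖| := by
    have e1 : exp ((1 + κ * I) * x + θ * I) = Real.exp x * exp (arg w * I) := by
      rw [Complex.ofReal_exp, ← Complex.exp_add]
      rw [Complex.exp_eq_exp_iff_exists_int]
      refine ⟨j, ?_⟩
      have : (κ : ℂ) * x = arg w + 2 * Real.pi * j - θ := by exact_mod_cast hxκ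
      linear_combination I * this
    have e2 : exp ((1 + κ * I) * x + θ * I) - w
        = ((Real.exp x - ‖w‖ : ℝ) : ℂ) * exp (arg w * I) := by
      rw [e1]
      nth_rewrite 2 [← norm_mul_exp_arg_mul_I w]
      push_cast
      ring
    rw [e2, norm_mul, Complex.norm_exp_ofReal_mul_I, mul_one, Complex.norm_real, Real.norm_eq_abs]
  have hX0 : X ≤ 0 := (min_le_right _ _).trans (by linarith)
  refine ⟨x, ⟨?_, h1.trans (min_le_right _ _)⟩, ?_⟩
  · have h5 : Real.log δ + μ / 4 ≤ X := by
      have h6 : Real.log δ ≤ Real.log (μ / 8) - Real.log 5 := by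
        rw [← Real.log_div (by positivity) (by norm_num)]
        refine Real.log_le_log hδ (hδμ.trans (by linarith))
      have h7 : (1 : ℝ) / 2 ≤ Real.log 5 := by
        have := Real.one_sub_inv_le_log_of_pos (by norm_num : (0 : ℝ) < 5)
        norm_num at this ⊢
        linarith
      refine le_min ?_ ?_
      · have := Real.log_le_log (by positivity) (le_max_right ‖w‖ (μ / 8))
        linarith
      · have := Real.log_le_sub_one_of_pos hδ
        linarith
    linarith
  · rw [hexp, abs_le]
    have hxX : Real.exp x ≤ Real.exp X := Real.exp_le_exp.2 h1
    have hup : Real.exp X ≤ max ‖w‖ (μ / 8) := by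
      rw [← Real.exp_log hm]
      exact Real.exp_le_exp.2 (min_le_left _ _)
    have hlow : ‖w‖ - μ / 4 ≤ Real.exp X := by
      rcases min_choice (Real.log (max ‖w‖ (μ / 8))) (-10 * δ) with h | h
      · rw [hX, h, Real.exp_log hm]
        have := le_max_left ‖w‖ (μ / 8)
        linarith
      · rw [hX, h]
        have := Real.add_one_le_exp (-10 * δ)
        linarith
    constructor
    · have h3 : Real.exp (X - μ / 4) ≤ Real.exp x := Real.exp_le_exp.2 h2.le
      have h4 : Real.exp X * (1 - μ / 4) ≤ Real.exp (X - μ / 4) := by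
        rw [sub_eq_add_neg X, Real.exp_add]
        refine mul_le_mul_of_nonneg_left ?_ (Real.exp_pos _).le
        have := Real.add_one_le_exp (-(μ / 4))
        linarith
      have h5 : Real.exp X ≤ 1 := Real.exp_le_one_iff.2 hX0
      nlinarith
    · have : max ‖w‖ (μ / 8) ≤ ‖w‖ + μ / 2 :=
        max_le (by linarith) (by linarith [norm_nonneg w])
      linarith

/-- A map `F` near the disk of radius two, semiconjugated by an entire locally injective `Φ` to
a rotation, with an inverse branch `h` of `Φ` on a neighbourhood of the closed unit disk. -/
structure SpiralStage where
  Φ : ℂ → ℂ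
  h : ℂ → ℂ
  F : ℂ → ℂ
  R : ℝ
  α : ℝ
  σ : ℝ
  β : ℝ
  differentiable_Φ : Differentiable ℂ Φ
  deriv_Φ : ∀ z, deriv Φ z ≠ 0
  Φ_zero : Φ 0 = 0
  one_lt_R : 1 < R
  differentiableOn_h : DifferentiableOn ℂ h (ball 0 R)
  h_zero : h 0 = 0
  Φ_h : ∀ w ∈ ball (0 : ℂ) R, Φ (h w) = w
  norm_h_lt : ∀ w ∈ ball (0 : ℂ) R, ‖h w‖ < 2
  two_lt_σ : 2 < σ
  differentiableOn_F : DifferentiableOn ℂ F (ball 0 σ)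
  F_zero : F 0 = 0
  Φ_F : ∀ z ∈ ball (0 : ℂ) σ, Φ (F z) = exp (2 * Real.pi * I * α) * Φ z
  β_pos : 0 < β

/-- `S'` refines `S`: the new invariant disk is the image under `S.h` of a thin neighbourhood of
`q` spiral arms that wind around the unit disk. -/
structure SpiralStep (n : ℕ) (r : ℝ) (S S' : SpiralStage) (κ δ μ : ℝ) (q : ℕ) : Prop where
  κ_pos : 0 < κ
  δ_pos : 0 < δ
  one_le_q : 1 ≤ q
  small : 100 * q * (1 + κ) * δ ≤ 1
  width : 10 * δ * (1 + κ) + 11 / q ≤ μ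
  δ_le : 40 * δ ≤ μ
  osc : ∀ w ∈ closedBall (0 : ℂ) 1, ∀ w' ∈ closedBall (0 : ℂ) 1, ‖w - w'‖ ≤ μ →
    ‖S.h w - S.h w'‖ < 1 / (n + 1) ∧ ‖S.h w - S.h w'‖ < S.β / 2
  near : ∀ w ∈ closedBall (0 : ℂ) 1, ∀ k : ℤ, ∃ x ∈ Icc (Real.log δ) (-10 * δ),
    ‖exp ((1 + κ * I) * x + (2 * Real.pi * k / q : ℝ) * I) - w‖ ≤ μ / 2
  fac : ∀ w ∈ ball (0 : ℂ) S'.R, ∃ v : ℂ, ‖v‖ < 1 ∧ S'.h w = S.h v ∧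
    (‖v‖ < δ ∨ ∃ (k : ℤ) (ω : ℂ), exp ω = v ∧ |ω.im - κ * ω.re - 2 * Real.pi * k / q| < δ / q)
  dens : ∀ k : ℤ, ∀ x ∈ Icc (Real.log δ) (-δ), ∃ w ∈ closedBall (0 : ℂ) 1, ∃ v : ℂ, ‖v‖ < 1 ∧
    S'.h w = S.h v ∧ ‖v - exp ((1 + κ * I) * x + (2 * Real.pi * k / q : ℝ) * I)‖ < δ
  mod : ∀ z ∈ closedBall (0 : ℂ) 2, ∀ z' ∈ closedBall (0 : ℂ) 2, ‖z - z'‖ ≤ S'.β →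
    ‖S.Φ z - S.Φ z'‖ < δ
  β_le : S'.β ≤ S.β / 2
  α_close : |S'.α - S.α| ≤ S.β
  α_far : 4 * S'.β ≤ |S'.α - r|
  F_close : ∀ z ∈ closedBall (0 : ℂ) 2, ‖S'.F z - S.F z‖ ≤ S.β

theorem norm_exp_rotation_sub_le (a b : ℝ) :
    ‖exp (2 * Real.pi * I * a) - exp (2 * Real.pi * I * b)‖ ≤ 2 * Real.pi * |a - b| := by
  have h1 : exp (2 * Real.pi * I * a) - exp (2 * Real.pi * I * b)
      = exp ((2 * Real.pi * b : ℝ) * I) * (exp (I * (2 * Real.pi * (a - b) : ℝ)) - 1) := by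
    rw [mul_sub, ← Complex.exp_add, mul_one]
    congr 2 <;> (push_cast; ring)
  rw [h1, norm_mul, Complex.norm_exp_ofReal_mul_I, one_mul]
  refine (Real.norm_exp_I_mul_ofReal_sub_one_le).trans ?_
  rw [Real.norm_eq_abs, abs_mul, abs_of_pos (by positivity)]

theorem exists_spiralStep (n : ℕ) (r : ℝ) (S : SpiralStage) :
    ∃ (S' : SpiralStage) (κ δ μ : ℝ) (q : ℕ), SpiralStep n r S S' κ δ μ q := by
  have hpi := Real.pi_pos
  have hβ := S.β_pos
  obtain ⟨μ, hμ0, hμ1, hosc⟩ : ∃ μ > 0, μ ≤ 1 ∧ ∀ w ∈ closedBall (0 : ℂ) 1,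
      ∀ w' ∈ closedBall (0 : ℂ) 1, ‖w - w'‖ ≤ μ →
      ‖S.h w - S.h w'‖ < 1 / (n + 1) ∧ ‖S.h w - S.h w'‖ < S.β / 2 := by
    have huc := (isCompact_closedBall (0 : ℂ) 1).uniformContinuousOn_of_continuous
      (S.differentiableOn_h.continuousOn.mono (closedBall_subset_ball S.one_lt_R))
    obtain ⟨d, hd, h⟩ := Metric.uniformContinuousOn_iff.1 huc (min (1 / (n + 1)) (S.β / 2))
      (lt_min (by positivity) (by positivity))
    refine ⟨min (d / 2) 1, lt_min (by positivity) one_pos, min_le_right _ _,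
      fun w hw w' hw' hww => ?_⟩
    have := h w hw w' hw' (by
      rw [dist_eq_norm]
      have := hww.trans (min_le_left _ _)
      linarith)
    rwa [dist_eq_norm, lt_min_iff] at this
  set κ := 8 * Real.pi / μ with hκ
  have hκ0 : 0 < κ := by positivity
  have hσ2 := S.two_lt_σ
  obtain ⟨d, hd, hlift⟩ := exists_lift_perturbation S.differentiable_Φ S.deriv_Φ S.Φ_zero
    (σ := S.σ) (σ' := (2 + S.σ) / 2) (by linarith) (by linarith) S.differentiableOn_F S.F_zero
    S.Φ_F hβ
  obtain ⟨q, hq⟩ := exists_nat_gt (max (22 / μ) (max (1 / S.β) (2 * Real.pi / d)))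
  have hq1 : 22 / μ < q := (le_max_left _ _).trans_lt hq
  have hq2 : 1 / S.β < q := ((le_max_left _ _).trans (le_max_right _ _)).trans_lt hq
  have hq3 : 2 * Real.pi / d < q := ((le_max_right _ _).trans (le_max_right _ _)).trans_lt hq
  have hq0 : (0 : ℝ) < q := lt_trans (by positivity) hq1
  rw [div_lt_iff₀ (by positivity)] at hq1 hq2 hq3
  have hqN : 1 ≤ q := by exact_mod_cast hq0
  obtain ⟨p, hpr, hpα⟩ : ∃ p : ℤ, (p / q : ℝ) ≠ r ∧ |(p / q : ℝ) - S.α| ≤ 1 / q := by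
    have h1 := Int.floor_le (S.α * q)
    have h2 := Int.lt_floor_add_one (S.α * q)
    have key : ∀ p : ℤ, |(p : ℝ) - S.α * q| ≤ 1 → |(p / q : ℝ) - S.α| ≤ 1 / q := by
      intro p hp
      have : (p / q : ℝ) - S.α = (p - S.α * q) / q := by field_simp
      rw [this, abs_div, abs_of_pos hq0]
      gcongr
    by_cases hr : ((⌊S.α * q⌋ : ℤ) / q : ℝ) = r
    · refine ⟨⌊S.α * q⌋ + 1, ?_, key _ ?_⟩
      · rw [← hr]
        intro h
        field_simp at h
        push_cast at h
        linarith
      · push_cast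
        rw [abs_le]; constructor <;> linarith
    · refine ⟨⌊S.α * q⌋, hr, key _ ?_⟩
      rw [abs_le]; constructor <;> linarith
  set δ := min (1 / (100 * q * (1 + κ))) (μ / 40) with hδ
  have hδ0 : 0 < δ := lt_min (by positivity) (by positivity)
  have hδμ : δ ≤ μ / 40 := min_le_right _ _
  have hδq : 100 * q * (1 + κ) * δ ≤ 1 := by
    have : δ ≤ 1 / (100 * q * (1 + κ)) := min_le_left _ _
    rwa [le_div_iff₀ (by positivity), mul_comm] at this
  obtain ⟨ψ, g, R', hR', hψ, hψ', hψ0, hψζ, hg, hg0, hψg, hg1, hgfac, hgdens⟩ :=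
    exists_equivariant_step hκ0 hδ0 (by linarith) hqN
  obtain ⟨F', hF', hF'0, hΦF', hFF'⟩ := hlift (exp (2 * Real.pi * I * (p / q : ℝ))) (by
    refine (norm_exp_rotation_sub_le _ _).trans_lt ?_
    calc 2 * Real.pi * |(p / q : ℝ) - S.α| ≤ 2 * Real.pi * (1 / q) := by gcongr
      _ < d := by rw [mul_one_div, div_lt_iff₀ hq0]; linarith)
  obtain ⟨η, hη, hmod⟩ : ∃ η > 0, ∀ z ∈ closedBall (0 : ℂ) 2, ∀ z' ∈ closedBall (0 : ℂ) 2,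
      ‖z - z'‖ ≤ η → ‖S.Φ z - S.Φ z'‖ < δ := by
    have huc := (isCompact_closedBall (0 : ℂ) 2).uniformContinuousOn_of_continuous
      S.differentiable_Φ.continuous.continuousOn
    obtain ⟨d, hd, h⟩ := Metric.uniformContinuousOn_iff.1 huc δ hδ0
    refine ⟨d / 2, by positivity, fun z hz z' hz' hzz => ?_⟩
    have := h z hz z' hz' (by rw [dist_eq_norm]; linarith)
    rwa [dist_eq_norm] at this
  have hgR : ∀ w ∈ ball (0 : ℂ) R', g w ∈ ball (0 : ℂ) S.R := fun w hw => by
    rw [mem_ball_zero_iff]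
    exact (hg1 w hw).trans S.one_lt_R
  have hpr' : 0 < |(p / q : ℝ) - r| := abs_pos.2 (sub_ne_zero.2 hpr)
  have hζ : exp (2 * Real.pi * I * (p / q : ℝ)) ^ q = 1 := by
    rw [← Complex.exp_nat_mul, Complex.exp_eq_one_iff]
    refine ⟨p, ?_⟩
    have : (q : ℂ) ≠ 0 := by exact_mod_cast hq0.ne'
    push_cast
    field_simp
  let S' : SpiralStage :=
    { Φ := fun z => ψ (S.Φ z)
      h := fun w => S.h (g w)
      F := F'
      R := R'
      α := p / q
      σ := (2 + S.σ) / 2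
      β := min (S.β / 2) (min (|(p / q : ℝ) - r| / 4) η)
      differentiable_Φ := hψ.comp S.differentiable_Φ
      deriv_Φ := fun z => by
        have := ((hψ (S.Φ z)).hasDerivAt.comp z (S.differentiable_Φ z).hasDerivAt).deriv
        have h2 : deriv (fun z => ψ (S.Φ z)) z = deriv ψ (S.Φ z) * deriv S.Φ z := this
        rw [h2]
        exact mul_ne_zero (hψ' _) (S.deriv_Φ z)
      Φ_zero := by rw [S.Φ_zero, hψ0]
      one_lt_R := hR'
      differentiableOn_h := S.differentiableOn_h.comp hg hgR
      h_zero := by rw [hg0, S.h_zero]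
      Φ_h := fun w hw => by rw [S.Φ_h _ (hgR w hw), hψg w hw]
      norm_h_lt := fun w hw => S.norm_h_lt _ (hgR w hw)
      two_lt_σ := by linarith
      differentiableOn_F := hF'
      F_zero := hF'0
      Φ_F := fun z hz => by rw [hΦF' z hz, hψζ _ _ hζ]
      β_pos := lt_min (by positivity) (lt_min (by positivity) hη) }
  refine ⟨S', κ, δ, μ, q, ?_⟩
  have hSβ : S'.β = min (S.β / 2) (min (|(p / q : ℝ) - r| / 4) η) := rfl
  exact
    { κ_pos := hκ0
      δ_pos := hδ0
      one_le_q := hqN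
      small := hδq
      width := by
        have h1 : 10 * δ * (1 + κ) ≤ 1 / q := by
          rw [le_div_iff₀ hq0]
          nlinarith
        have h2 : 12 / (q : ℝ) ≤ μ := by
          rw [div_le_iff₀ hq0]; linarith
        have h3 : 1 / (q : ℝ) + 11 / q = 12 / q := by ring
        linarith
      δ_le := by linarith
      osc := hosc
      near := fun w hw k =>
        exists_spiral_near hμ0 hμ1 hκ hδ0 hδμ (mem_closedBall_zero_iff.1 hw) _
      fac := fun w hw => ⟨g w, hg1 w hw, rfl, hgfac w hw⟩
      dens := fun k x hx => by
        obtain ⟨w, hw, h⟩ := hgdens k x hx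
        exact ⟨w, hw, g w, hg1 w (closedBall_subset_ball hR' hw), rfl, h⟩
      mod := fun z hz z' hz' h => hmod z hz z' hz'
        (h.trans (hSβ ▸ (min_le_right _ _).trans (min_le_right _ _)))
      β_le := min_le_left _ _
      α_close := hpα.trans (by rw [div_le_iff₀ hq0]; linarith)
      α_far := by
        have : S'.β ≤ |(p / q : ℝ) - r| / 4 := (min_le_right _ _).trans (min_le_left _ _)
        change 4 * S'.β ≤ |(p / q : ℝ) - r|
        linarith
      F_close := fun z hz => hFF' z (closedBall_subset_ball (by linarith) hz) }

theorem isPreconnected_iInter_of_antitone {X : Type*} [TopologicalSpace X] [T2Space X]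
    [NormalSpace X] {K : ℕ → Set X} (hK : Antitone K) (hc : ∀ n, IsCompact (K n))
    (hp : ∀ n, IsPreconnected (K n)) : IsPreconnected (⋂ n, K n) := by
  have hcl : IsClosed (⋂ n, K n) := isClosed_iInter fun n => (hc n).isClosed
  rw [isPreconnected_iff_subset_of_fully_disjoint_closed hcl]
  intro u v hu hv huv hd
  obtain ⟨U, V, hU, hV, huU, hvV, hUV⟩ := normal_separation hu hv hd
  obtain ⟨n, hn⟩ := exists_subset_nhds_of_isCompact (V := K) hK.directed_ge hc (U := U ∪ V) (by
    intro x hx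
    exact (hU.union hV).mem_nhds ((union_subset_union huU hvV) (huv hx)))
  rcases (hp n).subset_or_subset hU hV hUV hn with h | h
  · left
    intro x hx
    rcases huv hx with h' | h'
    · exact h'
    · exact (disjoint_left.1 hUV (h (mem_iInter.1 hx n)) (hvV h')).elim
  · right
    intro x hx
    rcases huv hx with h' | h'
    · exact (disjoint_left.1 hUV (huU h') (h (mem_iInter.1 hx n))).elim
    · exact h'

theorem norm_sub_le_of_halving {E : Type*} [SeminormedAddCommGroup E] {a : ℕ → E} {β : ℕ → ℝ}
    (h : ∀ n, ‖a (n + 1) - a n‖ ≤ β n) (hβ : ∀ n, β (n + 1) ≤ β n / 2) {n m : ℕ} (hnm : n ≤ m) :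
    ‖a m - a n‖ ≤ 2 * β n - 2 * β m := by
  induction m, hnm using Nat.le_induction with
  | base => simp
  | succ m _ ih =>
    have h1 := norm_sub_le_norm_sub_add_norm_sub (a (m + 1)) (a m) (a n)
    linarith [h m, hβ m]

theorem tendsto_zero_of_halving {β : ℕ → ℝ} (h0 : ∀ n, 0 ≤ β n)
    (hβ : ∀ n, β (n + 1) ≤ β n / 2) : Tendsto β atTop (nhds 0) := by
  have h1 : ∀ n, β n ≤ β 0 * (1 / 2) ^ n := by
    intro n
    induction n with
    | zero => simp
    | succ n ih => rw [pow_succ]; linarith [hβ n]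
  refine squeeze_zero h0 h1 ?_
  have := (tendsto_pow_atTop_nhds_zero_of_lt_one (by norm_num : (0 : ℝ) ≤ 1 / 2)
    (by norm_num)).const_mul (β 0)
  simpa using this

theorem exists_limit_of_halving {E : Type*} [NormedAddCommGroup E] [CompleteSpace E]
    {a : ℕ → E} {β : ℕ → ℝ} (h0 : ∀ n, 0 ≤ β n)
    (h : ∀ n, ‖a (n + 1) - a n‖ ≤ β n) (hβ : ∀ n, β (n + 1) ≤ β n / 2) :
    ∃ l, Tendsto a atTop (nhds l) ∧ ∀ n, ‖l - a n‖ ≤ 2 * β n := by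
  have hc : CauchySeq a := by
    refine cauchySeq_of_le_tendsto_0 (fun n => 4 * β n) ?_ ?_
    · intro m k N hm hk
      rw [dist_eq_norm]
      have h1 := norm_sub_le_of_halving h hβ hm
      have h2 := norm_sub_le_of_halving h hβ hk
      rw [norm_sub_rev] at h2
      have h3 := norm_sub_le_norm_sub_add_norm_sub (a m) (a N) (a k)
      linarith [h0 m, h0 k]
    · simpa using (tendsto_zero_of_halving h0 hβ).const_mul 4
  obtain ⟨l, hl⟩ := cauchySeq_tendsto_of_complete hc
  refine ⟨l, hl, fun n => ?_⟩
  refine le_of_tendsto ((hl.sub_const (a n)).norm) ?_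
  filter_upwards [eventually_ge_atTop n] with m hm
  have := norm_sub_le_of_halving h hβ hm
  linarith [h0 m]

namespace SpiralStage

variable (S : SpiralStage)

/-- The closed invariant disk of a stage. -/
def disk : Set ℂ := S.h '' closedBall 0 1

theorem continuousOn_h : ContinuousOn S.h (closedBall 0 1) :=
  S.differentiableOn_h.continuousOn.mono (closedBall_subset_ball S.one_lt_R)

theorem injOn_h : InjOn S.h (ball 0 S.R) := fun a ha b hb hab => by
  rw [← S.Φ_h a ha, ← S.Φ_h b hb, hab]

theorem deriv_h {w : ℂ} (hw : w ∈ ball (0 : ℂ) S.R) : deriv S.h w ≠ 0 := by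
  intro h0
  have h1 := (S.differentiableOn_h.differentiableAt (isOpen_ball.mem_nhds hw)).hasDerivAt
  have h2 := (S.differentiable_Φ (S.h w)).hasDerivAt.comp w h1
  have h3 : HasDerivAt (S.Φ ∘ S.h) 1 w := (hasDerivAt_id w).congr_of_eventuallyEq (by
    filter_upwards [isOpen_ball.mem_nhds hw] with y hy using S.Φ_h y hy)
  have := h2.unique h3
  rw [h0, mul_zero] at this
  exact zero_ne_one this

theorem isOpen_image_h {V : Set ℂ} (hV : IsOpen V) (hVR : V ⊆ ball 0 S.R) :
    IsOpen (S.h '' V) :=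
  isOpen_image_of_deriv_ne_zero isOpen_ball S.differentiableOn_h (fun _ hz => S.deriv_h hz) hV hVR

theorem isCompact_disk : IsCompact S.disk :=
  (isCompact_closedBall _ _).image_of_continuousOn S.continuousOn_h

theorem isPathConnected_disk : IsPathConnected S.disk :=
  ((convex_closedBall (0 : ℂ) 1).isPathConnected
    ⟨0, mem_closedBall_self zero_le_one⟩).image' S.continuousOn_h

theorem isConnected_compl_disk : IsConnected S.diskᶜ :=
  isConnected_compl_image_closedBall one_pos S.one_lt_R S.differentiableOn_h
    (fun _ hz => S.deriv_h hz) S.injOn_h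

theorem zero_mem_disk : 0 ∈ S.disk := ⟨0, mem_closedBall_self zero_le_one, S.h_zero⟩

theorem disk_subset : S.disk ⊆ ball 0 2 := by
  rintro _ ⟨w, hw, rfl⟩
  exact mem_ball_zero_iff.2 (S.norm_h_lt w (closedBall_subset_ball S.one_lt_R hw))

theorem deriv_F_zero : deriv S.F 0 = exp (2 * Real.pi * I * S.α) := by
  have hσ : (0 : ℝ) < S.σ := by linarith [S.two_lt_σ]
  have hn : ball (0 : ℂ) S.σ ∈ nhds 0 := ball_mem_nhds 0 hσ
  have h1 := (S.differentiableOn_F.differentiableAt hn).hasDerivAt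
  have h2 := (S.differentiable_Φ (S.F 0)).hasDerivAt.comp 0 h1
  have h3 := (S.differentiable_Φ 0).hasDerivAt.const_mul (exp (2 * Real.pi * I * S.α))
  have h4 := h2.unique (h3.congr_of_eventuallyEq (by
    filter_upwards [hn] with y hy using S.Φ_F y hy))
  rw [S.F_zero, mul_comm] at h4
  exact mul_right_cancel₀ (S.deriv_Φ 0) h4

theorem F_h {w : ℂ} (hw : w ∈ ball (0 : ℂ) S.R) :
    S.F (S.h w) = S.h (exp (2 * Real.pi * I * S.α) * w) := by
  set lam := exp (2 * Real.pi * I * S.α) with hlam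
  have hn : ‖lam‖ = 1 := by
    have : lam = exp ((2 * Real.pi * S.α : ℝ) * I) := by
      rw [hlam]; congr 1; push_cast; ring
    rw [this, Complex.norm_exp_ofReal_mul_I]
  have hR : (0 : ℝ) < S.R := by linarith [S.one_lt_R]
  have hm : MapsTo (fun w => lam * w) (ball 0 S.R) (ball 0 S.R) := fun w hw => by
    simpa [hn] using hw
  have hm2 : MapsTo S.h (ball 0 S.R) (ball 0 S.σ) := fun w hw => by
    rw [mem_ball_zero_iff]
    exact (S.norm_h_lt w hw).trans S.two_lt_σ
  have hd1 : DifferentiableOn ℂ (fun w => S.F (S.h w)) (ball 0 S.R) :=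
    S.differentiableOn_F.comp S.differentiableOn_h hm2
  have hd2 : DifferentiableOn ℂ (fun w => S.h (lam * w)) (ball 0 S.R) :=
    S.differentiableOn_h.comp ((differentiable_id.const_mul lam).differentiableOn) hm
  have h0 : (0 : ℂ) ∈ ball (0 : ℂ) S.R := mem_ball_self hR
  refine (hd1.analyticOnNhd isOpen_ball).eqOn_of_preconnected_of_eventuallyEq
    (hd2.analyticOnNhd isOpen_ball) (convex_ball _ _).isPreconnected h0 ?_ hw
  have hinv := (hasStrictDerivAt_of_differentiable S.differentiable_Φ 0).eventually_left_inverse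
    (S.deriv_Φ 0)
  have hc1 : Tendsto (fun w => S.F (S.h w)) (nhds 0) (nhds 0) := by
    have := (hd1.continuousOn.continuousAt (isOpen_ball.mem_nhds h0)).tendsto
    simpa only [S.h_zero, S.F_zero] using this
  have hc2 : Tendsto (fun w => S.h (lam * w)) (nhds 0) (nhds 0) := by
    have := (hd2.continuousOn.continuousAt (isOpen_ball.mem_nhds h0)).tendsto
    simpa only [mul_zero, S.h_zero] using this
  filter_upwards [hc1.eventually hinv, hc2.eventually hinv, isOpen_ball.mem_nhds h0] with w h1 h2 h3
  rw [← h1, ← h2, S.Φ_F _ (hm2 h3), S.Φ_h _ h3, S.Φ_h _ (hm h3)]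

theorem F_image_disk : S.F '' S.disk = S.disk := by
  set lam := exp (2 * Real.pi * I * S.α) with hlam
  have hn : ‖lam‖ = 1 := by
    have : lam = exp ((2 * Real.pi * S.α : ℝ) * I) := by
      rw [hlam]; congr 1; push_cast; ring
    rw [this, Complex.norm_exp_ofReal_mul_I]
  have hsub := closedBall_subset_ball (x := (0 : ℂ)) S.one_lt_R
  ext z
  constructor
  · rintro ⟨_, ⟨w, hw, rfl⟩, rfl⟩
    exact ⟨lam * w, by simpa [hn] using hw, (S.F_h (hsub hw)).symm⟩
  · rintro ⟨w, hw, rfl⟩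
    have hw' : lam⁻¹ * w ∈ closedBall (0 : ℂ) 1 := by simpa [hn] using hw
    refine ⟨_, ⟨lam⁻¹ * w, hw', rfl⟩, ?_⟩
    rw [S.F_h (hsub hw'), mul_inv_cancel_left₀ (exp_ne_zero _)]

/-- The identity of the unit disk. -/
def initial : SpiralStage where
  Φ := id
  h := id
  F := fun z => exp (2 * Real.pi * I * (0 : ℝ)) * z
  R := 2
  α := 0
  σ := 3
  β := 1 / 16
  differentiable_Φ := differentiable_id
  deriv_Φ := by simp
  Φ_zero := rfl
  one_lt_R := one_lt_two
  differentiableOn_h := differentiableOn_id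
  h_zero := rfl
  Φ_h := fun _ _ => rfl
  norm_h_lt := fun w hw => mem_ball_zero_iff.1 hw
  two_lt_σ := by norm_num
  differentiableOn_F := (differentiable_id.const_mul _).differentiableOn
  F_zero := mul_zero _
  Φ_F := fun _ _ => rfl
  β_pos := by norm_num

end SpiralStage

/-- An infinite sequence of stages, starting with the unit disk, along with the rational numbers
avoided one after the other. -/
structure SpiralTower where
  S : ℕ → SpiralStage
  ρ : ℕ → ℚ
  κ : ℕ → ℝ
  δ : ℕ → ℝ
  μ : ℕ → ℝ
  q : ℕ → ℕ
  surjective_ρ : Function.Surjective ρ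
  zero : S 0 = SpiralStage.initial
  step : ∀ n, SpiralStep n (ρ n) (S n) (S (n + 1)) (κ n) (δ n) (μ n) (q n)

theorem nonempty_spiralTower : Nonempty SpiralTower := by
  obtain ⟨ρ, hρ⟩ := exists_surjective_nat ℚ
  choose next κ δ μ q h using exists_spiralStep
  let S : ℕ → SpiralStage := fun n =>
    Nat.rec SpiralStage.initial (fun n s => next n (ρ n) s) n
  exact ⟨⟨S, ρ, fun n => κ n (ρ n) (S n), fun n => δ n (ρ n) (S n), fun n => μ n (ρ n) (S n),
    fun n => q n (ρ n) (S n), hρ, rfl, fun n => h n (ρ n) (S n)⟩⟩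

namespace SpiralTower

variable (T : SpiralTower)

/-- The intersection of the invariant disks of all the stages. -/
def hull : Set ℂ := ⋂ n, (T.S n).disk

theorem β_nonneg (n : ℕ) : 0 ≤ (T.S n).β := (T.S n).β_pos.le

theorem β_succ (n : ℕ) : (T.S (n + 1)).β ≤ (T.S n).β / 2 := (T.step n).β_le

theorem disk_succ (n : ℕ) : (T.S (n + 1)).disk ⊆ (T.S n).h '' ball 0 1 := by
  rintro _ ⟨w, hw, rfl⟩
  obtain ⟨v, hv, h, _⟩ := (T.step n).fac w (closedBall_subset_ball (T.S (n + 1)).one_lt_R hw)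
  exact ⟨v, mem_ball_zero_iff.2 hv, h.symm⟩

theorem antitone_disk : Antitone fun n => (T.S n).disk :=
  antitone_nat_of_succ_le fun n => (T.disk_succ n).trans (image_mono ball_subset_closedBall)

theorem isCompact_hull : IsCompact T.hull :=
  (T.S 0).isCompact_disk.of_isClosed_subset
    (isClosed_iInter fun n => (T.S n).isCompact_disk.isClosed) (iInter_subset _ 0)

theorem zero_mem_hull : 0 ∈ T.hull := mem_iInter.2 fun n => (T.S n).zero_mem_disk

theorem isConnected_hull : IsConnected T.hull :=
  ⟨⟨0, T.zero_mem_hull⟩, isPreconnected_iInter_of_antitone T.antitone_disk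
    (fun n => (T.S n).isCompact_disk)
    fun n => (T.S n).isPathConnected_disk.isConnected.isPreconnected⟩

theorem isConnected_compl_hull : IsConnected T.hullᶜ := by
  have h3 : ∀ n, (3 : ℂ) ∈ (T.S n).diskᶜ := fun n h => by
    have := mem_ball_zero_iff.1 ((T.S n).disk_subset h)
    norm_num at this
  have : T.hullᶜ = ⋃ n, (T.S n).diskᶜ := compl_iInter _
  rw [this]
  exact ⟨⟨3, mem_iUnion.2 ⟨0, h3 0⟩⟩, isPreconnected_iUnion ⟨3, mem_iInter.2 h3⟩
    fun n => (T.S n).isConnected_compl_disk.isPreconnected⟩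

theorem hull_subset_ball : T.hull ⊆ ball 0 1 := by
  intro z hz
  obtain ⟨w, hw, rfl⟩ := T.disk_succ 0 (mem_iInter.1 hz 1)
  rw [T.zero]
  exact hw

theorem exists_mem_disk_near {n : ℕ} {z : ℂ} (hz : z ∈ (T.S n).disk) {m : ℕ} (hnm : n ≤ m) :
    ∃ z' ∈ (T.S m).disk, ‖z' - z‖ ≤ (T.S n).β - (T.S m).β := by
  induction m, hnm using Nat.le_induction with
  | base => exact ⟨z, hz, by simp⟩
  | succ m _ ih =>
    obtain ⟨_, ⟨w, hw, rfl⟩, hwz⟩ := ih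
    have st := T.step m
    obtain ⟨x, hx, hxw⟩ := st.near w hw 0
    have hδ := st.δ_pos
    obtain ⟨w', hw', v, hv, hwv, hvx⟩ := st.dens 0 x ⟨hx.1, by linarith [hx.2]⟩
    refine ⟨_, ⟨w', hw', rfl⟩, ?_⟩
    have h1 : ‖v - w‖ ≤ T.μ m := by
      refine (norm_sub_le_norm_sub_add_norm_sub _ _ _).trans (add_le_add hvx.le hxw) |>.trans ?_
      have := st.δ_le
      linarith
    have h2 := (st.osc v (mem_closedBall_zero_iff.2 hv.le) w hw h1).2
    rw [hwv]
    have h3 := norm_sub_le_norm_sub_add_norm_sub ((T.S m).h v) ((T.S m).h w) z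
    linarith [T.β_succ m]

theorem exists_mem_hull_near {n : ℕ} {z : ℂ} (hz : z ∈ (T.S n).disk) :
    ∃ z' ∈ T.hull, ‖z' - z‖ ≤ (T.S n).β := by
  have key : (⋂ m : ℕ, (T.S m).disk ∩ closedBall z (T.S n).β).Nonempty := by
    refine IsCompact.nonempty_iInter_of_sequence_nonempty_isCompact_isClosed
      (fun m : ℕ => (T.S m).disk ∩ closedBall z (T.S n).β)
      (fun m => inter_subset_inter_left _ (T.antitone_disk m.le_succ)) (fun m => ?_)
      ((T.S 0).isCompact_disk.inter_right isClosed_closedBall)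
      fun m => (T.S m).isCompact_disk.isClosed.inter isClosed_closedBall
    obtain ⟨z', hz', h⟩ := T.exists_mem_disk_near hz (le_max_left n m)
    refine ⟨z', T.antitone_disk (le_max_right n m) hz', mem_closedBall_iff_norm.2 ?_⟩
    linarith [T.β_nonneg (max n m)]
  obtain ⟨z', hz'⟩ := key
  rw [mem_iInter] at hz'
  exact ⟨z', mem_iInter.2 fun m => (hz' m).1, mem_closedBall_iff_norm.1 (hz' 0).2⟩

theorem exists_ne_zero_mem_hull : ∃ z ∈ T.hull, z ≠ 0 := by
  have h1 : (1 : ℂ) ∈ (T.S 0).disk := by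
    rw [T.zero]
    exact ⟨1, by simp, rfl⟩
  obtain ⟨z, hz, h⟩ := T.exists_mem_hull_near h1
  refine ⟨z, hz, ?_⟩
  rintro rfl
  rw [T.zero] at h
  have : SpiralStage.initial.β = 1 / 16 := rfl
  rw [this] at h
  norm_num at h

theorem preperfect_hull : Preperfect T.hull := by
  obtain ⟨z, hz, h0⟩ := T.exists_ne_zero_mem_hull
  exact T.isConnected_hull.isPreconnected.preperfect_of_nontrivial ⟨z, hz, 0, T.zero_mem_hull, h0⟩

theorem exists_irrational : ∃ α : ℝ, Irrational α ∧
    Tendsto (fun n => (T.S n).α) atTop (nhds α) := by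
  obtain ⟨α, hα, hle⟩ := exists_limit_of_halving (a := fun n => (T.S n).α) T.β_nonneg
    (fun n => (T.step n).α_close) T.β_succ
  refine ⟨α, ?_, hα⟩
  rintro ⟨r, hr⟩
  obtain ⟨n, hn⟩ := T.surjective_ρ r
  have h1 := (T.step n).α_far
  have h2 := hle (n + 1)
  rw [hn, hr, abs_sub_comm, ← Real.norm_eq_abs] at h1
  linarith [(T.S (n + 1)).β_pos]

theorem exists_limit_map : ∃ f : ℂ → ℂ, ∀ n, ∀ z ∈ closedBall (0 : ℂ) 2,
    ‖f z - (T.S n).F z‖ ≤ 2 * (T.S n).β := by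
  have : ∀ z ∈ closedBall (0 : ℂ) 2, ∃ l, ∀ n, ‖l - (T.S n).F z‖ ≤ 2 * (T.S n).β := by
    intro z hz
    obtain ⟨l, _, h⟩ := exists_limit_of_halving (a := fun n => (T.S n).F z) T.β_nonneg
      (fun n => (T.step n).F_close z hz) T.β_succ
    exact ⟨l, h⟩
  choose! f hf using this
  exact ⟨f, fun n z hz => hf z hz n⟩

variable {T} {f : ℂ → ℂ}

theorem tendsto_F (hf : ∀ n, ∀ z ∈ closedBall (0 : ℂ) 2, ‖f z - (T.S n).F z‖ ≤ 2 * (T.S n).β) :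
    TendstoUniformlyOn (fun n => (T.S n).F) f atTop (ball 0 2) := by
  rw [Metric.tendstoUniformlyOn_iff]
  intro ε hε
  have h := (tendsto_zero_of_halving T.β_nonneg T.β_succ).const_mul 2
  rw [mul_zero] at h
  filter_upwards [h.eventually (gt_mem_nhds hε)] with n hn z hz
  rw [dist_eq_norm]
  exact (hf n z (ball_subset_closedBall hz)).trans_lt hn

theorem differentiableOn_limit
    (hf : ∀ n, ∀ z ∈ closedBall (0 : ℂ) 2, ‖f z - (T.S n).F z‖ ≤ 2 * (T.S n).β) :
    DifferentiableOn ℂ f (ball 0 2) :=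
  (tendsto_F hf).tendstoLocallyUniformlyOn.differentiableOn
    (Eventually.of_forall fun n => (T.S n).differentiableOn_F.mono
      (ball_subset_ball (T.S n).two_lt_σ.le)) isOpen_ball

theorem limit_zero
    (hf : ∀ n, ∀ z ∈ closedBall (0 : ℂ) 2, ‖f z - (T.S n).F z‖ ≤ 2 * (T.S n).β) : f 0 = 0 := by
  have h := (tendsto_F hf).tendsto_at (mem_ball_self two_pos)
  simp only [(T.S _).F_zero] at h
  exact tendsto_nhds_unique h tendsto_const_nhds |>.symm ▸ rfl

theorem deriv_limit
    (hf : ∀ n, ∀ z ∈ closedBall (0 : ℂ) 2, ‖f z - (T.S n).F z‖ ≤ 2 * (T.S n).β) {α : ℝ}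
    (hα : Tendsto (fun n => (T.S n).α) atTop (nhds α)) :
    deriv f 0 = exp (2 * Real.pi * I * α) := by
  have h1 := ((tendsto_F hf).tendstoLocallyUniformlyOn.deriv
    (Eventually.of_forall fun n => (T.S n).differentiableOn_F.mono
      (ball_subset_ball (T.S n).two_lt_σ.le)) isOpen_ball).tendsto_at (mem_ball_self two_pos)
  have h2 : Tendsto (fun n => exp (2 * Real.pi * I * (T.S n).α)) atTop
      (nhds (exp (2 * Real.pi * I * α))) :=
    ((Complex.continuous_exp.comp (continuous_const.mul Complex.continuous_ofReal)).tendsto α).comp hα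
  refine tendsto_nhds_unique h1 (h2.congr fun n => ?_)
  exact (T.S n).deriv_F_zero.symm

theorem injOn_limit
    (hf : ∀ n, ∀ z ∈ closedBall (0 : ℂ) 2, ‖f z - (T.S n).F z‖ ≤ 2 * (T.S n).β) :
    InjOn f (ball 0 1) := by
  have h0 : ∀ z ∈ closedBall (0 : ℂ) 2, ‖f z - z‖ ≤ 1 / 8 := by
    intro z hz
    have := hf 0 z hz
    rw [T.zero] at this
    have h1 : SpiralStage.initial.F z = z := by simp [SpiralStage.initial]
    have h2 : SpiralStage.initial.β = 1 / 16 := rfl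
    rw [h1, h2] at this
    linarith
  have hd : DifferentiableOn ℂ (fun z => f z - z) (ball 0 2) :=
    (differentiableOn_limit hf).sub differentiableOn_id
  have hb : ∀ z ∈ ball (0 : ℂ) 1, closedBall z 1 ⊆ ball 0 2 := fun z hz => by
    refine closedBall_subset_ball' ?_
    have := mem_ball.1 hz
    linarith
  have hder : ∀ z ∈ ball (0 : ℂ) 1, ‖deriv (fun z => f z - z) z‖ ≤ 1 / 8 := by
    intro z hz
    have := norm_deriv_le_of_forall_mem_sphere_norm_le (c := z) (C := 1 / 8) one_pos
      ((hd.mono (hb z hz)).diffContOnCl_ball subset_rfl)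
      fun w hw => h0 w (ball_subset_closedBall (hb z hz (sphere_subset_closedBall hw)))
    simpa using this
  intro a ha b hb' hab
  have h1 := Convex.norm_image_sub_le_of_norm_deriv_le (𝕜 := ℂ) (f := fun z => f z - z)
    (fun z hz => hd.differentiableAt (isOpen_ball.mem_nhds (ball_subset_ball one_le_two hz)))
    hder (convex_ball (0 : ℂ) 1) ha hb'
  have h2 : f b - b - (f a - a) = -(b - a) := by rw [hab]; ring
  rw [h2, norm_neg] at h1
  have h3 : ‖b - a‖ = 0 := by linarith [norm_nonneg (b - a)]
  exact (sub_eq_zero.1 (norm_eq_zero.1 h3)).symm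

theorem image_hull
    (hf : ∀ n, ∀ z ∈ closedBall (0 : ℂ) 2, ‖f z - (T.S n).F z‖ ≤ 2 * (T.S n).β) :
    f '' T.hull = T.hull := by
  have h2 : ∀ {n z}, z ∈ (T.S n).disk → z ∈ ball (0 : ℂ) 2 := fun h => (T.S _).disk_subset h
  have hβ := (tendsto_zero_of_halving T.β_nonneg T.β_succ).const_mul 2
  rw [mul_zero] at hβ
  ext z
  constructor
  · rintro ⟨y, hy, rfl⟩
    refine mem_iInter.2 fun n => ?_
    have h := (tendsto_F hf).tendsto_at (h2 (mem_iInter.1 hy 0))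
    refine (T.S n).isCompact_disk.isClosed.mem_of_tendsto h ?_
    filter_upwards [eventually_ge_atTop n] with m hm
    refine T.antitone_disk hm ?_
    change _ ∈ (T.S m).disk
    rw [← (T.S m).F_image_disk]
    exact mem_image_of_mem _ (mem_iInter.1 hy m)
  · intro hz
    have hy : ∀ n, ∃ y ∈ (T.S n).disk, (T.S n).F y = z := fun n => by
      have := mem_iInter.1 hz n
      rwa [← (T.S n).F_image_disk] at this
    choose y hy hyz using hy
    obtain ⟨l, hl, φ, hφ, hlim⟩ := (T.S 0).isCompact_disk.tendsto_subseq
      fun n => T.antitone_disk n.zero_le (hy n)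
    refine ⟨l, mem_iInter.2 fun n => ?_, ?_⟩
    · refine (T.S n).isCompact_disk.isClosed.mem_of_tendsto hlim ?_
      filter_upwards [eventually_ge_atTop n] with m hm
      exact T.antitone_disk (hm.trans (hφ.id_le m)) (hy _)
    · have hc : Tendsto (fun m => f (y (φ m))) atTop (nhds (f l)) :=
        ((differentiableOn_limit hf).continuousOn.continuousAt
          (isOpen_ball.mem_nhds (h2 hl))).tendsto.comp hlim
      refine tendsto_nhds_unique hc ?_
      rw [tendsto_iff_norm_sub_tendsto_zero]
      refine squeeze_zero (fun _ => norm_nonneg _) (fun m => ?_) (hβ.comp hφ.tendsto_atTop)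
      have := hf (φ m) (y (φ m)) (ball_subset_closedBall (h2 (hy _)))
      rwa [hyz] at this

end SpiralTower

theorem mem_of_irrational_orbit {α : ℝ} (hα : Irrational α) {h : ℂ → ℂ} {w : ℂ}
    (hh : ContinuousOn h (sphere 0 ‖w‖)) {K : Set ℂ} (hK : IsClosed K)
    (horb : ∀ n : ℕ, h (exp (2 * Real.pi * I * α) ^ n * w) ∈ K) {v : ℂ} (hv : ‖v‖ = ‖w‖) :
    h v ∈ K := by
  rcases eq_or_ne w 0 with rfl | hw
  · rw [norm_zero, norm_eq_zero] at hv
    simpa [hv] using horb 0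
  let g : AddCircle (1 : ℝ) → ℂ := fun θ => h ((AddCircle.toCircle θ : ℂ) * w)
  have hg : Continuous g := by
    refine hh.comp_continuous
      ((continuous_subtype_val.comp AddCircle.continuous_toCircle).mul continuous_const) fun θ => ?_
    rw [mem_sphere_zero_iff_norm, Complex.norm_mul, Circle.norm_coe, one_mul]
  have hexp : ∀ x : ℝ, ((AddCircle.toCircle (x : AddCircle (1 : ℝ)) : Circle) : ℂ)
      = exp (2 * Real.pi * I * x) := by
    intro x
    rw [AddCircle.toCircle_apply_mk, Circle.coe_exp]
    congr 1
    push_cast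
    ring
  have hdense : DenseRange (fun n : ℕ => n • (α : AddCircle (1 : ℝ))) := by
    rw [← denseRange_zsmul_iff_nsmul, AddCircle.denseRange_zsmul_coe_iff, div_one]
    exact hα
  have hmem : ∀ θ, g θ ∈ K := by
    refine fun θ => hdense.induction_on (p := fun θ => g θ ∈ K) θ (hK.preimage hg) fun n => ?_
    change h _ ∈ K
    have : ((AddCircle.toCircle (n • (α : AddCircle (1 : ℝ))) : Circle) : ℂ)
        = exp (2 * Real.pi * I * α) ^ n := by
      rw [AddCircle.toCircle_nsmul, Circle.coe_pow, hexp]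
    rw [this]
    exact horb n
  have h1 := hmem ((arg (v / w) / (2 * Real.pi) : ℝ) : AddCircle (1 : ℝ))
  have h2 : ((AddCircle.toCircle ((arg (v / w) / (2 * Real.pi) : ℝ) : AddCircle (1 : ℝ)) :
      Circle) : ℂ) * w = v := by
    have h3 : ‖v / w‖ = 1 := by
      rw [norm_div, hv, div_self (norm_ne_zero_iff.2 hw)]
    have h4 := norm_mul_exp_arg_mul_I (v / w)
    rw [h3, ofReal_one, one_mul] at h4
    have h5 : (2 * Real.pi * I * ((arg (v / w) / (2 * Real.pi) : ℝ) : ℂ) : ℂ)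
        = arg (v / w) * I := by
      have := Real.pi_ne_zero
      push_cast
      field_simp
    rw [hexp, h5, h4, div_mul_cancel₀ _ hw]
  change h _ ∈ K at h1
  rwa [h2] at h1

/-- A nontrivial closed connected invariant set of an irrationally indifferent linearizable germ
is a neighbourhood of the origin. -/
theorem mem_nhds_of_linearizable {α : ℝ} (hα : Irrational α) {f : ℂ → ℂ} (hlin : Linearizable α f)
    {K : Set ℂ} (hK : IsClosed K) (hKp : IsPreconnected K) (h0 : 0 ∈ K)
    (hne : ∃ z ∈ K, z ≠ 0) (hfK : ∀ z ∈ K, f z ∈ K) : K ∈ nhds 0 := by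
  obtain ⟨h, V, hV, h0V, hd, hinj, hh0, heq⟩ := hlin
  obtain ⟨z₁, hz₁, hz₁0⟩ := hne
  obtain ⟨ρ₁, hρ₁, hb₁⟩ := Metric.eventually_nhds_iff_ball.1 heq
  have hc : ContinuousAt h 0 := (hd.differentiableAt (hV.mem_nhds h0V)).continuousAt
  have hpre : V ∩ h ⁻¹' ball 0 ‖z₁‖ ∈ nhds 0 := by
    refine inter_mem (hV.mem_nhds h0V) (hc ?_)
    rw [hh0]
    exact ball_mem_nhds 0 (norm_pos_iff.2 hz₁0)
  obtain ⟨ρ₂, hρ₂, hb₂⟩ := Metric.mem_nhds_iff.1 hpre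
  set ρ := min ρ₁ ρ₂ with hρdef
  have hρ : 0 < ρ := lt_min hρ₁ hρ₂
  have hρV : ball (0 : ℂ) ρ ⊆ V := fun z hz =>
    (hb₂ (ball_subset_ball (min_le_right _ _) hz)).1
  have hnorm : ∀ z ∈ ball (0 : ℂ) ρ, ‖h z‖ < ‖z₁‖ := fun z hz =>
    mem_ball_zero_iff.1 (hb₂ (ball_subset_ball (min_le_right _ _) hz)).2
  have heqρ : ∀ z ∈ ball (0 : ℂ) ρ, f (h z) = h (exp (2 * Real.pi * I * α) * z) := fun z hz =>
    hb₁ z (ball_subset_ball (min_le_left _ _) hz)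
  have hopen : ∀ s ⊆ ball (0 : ℂ) ρ, IsOpen s → IsOpen (h '' s) := by
    refine (((hd.mono hρV).analyticOnNhd isOpen_ball).is_constant_or_isOpen
      (convex_ball _ _).isPreconnected).resolve_left ?_
    rintro ⟨c, hc⟩
    have hm0 : (0 : ℂ) ∈ ball (0 : ℂ) ρ := mem_ball_self hρ
    have hm1 : ((ρ / 2 : ℝ) : ℂ) ∈ ball (0 : ℂ) ρ := by
      rw [mem_ball_zero_iff, norm_real, Real.norm_eq_abs, abs_of_pos (by positivity)]
      linarith
    have := hinj (hρV hm0) (hρV hm1) ((hc _ hm0).trans (hc _ hm1).symm)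
    have h3 : (ρ / 2 : ℝ) = 0 := by exact_mod_cast this.symm
    linarith
  have hlam : ‖exp (2 * Real.pi * I * α)‖ = 1 := by
    have : exp (2 * Real.pi * I * α) = exp ((2 * Real.pi * α : ℝ) * I) := by
      congr 1; push_cast; ring
    rw [this, Complex.norm_exp_ofReal_mul_I]
  have hcircle : ∀ r, 0 < r → r < ρ → ∃ w, ‖w‖ = r ∧ h w ∈ K := by
    intro r hr hrρ
    by_contra! hcon
    have hcl : IsClosed (h '' closedBall 0 r) :=
      ((isCompact_closedBall (0 : ℂ) r).image_of_continuousOn (hd.continuousOn.mono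
        ((closedBall_subset_ball hrρ).trans hρV))).isClosed
    have hsub := hKp.subset_left_of_subset_union
      (hopen (ball 0 r) (ball_subset_ball hrρ.le) isOpen_ball) hcl.isOpen_compl
      (disjoint_left.2 fun z hz hz' => hz' (image_mono ball_subset_closedBall hz))
      (fun z hz => by
        by_cases hz' : z ∈ h '' closedBall 0 r
        · obtain ⟨w, hw, rfl⟩ := hz'
          rcases (mem_closedBall_zero_iff.1 hw).lt_or_eq with hlt | he
          · exact Or.inl ⟨w, mem_ball_zero_iff.2 hlt, rfl⟩
          · exact (hcon w he hz).elim
        · exact Or.inr hz')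
      ⟨0, h0, 0, mem_ball_self hr, hh0⟩
    obtain ⟨w, hw, hwz⟩ := hsub hz₁
    have := hnorm w (ball_subset_ball hrρ.le hw)
    rw [hwz] at this
    exact this.false
  have hall : h '' ball 0 ρ ⊆ K := by
    rintro _ ⟨v, hv, rfl⟩
    rcases eq_or_ne v 0 with rfl | hv0
    · rwa [hh0]
    have hv' := mem_ball_zero_iff.1 hv
    obtain ⟨w, hw, hwK⟩ := hcircle ‖v‖ (norm_pos_iff.2 hv0) hv'
    refine mem_of_irrational_orbit hα (hd.continuousOn.mono ?_) hK (fun n => ?_) hw.symm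
    · intro z hz
      refine hρV (mem_ball_zero_iff.2 ?_)
      rwa [mem_sphere_zero_iff_norm.1 hz, hw]
    · induction n with
      | zero => simpa using hwK
      | succ n ih =>
        rw [pow_succ', mul_assoc, ← heqρ _ (by
          rw [mem_ball_zero_iff, norm_mul, norm_pow, hlam, one_pow, one_mul, hw]
          exact hv')]
        exact hfK _ ih
  exact mem_of_superset ((hopen _ subset_rfl isOpen_ball).mem_nhds
    ⟨0, mem_ball_self hρ, hh0⟩) hall

theorem SpiralTower.hull_notMem_nhds (T : SpiralTower) : T.hull ∉ nhds 0 := by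
  intro hmem
  obtain ⟨ε, hε, hsub⟩ := Metric.mem_nhds_iff.1 hmem
  obtain ⟨n, hn⟩ := exists_nat_one_div_lt hε
  have st := T.step n
  have hδ := st.δ_pos
  have hκ := st.κ_pos
  have hpi := Real.pi_gt_three
  have hq : (0 : ℝ) < T.q n := by exact_mod_cast st.one_le_q
  have hq1 : (1 : ℝ) ≤ T.q n := by exact_mod_cast st.one_le_q
  have hδ1 : 100 * T.δ n ≤ 1 := by
    have h1 := st.small
    have h2 : 100 * T.δ n ≤ 100 * T.q n * (1 + T.κ n) * T.δ n := by
      have : 1 ≤ T.q n * (1 + T.κ n) := by nlinarith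
      nlinarith
    linarith
  set ω₀ : ℂ := (1 + T.κ n * I) * (Real.log (2 * T.δ n) : ℝ) + (Real.pi / T.q n : ℝ) * I with hω₀
  have hre : ω₀.re = Real.log (2 * T.δ n) := by simp [hω₀]
  have him : ω₀.im = T.κ n * Real.log (2 * T.δ n) + Real.pi / T.q n := by simp [hω₀]
  have hnorm : ‖exp ω₀‖ = 2 * T.δ n := by
    rw [norm_exp, hre, Real.exp_log (by positivity)]
  have hosc := (st.osc (exp ω₀) (mem_closedBall_zero_iff.2 (by linarith)) 0
    (mem_closedBall_self zero_le_one) (by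
      rw [sub_zero, hnorm]
      have := st.δ_le
      linarith)).1
  rw [(T.S n).h_zero, sub_zero] at hosc
  have hK : (T.S n).h (exp ω₀) ∈ (T.S (n + 1)).disk :=
    mem_iInter.1 (hsub (mem_ball_zero_iff.2 (hosc.trans hn))) (n + 1)
  obtain ⟨w, hw, hwe⟩ := hK
  obtain ⟨v, hv, hwv, hcase⟩ := st.fac w (closedBall_subset_ball (T.S (n + 1)).one_lt_R hw)
  have hR := (T.S n).one_lt_R
  have hve : v = exp ω₀ := (T.S n).injOn_h (mem_ball_zero_iff.2 (by linarith))
    (mem_ball_zero_iff.2 (by linarith)) (hwv.symm.trans hwe)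
  rcases hcase with h | ⟨k, ω, hω, hlt⟩
  · rw [hve, hnorm] at h
    linarith
  · rw [hve, Complex.exp_eq_exp_iff_exists_int] at hω
    obtain ⟨m, hm⟩ := hω
    have e1 : ω.re = ω₀.re := by rw [hm]; simp
    have e2 : ω.im = ω₀.im + 2 * Real.pi * m := by rw [hm]; simp; ring
    have e3 : ω.im - T.κ n * ω.re - 2 * Real.pi * k / T.q n
        = Real.pi / T.q n * ((1 + 2 * T.q n * m - 2 * k : ℤ) : ℝ) := by
      rw [e1, e2, hre, him]
      push_cast
      field_simp
      ring
    rw [e3, abs_mul, abs_of_pos (by positivity)] at hlt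
    have h4 : (1 : ℝ) ≤ |((1 + 2 * T.q n * m - 2 * k : ℤ) : ℝ)| := by
      rw [← Int.cast_abs]
      exact_mod_cast Int.one_le_abs (by
        intro h
        have : (2 : ℤ) ∣ 1 := ⟨k - T.q n * m, by push_cast at h; linarith⟩
        norm_num at this)
    have h5 : Real.pi / T.q n * 1 ≤ Real.pi / T.q n * |((1 + 2 * T.q n * m - 2 * k : ℤ) : ℝ)| :=
      mul_le_mul_of_nonneg_left h4 (by positivity)
    have h6 : T.δ n / T.q n ≤ Real.pi / T.q n := by gcongr; linarith
    linarith

theorem lift_stays_in_arm {κ δ τ : ℝ} {q : ℕ} (hδ1 : δ ≤ 1) (hq : 1 ≤ q)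
    (hτ : 0 ≤ τ) {L : ℝ → ℂ} (hL : ContinuousOn L (Icc 0 τ)) {j : ℤ}
    (h0 : |(L 0).im - κ * (L 0).re - 2 * Real.pi * j / q| < 1 / q)
    (h : ∀ t ∈ Icc 0 τ, ∃ (i : ℤ) (ω : ℂ), exp ω = exp (L t) ∧
      |ω.im - κ * ω.re - 2 * Real.pi * i / q| < δ / q) :
    ∀ t ∈ Icc 0 τ, |q * ((L t).im - κ * (L t).re) - 2 * Real.pi * j| ≤ Real.pi / 2 := by
  have hpi := Real.pi_gt_three
  have hq0 : (0 : ℝ) < q := by exact_mod_cast hq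
  have hmul : ∀ x y c : ℝ, |x - 2 * Real.pi * y / q| < c / q → |q * x - 2 * Real.pi * y| < c := by
    intro x y c hx
    have : q * x - 2 * Real.pi * y = q * (x - 2 * Real.pi * y / q) := by field_simp
    rw [this, abs_mul, abs_of_pos hq0]
    rw [lt_div_iff₀ hq0] at hx
    linarith
  obtain ⟨m, hm⟩ := im_window_of_preconnected (S := Icc 0 τ) isPreconnected_Icc
    (f := fun t => q * ((L t).im - κ * (L t).re)) (c := 0)
    (by
      have h1 : ContinuousOn (fun t => (L t).im) (Icc 0 τ) :=
        Complex.continuous_im.comp_continuousOn hL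
      have h2 : ContinuousOn (fun t => (L t).re) (Icc 0 τ) :=
        Complex.continuous_re.comp_continuousOn hL
      fun_prop)
    (fun t ht => by
      obtain ⟨i, ω, hω, hi⟩ := h t ht
      obtain ⟨l, hl⟩ := Complex.exp_eq_exp_iff_exists_int.1 hω
      have e1 : ω.re = (L t).re := by rw [hl]; simp
      have e2 : ω.im = (L t).im + 2 * Real.pi * l := by rw [hl]; simp; ring
      have h1 := hmul _ _ _ hi
      rw [e1, e2] at h1
      have h2 : Real.cos (q * ((L t).im - κ * (L t).re) - 0)
          = Real.cos (q * ((L t).im + 2 * Real.pi * l - κ * (L t).re) - 2 * Real.pi * i) := by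
        have : q * ((L t).im + 2 * Real.pi * l - κ * (L t).re) - 2 * Real.pi * i
          = (q * ((L t).im - κ * (L t).re) - 0) + ((q * l - i : ℤ) : ℝ) * (2 * Real.pi) := by
          push_cast; ring
        rw [this, Real.cos_add_int_mul_two_pi]
      rw [h2]
      rw [abs_lt] at h1
      exact Real.cos_nonneg_of_neg_pi_div_two_le_of_le (by linarith) (by linarith))
    ⟨0, left_mem_Icc.2 hτ⟩
  have hmj : m = j := by
    have h1 := hm 0 (left_mem_Icc.2 hτ)
    have h2 := hmul _ _ _ h0
    rw [abs_le] at h1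
    rw [abs_lt] at h2
    have h3 : ((m - j : ℤ) : ℝ) < 1 := by
      push_cast
      nlinarith
    have h4 : -1 < ((m - j : ℤ) : ℝ) := by
      push_cast
      nlinarith
    have h5 : m - j < 1 := by exact_mod_cast h3
    have h6 : -1 < m - j := by exact_mod_cast h4
    omega
  intro t ht
  have := hm t ht
  rwa [hmj, sub_zero] at this

theorem exists_first_time {s : Set ℝ} {T : ℝ} (hs : IsClosed (Icc 0 T ∩ s))
    (hne : (Icc 0 T ∩ s).Nonempty) :
    ∃ τ ∈ Icc 0 T, τ ∈ s ∧ ∀ t, 0 ≤ t → t < τ → t ∉ s := by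
  have hc : IsCompact (Icc 0 T ∩ s) :=
    isCompact_Icc.of_isClosed_subset hs inter_subset_left
  obtain ⟨τ, hτ, hmin⟩ := hc.exists_isLeast hne
  exact ⟨τ, hτ.1, hτ.2, fun t h0 ht hts =>
    ht.not_ge (hmin ⟨⟨h0, ht.le.trans hτ.1.2⟩, hts⟩)⟩

/-- A path that starts in the arm `k`, avoids paths from the tip of every arm to the origin, and
stays away from the tips and the origin, cannot leave the neighbourhood of its arm. -/
theorem arm_barrier {κ δ T : ℝ} {q : ℕ} (hδ : 0 < δ) (hδ1 : 100 * δ ≤ 1) (hq : 1 ≤ q)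
    {ω : ℝ → ℂ} (hω : ContinuousOn ω (Icc 0 T))
    (hlo : ∀ t ∈ Icc 0 T, Real.log δ ≤ (ω t).re) (hhi : ∀ t ∈ Icc 0 T, (ω t).re ≤ -10 * δ)
    {k : ℤ} (h0 : |(ω 0).im - κ * (ω 0).re - 2 * Real.pi * k / q| < δ / q)
    (H : ∀ s₀ s₁, 0 < s₀ → s₀ ≤ s₁ → s₁ ≤ T → ∀ j : ℤ, ∃ c : ℝ → ℂ, ContinuousOn c (Icc 0 1) ∧
      (∃ ω' : ℂ, exp ω' = c 0 ∧ |ω'.im - κ * ω'.re - 2 * Real.pi * j / q| < 1 / q ∧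
        -10 * δ < ω'.re) ∧ c 1 = 0 ∧
      ∀ t ∈ Icc (0 : ℝ) 1, (∀ s ∈ Icc s₀ s₁, c t ≠ exp (ω s)) ∧ (‖c t‖ < δ ∨
        ∃ (i : ℤ) (ω' : ℂ), exp ω' = c t ∧ |ω'.im - κ * ω'.re - 2 * Real.pi * i / q| < δ / q)) :
    ∀ t ∈ Icc 0 T, |(ω t).im - κ * (ω t).re - 2 * Real.pi * k / q| < 10 / q := by
  have hpi := Real.pi_gt_three
  have hpi4 := Real.pi_lt_d2
  have hq0 : (0 : ℝ) < q := by exact_mod_cast hq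
  intro t₁ ht₁
  by_contra! hcon
  obtain ⟨ε, hε, hεabs, hεt⟩ : ∃ ε : ℤ, (ε : ℝ) * ε = 1 ∧ |(ε : ℝ)| = 1 ∧
      10 / q ≤ ε * ((ω t₁).im - κ * (ω t₁).re - 2 * Real.pi * k / q) := by
    rcases le_total 0 ((ω t₁).im - κ * (ω t₁).re - 2 * Real.pi * k / q) with h | h
    · rw [abs_of_nonneg h] at hcon
      exact ⟨1, by norm_num, by norm_num, by simpa using hcon⟩
    · rw [abs_of_nonpos h] at hcon
      exact ⟨-1, by norm_num, by norm_num, by push_cast; linarith⟩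
  set φ : ℝ → ℝ := fun t => ε * ((ω t).im - κ * (ω t).re - 2 * Real.pi * k / q) with hφ
  have hre : ContinuousOn (fun t => (ω t).re) (Icc 0 T) :=
    Complex.continuous_re.comp_continuousOn hω
  have him : ContinuousOn (fun t => (ω t).im) (Icc 0 T) :=
    Complex.continuous_im.comp_continuousOn hω
  have hφc : ContinuousOn φ (Icc 0 T) := by fun_prop
  have hφ0 : φ 0 < 3 / q := by
    refine (le_abs_self _).trans_lt ?_
    rw [hφ]
    simp only
    rw [abs_mul, hεabs, one_mul]
    refine h0.trans ?_
    gcongr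
    linarith
  obtain ⟨s₀, hs₀, hφs₀⟩ := intermediate_value_Icc ht₁.1 (hφc.mono (Icc_subset_Icc_right ht₁.2))
    (show 3 / (q : ℝ) ∈ Icc (φ 0) (φ t₁) from ⟨hφ0.le, le_trans (by gcongr; norm_num) hεt⟩)
  have hs₀0 : 0 < s₀ := by
    rcases hs₀.1.lt_or_eq with h | h
    · exact h
    · rw [← h] at hφs₀
      exact (hφ0.ne hφs₀).elim
  obtain ⟨c, hc, ⟨ω', hω', hω'j, hω're⟩, hc1, hcT⟩ := H s₀ t₁ hs₀0 hs₀.2 ht₁.2 (k + ε)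
  obtain ⟨τ, hτ, hτs, hτmin⟩ := exists_first_time (T := 1) (s := {t | ‖c t‖ ≤ δ})
    (hc.norm.preimage_isClosed_of_isClosed isClosed_Icc isClosed_Iic)
    ⟨1, right_mem_Icc.2 zero_le_one, by simp [hc1, hδ.le]⟩
  have hcω' : ‖c 0‖ = Real.exp ω'.re := by rw [← hω', norm_exp]
  have hδexp : δ < Real.exp ω'.re := by
    have h1 := Real.add_one_le_exp ω'.re
    linarith
  have hτ0 : 0 < τ := by
    rcases hτ.1.lt_or_eq with h | h
    · exact h
    · rw [← h] at hτs
      change ‖c 0‖ ≤ δ at hτs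
      linarith
  have hsub : Icc 0 τ ⊆ Icc (0 : ℝ) 1 := Icc_subset_Icc_right hτ.2
  have hnorm : ∀ t ∈ Icc 0 τ, δ ≤ ‖c t‖ := by
    have h1 : closure (Ico 0 τ) ⊆ Icc 0 1 ∩ {t | δ ≤ ‖c t‖} := by
      refine closure_minimal (fun t ht => ⟨hsub (Ico_subset_Icc_self ht), ?_⟩)
        (hc.norm.preimage_isClosed_of_isClosed isClosed_Icc isClosed_Ici)
      have h2 : ¬ ‖c t‖ ≤ δ := hτmin t ht.1 ht.2
      exact (not_le.1 h2).le
    rw [closure_Ico hτ0.ne] at h1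
    exact fun t ht => (h1 ht).2
  obtain ⟨L, hL, hLe, hL0⟩ := exists_log_path hτ.1 (hc.mono hsub)
    (fun t ht h => by
      have := hnorm t ht
      rw [h, norm_zero] at this
      linarith) hω'
  have harm := lift_stays_in_arm (κ := κ) (δ := δ) (by linarith) hq hτ.1 hL (j := k + ε)
    (by rwa [hL0]) (fun t ht => by
      rcases (hcT t (hsub ht)).2 with h | ⟨i, ω'', h⟩
      · exact ((hnorm t ht).not_gt h).elim
      · rw [hLe t ht]
        exact ⟨i, ω'', h⟩)
  have hlevel : ∀ t ∈ Icc 0 τ, Real.exp (L t).re = ‖c t‖ := fun t ht => by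
    rw [← hLe t ht, norm_exp]
  have hLφ : ∀ t ∈ Icc 0 τ,
      3 / q ≤ ε * ((L t).im - κ * (L t).re - 2 * Real.pi * k / q) ∧
      ε * ((L t).im - κ * (L t).re - 2 * Real.pi * k / q) ≤ 10 / q := by
    intro t ht
    have h1 := harm t ht
    have e1 : ε * ((L t).im - κ * (L t).re - 2 * Real.pi * k / q)
        = (ε * (q * ((L t).im - κ * (L t).re) - 2 * Real.pi * ((k + ε : ℤ) : ℝ))
          + 2 * Real.pi) / q := by
      push_cast
      field_simp
      linear_combination (2 * Real.pi) * hε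
    have h2 : |ε * (q * ((L t).im - κ * (L t).re) - 2 * Real.pi * ((k + ε : ℤ) : ℝ))|
        ≤ Real.pi / 2 := by rwa [abs_mul, hεabs, one_mul]
    rw [abs_le] at h2
    rw [e1, div_le_div_iff_of_pos_right hq0, div_le_div_iff_of_pos_right hq0]
    constructor <;> linarith
  have hLre : ContinuousOn (fun t => (L t).re) (Icc 0 τ) :=
    Complex.continuous_re.comp_continuousOn hL
  have hLim : ContinuousOn (fun t => (L t).im) (Icc 0 τ) :=
    Complex.continuous_im.comp_continuousOn hL
  have hm1 : ∀ s ∈ Icc (0 : ℝ) 1, s₀ + (t₁ - s₀) * s ∈ Icc s₀ t₁ := fun s hs =>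
    ⟨by nlinarith [hs.1, hs₀.2], by nlinarith [hs.2, hs₀.2]⟩
  have hm1' : ∀ s ∈ Icc (0 : ℝ) 1, s₀ + (t₁ - s₀) * s ∈ Icc 0 T := fun s hs =>
    Icc_subset_Icc hs₀.1 ht₁.2 (hm1 s hs)
  have hm2 : ∀ t ∈ Icc (0 : ℝ) 1, τ * t ∈ Icc 0 τ := fun t ht =>
    ⟨mul_nonneg hτ.1 ht.1, mul_le_of_le_one_right hτ.1 ht.2⟩
  obtain ⟨s, hs, t, ht, hst⟩ := exists_zero_of_sides (u := fun p =>
      (((ε * ((L (τ * p.2)).im - κ * (L (τ * p.2)).re - 2 * Real.pi * k / q)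
        - φ (s₀ + (t₁ - s₀) * p.1) : ℝ)) : ℂ)
      + (((L (τ * p.2)).re - (ω (s₀ + (t₁ - s₀) * p.1)).re : ℝ) : ℂ) * I) (by
      have c1 : ContinuousOn (fun p : ℝ × ℝ => (L (τ * p.2)).re) (Icc 0 1 ×ˢ Icc 0 1) :=
        hLre.comp (by fun_prop) fun p hp => hm2 _ hp.2
      have c2 : ContinuousOn (fun p : ℝ × ℝ => (L (τ * p.2)).im) (Icc 0 1 ×ˢ Icc 0 1) :=
        hLim.comp (by fun_prop) fun p hp => hm2 _ hp.2
      have c3 : ContinuousOn (fun p : ℝ × ℝ => (ω (s₀ + (t₁ - s₀) * p.1)).re)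
          (Icc 0 1 ×ˢ Icc 0 1) :=
        hre.comp (by fun_prop) fun p hp => hm1' _ hp.1
      have c4 : ContinuousOn (fun p : ℝ × ℝ => φ (s₀ + (t₁ - s₀) * p.1))
          (Icc 0 1 ×ˢ Icc 0 1) :=
        hφc.comp (by fun_prop) fun p hp => hm1' _ hp.1
      refine ContinuousOn.add ?_ (ContinuousOn.mul ?_ continuousOn_const)
      · exact Complex.continuous_ofReal.comp_continuousOn ((continuousOn_const.mul
          ((c2.sub (continuousOn_const.mul c1)).sub continuousOn_const)).sub c4)
      · exact Complex.continuous_ofReal.comp_continuousOn (c1.sub c3))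
    (fun t ht => by
      have h1 := (hLφ _ (hm2 t ht)).1
      simp only [add_re, ofReal_re, mul_re, ofReal_im, I_re, I_im, mul_zero, add_zero, mul_one,
        sub_zero]
      linarith)
    (fun t ht => by
      have h1 := (hLφ _ (hm2 t ht)).2
      have e : s₀ + (t₁ - s₀) * 1 = t₁ := by ring
      simp only [add_re, ofReal_re, mul_re, ofReal_im, I_re, I_im, mul_zero]
      rw [e]
      linarith)
    (fun s hs => by
      have h1 := hhi _ (hm1' s hs)
      simp only [add_im, ofReal_re, mul_im, ofReal_im, I_re, I_im, mul_zero, add_zero, mul_one,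
        zero_add, hL0]
      linarith)
    (fun s hs => by
      have h1 := hlo _ (hm1' s hs)
      have h2 : (L τ).re ≤ Real.log δ := by
        rw [Real.le_log_iff_exp_le hδ, hlevel τ (right_mem_Icc.2 hτ.1)]
        exact hτs
      simp only [add_im, ofReal_re, mul_im, ofReal_im, I_re, I_im, mul_zero, add_zero, mul_one,
        zero_add]
      linarith)
  have hr := congrArg Complex.re hst
  have hi := congrArg Complex.im hst
  simp only [add_re, ofReal_re, mul_re, ofReal_im, I_re, I_im, mul_zero, add_zero, mul_one,
    sub_zero, add_im, mul_im, zero_add, zero_re, zero_im] at hr hi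
  have hε0 : (ε : ℝ) ≠ 0 := fun h => by rw [h] at hε; norm_num at hε
  have hr2 : (L (τ * t)).im - κ * (L (τ * t)).re - 2 * Real.pi * k / q
      = (ω (s₀ + (t₁ - s₀) * s)).im - κ * (ω (s₀ + (t₁ - s₀) * s)).re - 2 * Real.pi * k / q :=
    mul_left_cancel₀ hε0 (sub_eq_zero.1 hr)
  have hi2 := sub_eq_zero.1 hi
  rw [hi2] at hr2
  have heq : L (τ * t) = ω (s₀ + (t₁ - s₀) * s) := Complex.ext hi2 (by linarith)
  have h3 := (hcT _ (hsub (hm2 t ht))).1 _ (hm1 s hs)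
  rw [← hLe _ (hm2 t ht), heq] at h3
  exact h3 rfl

namespace SpiralTower

variable (T : SpiralTower)

theorem δ_le_one (n : ℕ) : 100 * T.δ n ≤ 1 := by
  have h1 := (T.step n).small
  have h2 := (T.step n).δ_pos
  have h3 := (T.step n).κ_pos
  have h4 : (1 : ℝ) ≤ T.q n := by exact_mod_cast (T.step n).one_le_q
  have h5 : (1 : ℝ) ≤ T.q n * (1 + T.κ n) := by nlinarith
  nlinarith

theorem exists_mem_disk_arm_tip {n m : ℕ} (hnm : n + 1 ≤ m) (k : ℤ) :
    ∃ p ∈ (T.S m).disk, ∃ ω : ℂ, exp ω = (T.S n).Φ p ∧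
      |ω.im - T.κ n * ω.re - 2 * Real.pi * k / T.q n| < 1 / T.q n ∧ -10 * T.δ n < ω.re := by
  have st := T.step n
  have hδ := st.δ_pos
  have hδ1 := T.δ_le_one n
  have hκ := st.κ_pos
  have hq : (0 : ℝ) < T.q n := by exact_mod_cast st.one_le_q
  set δ := T.δ n with hδdef
  set κ := T.κ n with hκdef
  obtain ⟨w, hw, v, hv, hwv, hve⟩ := st.dens k (-δ)
    ⟨by linarith [Real.log_le_sub_one_of_pos hδ], le_rfl⟩
  obtain ⟨z, hz, hzw⟩ := T.exists_mem_disk_near (mem_image_of_mem (T.S (n + 1)).h hw) hnm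
  set ω₀ : ℂ := (1 + κ * I) * (-δ : ℝ) + (2 * Real.pi * k / T.q n : ℝ) * I with hω₀
  have hre : ω₀.re = -δ := by simp [hω₀]
  have him : ω₀.im = -(κ * δ) + 2 * Real.pi * k / T.q n := by
    simp [hω₀]
  have hΦ : ‖(T.S n).Φ z - v‖ < δ := by
    have h1 : v ∈ ball (0 : ℂ) (T.S n).R :=
      mem_ball_zero_iff.2 (hv.trans (T.S n).one_lt_R)
    rw [← (T.S n).Φ_h v h1, ← hwv]
    refine st.mod _ (ball_subset_closedBall ((T.S m).disk_subset hz)) _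
      (ball_subset_closedBall ((T.S (n + 1)).disk_subset (mem_image_of_mem _ hw))) ?_
    linarith [T.β_nonneg m]
  have hζ : ‖(T.S n).Φ z / exp ω₀ - 1‖ ≤ 3 * δ := by
    have h1 : (T.S n).Φ z / exp ω₀ - 1 = ((T.S n).Φ z - exp ω₀) / exp ω₀ := by
      rw [sub_div, div_self (exp_ne_zero _)]
    have h2 : ‖(T.S n).Φ z - exp ω₀‖ ≤ 2 * δ := by
      have := norm_sub_le_norm_sub_add_norm_sub ((T.S n).Φ z) v (exp ω₀)
      linarith
    have h3 := Real.add_one_le_exp (-δ)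
    rw [h1, norm_div, norm_exp, hre, div_le_iff₀ (Real.exp_pos _)]
    nlinarith
  have hlog := norm_log_one_add_le_two (z := (T.S n).Φ z / exp ω₀ - 1) (by linarith)
  have hne : 1 + ((T.S n).Φ z / exp ω₀ - 1) ≠ 0 := fun h => by
    have h1 : (T.S n).Φ z / exp ω₀ - 1 = -1 := by linear_combination h
    rw [h1, norm_neg, norm_one] at hζ
    linarith
  set l := log (1 + ((T.S n).Φ z / exp ω₀ - 1)) with hl
  have hl6 : ‖l‖ ≤ 6 * δ := by linarith
  have hlr := (abs_re_le_norm l).trans hl6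
  have hli := (abs_im_le_norm l).trans hl6
  refine ⟨z, hz, ω₀ + l, ?_, ?_, ?_⟩
  · rw [exp_add, hl, exp_log hne]
    field_simp
    ring
  · have h1 : (ω₀ + l).im - κ * (ω₀ + l).re - 2 * Real.pi * k / T.q n = l.im - κ * l.re := by
      rw [add_im, add_re, hre, him]
      ring
    rw [h1, lt_div_iff₀ hq]
    have h2 : |l.im - κ * l.re| ≤ 6 * δ + κ * (6 * δ) := by
      refine (abs_sub _ _).trans (add_le_add hli ?_)
      rw [abs_mul, abs_of_pos hκ]
      gcongr
    have h3 := st.small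
    have h4 := mul_le_mul_of_nonneg_right h2 hq.le
    nlinarith
  · rw [add_re, hre]
    rw [abs_le] at hlr
    linarith

theorem exists_disjoint_disk {C : Set ℂ} (hC : IsCompact C) (hCK : Disjoint C T.hull) :
    ∃ m, Disjoint C (T.S m).disk := by
  obtain ⟨m, hm⟩ := hC.elim_directed_family_closed (fun n => (T.S n).disk)
    (fun n => (T.S n).isCompact_disk.isClosed) (disjoint_iff_inter_eq_empty.1 hCK)
    T.antitone_disk.directed_ge
  exact ⟨m, disjoint_iff_inter_eq_empty.2 hm⟩

theorem arm_barrier {n : ℕ} {τ : ℝ} {ω : ℝ → ℂ} (hω : ContinuousOn ω (Icc 0 τ))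
    (hlo : ∀ t ∈ Icc 0 τ, Real.log (T.δ n) ≤ (ω t).re)
    (hhi : ∀ t ∈ Icc 0 τ, (ω t).re ≤ -10 * T.δ n)
    {k : ℤ} (h0 : |(ω 0).im - T.κ n * (ω 0).re - 2 * Real.pi * k / T.q n| < T.δ n / T.q n)
    (H : ∀ t, 0 < t → t ≤ τ → (T.S n).h (exp (ω t)) ∉ T.hull) :
    ∀ t ∈ Icc 0 τ, |(ω t).im - T.κ n * (ω t).re - 2 * Real.pi * k / T.q n| < 10 / T.q n := by
  have st := T.step n
  have hδ := st.δ_pos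
  refine _root_.arm_barrier hδ (T.δ_le_one n) st.one_le_q hω hlo hhi h0
    fun s₀ s₁ hs₀ hs hs₁ j => ?_
  have hsub : Icc s₀ s₁ ⊆ Icc 0 τ := Icc_subset_Icc hs₀.le hs₁
  have hball : ∀ s ∈ Icc s₀ s₁, exp (ω s) ∈ ball (0 : ℂ) 1 := fun s hs => by
    rw [mem_ball_zero_iff, norm_exp, Real.exp_lt_one_iff]
    linarith [hhi s (hsub hs)]
  have hγ : ContinuousOn (fun t => (T.S n).h (exp (ω t))) (Icc s₀ s₁) :=
    (T.S n).continuousOn_h.comp (Complex.continuous_exp.comp_continuousOn (hω.mono hsub))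
      fun s hs => ball_subset_closedBall (hball s hs)
  obtain ⟨m, hm⟩ := T.exists_disjoint_disk (isCompact_Icc.image_of_continuousOn hγ) (by
    rw [Set.disjoint_left]
    rintro _ ⟨t, ht, rfl⟩
    exact H t (hs₀.trans_le ht.1) (ht.2.trans hs₁))
  have hM : (T.S (max m (n + 1))).disk ⊆ (T.S m).disk := T.antitone_disk (le_max_left _ _)
  have hN : (T.S (max m (n + 1))).disk ⊆ (T.S (n + 1)).disk := T.antitone_disk (le_max_right _ _)
  obtain ⟨p, hp, ω', hω', hj, hre⟩ := T.exists_mem_disk_arm_tip (le_max_right m (n + 1)) j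
  obtain ⟨P, hP⟩ := (T.S (max m (n + 1))).isPathConnected_disk.joinedIn p hp 0
    (T.S (max m (n + 1))).zero_mem_disk
  refine ⟨fun t => (T.S n).Φ (P.extend t),
    ((T.S n).differentiable_Φ.continuous.comp P.continuous_extend).continuousOn,
    ⟨ω', by simp [hω'], hj, hre⟩, by simp [(T.S n).Φ_zero], fun t ht => ?_⟩
  have hPt : P.extend t ∈ (T.S (max m (n + 1))).disk := by
    rw [Path.extend_apply P ht]
    exact hP _
  obtain ⟨w, hw, hwP⟩ := hN hPt
  obtain ⟨v, hv, hwv, hfac⟩ := st.fac w (closedBall_subset_ball (T.S (n + 1)).one_lt_R hw)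
  have hv' : (T.S n).Φ (P.extend t) = v := by
    rw [← hwP, hwv]
    exact (T.S n).Φ_h v (mem_ball_zero_iff.2 (hv.trans (T.S n).one_lt_R))
  simp only [hv']
  refine ⟨fun s hs hvs => ?_, hfac⟩
  refine Set.disjoint_left.1 hm (mem_image_of_mem _ hs) (hM ?_)
  rw [← hvs, ← hwv, hwP]
  exact hPt

end SpiralTower

theorem norm_exp_sub_exp_le {z w : ℂ} (hz : z.re ≤ 0) (hw : w.re ≤ 0) :
    ‖exp z - exp w‖ ≤ ‖z - w‖ := by
  have := (convex_halfSpace_re_le 0).norm_image_sub_le_of_norm_deriv_le (𝕜 := ℂ) (f := exp) (C := 1)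
    (fun _ _ => Complex.differentiableAt_exp)
    (fun x hx => by
      rw [Complex.deriv_exp, norm_exp, Real.exp_le_one_iff]
      exact hx) hw hz
  rwa [one_mul] at this

theorem norm_exp_sub_exp_le_of_arm {κ a b d c : ℝ} (hκ : 0 ≤ κ) {z w : ℂ} (hz : z.re ≤ 0)
    (hw : w.re ≤ 0) (hd : |z.re - w.re| ≤ d) (ha : |z.im - κ * z.re - c| ≤ a)
    (hb : |w.im - κ * w.re - c| ≤ b) : ‖exp z - exp w‖ ≤ d * (1 + κ) + a + b := by
  refine (norm_exp_sub_exp_le hz hw).trans ((norm_le_abs_re_add_abs_im _).trans ?_)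
  have e : (z - w).im = κ * (z.re - w.re) + (z.im - κ * z.re - c) - (w.im - κ * w.re - c) := by
    rw [sub_im]; ring
  have h1 := abs_sub (κ * (z.re - w.re) + (z.im - κ * z.re - c)) (w.im - κ * w.re - c)
  have h2 := abs_add_le (κ * (z.re - w.re)) (z.im - κ * z.re - c)
  rw [abs_mul, abs_of_nonneg hκ] at h2
  have h3 := mul_le_mul_of_nonneg_left hd hκ
  rw [e, sub_re]
  linarith

namespace SpiralTower

variable (T : SpiralTower)

theorem norm_h_sub_lt {n : ℕ} {v w : ℂ} (hv : ‖v‖ ≤ 1) (hw : ‖w‖ ≤ 1) (h : ‖v - w‖ ≤ T.μ n) :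
    ‖(T.S n).h v - (T.S n).h w‖ < 1 / (n + 1) :=
  ((T.step n).osc v (mem_closedBall_zero_iff.2 hv) w (mem_closedBall_zero_iff.2 hw) h).1

theorem norm_h_lt_of_norm_le {n : ℕ} {v : ℂ} (hv : ‖v‖ ≤ T.δ n) :
    ‖(T.S n).h v‖ < 1 / (n + 1) := by
  have h1 := (T.step n).δ_le
  have h2 := T.δ_le_one n
  have h3 := norm_nonneg v
  have := T.norm_h_sub_lt (n := n) (v := v) (w := 0) (by linarith) (by simp)
    (by rw [sub_zero]; linarith)
  rwa [(T.S n).h_zero, sub_zero] at this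

theorem exists_mem_arm_of_mem_hull {n : ℕ} {z : ℂ} (hz : z ∈ T.hull) :
    ∃ v : ℂ, ‖v‖ < 1 ∧ (T.S n).h v = z ∧ (‖v‖ < T.δ n ∨ ∃ (k : ℤ) (ω : ℂ), exp ω = v ∧
      |ω.im - T.κ n * ω.re - 2 * Real.pi * k / T.q n| < T.δ n / T.q n) := by
  obtain ⟨w, hw, rfl⟩ := mem_iInter.1 hz (n + 1)
  obtain ⟨v, hv, h, hfac⟩ := (T.step n).fac w (closedBall_subset_ball (T.S (n + 1)).one_lt_R hw)
  exact ⟨v, hv, h.symm, hfac⟩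

/-- Near an endpoint on the hull, a path that leaves the hull follows an arm up to its tip. -/
theorem exists_arm_near_endpoint {n : ℕ} {p : ℝ → ℂ} {t₁ c : ℝ} (ht₁ : 0 ≤ t₁)
    (hp : ContinuousOn p (Icc 0 t₁)) (ha : p 0 ∈ T.hull)
    (hpc : ∀ t ∈ Icc 0 t₁, ‖p t - p 0‖ < c) (hpK : ∀ t, 0 < t → t ≤ t₁ → p t ∉ T.hull)
    (hpd : p t₁ ∉ (T.S n).disk) (hn : 1 / ((n : ℝ) + 1) ≤ c) (hc : 2 * c ≤ ‖p 0‖) :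
    ∃ (k : ℤ) (ωa : ℂ), (T.S n).h (exp ωa) = p 0 ∧ ωa.re < 0 ∧ Real.log (T.δ n) ≤ ωa.re ∧
      |ωa.im - T.κ n * ωa.re - 2 * Real.pi * k / T.q n| < T.δ n / T.q n ∧
      ∀ ω : ℂ, ωa.re ≤ ω.re → ω.re < 0 →
        |ω.im - T.κ n * ω.re - 2 * Real.pi * k / T.q n| < T.δ n / T.q n →
        ‖(T.S n).h (exp ω) - p 0‖ < 2 * c := by
  have st := T.step n
  have hδ := st.δ_pos
  have hδ1 := T.δ_le_one n
  have hq : (0 : ℝ) < T.q n := by exact_mod_cast st.one_le_q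
  have hfar : ∀ v : ℂ, ‖v‖ ≤ T.δ n → ∀ t ∈ Icc 0 t₁, (T.S n).h v ≠ p t := by
    intro v hv t ht h
    have h1 := T.norm_h_lt_of_norm_le hv
    rw [h] at h1
    have h2 := hpc t ht
    have h3 := norm_sub_norm_le (p 0) (p t)
    rw [norm_sub_rev] at h3
    linarith
  obtain ⟨v, hv, hva, hfac⟩ := T.exists_mem_arm_of_mem_hull (n := n) ha
  have hvδ : T.δ n < ‖v‖ := by
    by_contra! h
    exact hfar v h 0 (left_mem_Icc.2 ht₁) hva
  obtain ⟨k, ωa, hωa, hk⟩ := hfac.resolve_left hvδ.not_gt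
  have hvω : ‖v‖ = Real.exp ωa.re := by rw [← hωa, norm_exp]
  have hωa0 : ωa.re < 0 := by rwa [← Real.exp_lt_one_iff, ← hvω]
  refine ⟨k, ωa, by rw [hωa, hva], hωa0, by
    rw [Real.log_le_iff_le_exp hδ, ← hvω]; exact hvδ.le, hk, fun ω hω hω0 hωk => ?_⟩
  have hV : IsOpen ((T.S n).h '' ball 0 1) :=
    (T.S n).isOpen_image_h isOpen_ball (ball_subset_ball (T.S n).one_lt_R.le)
  obtain ⟨τ, hτ, hτV, hτmin⟩ := exists_first_time (T := t₁)
    (s := {t | p t ∉ (T.S n).h '' ball 0 1})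
    (hp.preimage_isClosed_of_isClosed isClosed_Icc hV.isClosed_compl)
    ⟨t₁, right_mem_Icc.2 ht₁, fun h => hpd (image_mono ball_subset_closedBall h)⟩
  have hτ0 : 0 < τ := by
    rcases hτ.1.lt_or_eq with h | h
    · exact h
    · rw [← h] at hτV
      exact (hτV ⟨v, mem_ball_zero_iff.2 hv, hva⟩).elim
  have hsub : Icc 0 τ ⊆ Icc 0 t₁ := Icc_subset_Icc_right hτ.2
  have hdisk : ∀ t ∈ Icc 0 τ, p t ∈ (T.S n).disk := by
    have h1 : closure (Ico 0 τ) ⊆ Icc 0 t₁ ∩ {t | p t ∈ (T.S n).disk} := by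
      refine closure_minimal (fun t ht => ⟨hsub (Ico_subset_Icc_self ht), ?_⟩)
        (hp.preimage_isClosed_of_isClosed isClosed_Icc (T.S n).isCompact_disk.isClosed)
      have h2 : p t ∈ (T.S n).h '' ball 0 1 := not_not.1 (hτmin t ht.1 ht.2)
      exact image_mono ball_subset_closedBall h2
    rw [closure_Ico hτ0.ne] at h1
    exact fun t ht => (h1 ht).2
  have hw : ∀ t ∈ Icc 0 τ, ‖(T.S n).Φ (p t)‖ ≤ 1 ∧ (T.S n).h ((T.S n).Φ (p t)) = p t := by
    intro t ht
    obtain ⟨w, hw, hwp⟩ := hdisk t ht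
    rw [← hwp, (T.S n).Φ_h w (closedBall_subset_ball (T.S n).one_lt_R hw)]
    exact ⟨mem_closedBall_zero_iff.1 hw, rfl⟩
  have hwδ : ∀ t ∈ Icc 0 τ, T.δ n < ‖(T.S n).Φ (p t)‖ := by
    intro t ht
    by_contra! h
    exact hfar _ h t (hsub ht) (hw t ht).2
  have hwτ : ‖(T.S n).Φ (p τ)‖ = 1 := by
    refine le_antisymm (hw τ (right_mem_Icc.2 hτ.1)).1 ?_
    by_contra! h
    exact hτV ⟨_, mem_ball_zero_iff.2 h, (hw τ (right_mem_Icc.2 hτ.1)).2⟩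
  obtain ⟨L, hL, hLe, hL0⟩ := exists_log_path hτ.1 (c := ωa)
    ((T.S n).differentiable_Φ.continuous.comp_continuousOn (hp.mono hsub))
    (fun t ht h => by
      have h1 := hwδ t ht
      simp only [Function.comp_apply] at h
      rw [h, norm_zero] at h1
      linarith) (by
      simp only [Function.comp_apply]
      rw [hωa, ← hva]
      exact ((T.S n).Φ_h v (mem_ball_zero_iff.2 (hv.trans (T.S n).one_lt_R))).symm)
  simp only [Function.comp_apply] at hLe
  have hLn : ∀ t ∈ Icc 0 τ, Real.exp (L t).re = ‖(T.S n).Φ (p t)‖ := fun t ht => by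
    rw [← hLe t ht, norm_exp]
  have hLre : ContinuousOn (fun t => (L t).re) (Icc 0 τ) :=
    Complex.continuous_re.comp_continuousOn hL
  have hLτ : (L τ).re = 0 := by
    rw [← Real.exp_eq_one_iff, hLn τ (right_mem_Icc.2 hτ.1), hwτ]
  obtain ⟨t, ht, hd, harm⟩ : ∃ t ∈ Icc 0 τ, |ω.re - (L t).re| ≤ 10 * T.δ n ∧
      |(L t).im - T.κ n * (L t).re - 2 * Real.pi * k / T.q n| ≤ 10 / T.q n := by
    by_cases hx : -10 * T.δ n < ωa.re
    · refine ⟨0, left_mem_Icc.2 hτ.1, ?_, ?_⟩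
      · rw [hL0, abs_le]
        constructor <;> linarith
      · rw [hL0]
        refine hk.le.trans ?_
        gcongr
        linarith
    · push Not at hx
      set y := min ω.re (-10 * T.δ n) with hy
      have hay : ωa.re ≤ y := le_min hω hx
      have hy0 : y ≤ 0 := (min_le_left _ _).trans hω0.le
      obtain ⟨s, hs, hsy⟩ := intermediate_value_Icc hτ.1 hLre
        (show y ∈ Icc (L 0).re (L τ).re from ⟨by rwa [hL0], by rwa [hLτ]⟩)
      obtain ⟨σ, hσ, hσy, hσmin⟩ := exists_first_time (T := τ) (s := {t | (L t).re = y})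
        (hLre.preimage_isClosed_of_isClosed isClosed_Icc (isClosed_singleton (x := y)))
        ⟨s, hs, hsy⟩
      have hσsub : Icc 0 σ ⊆ Icc 0 τ := Icc_subset_Icc_right hσ.2
      have hle : ∀ t ∈ Icc 0 σ, (L t).re ≤ y := by
        intro t ht
        by_contra! h
        have htσ : t < σ := by
          refine ht.2.lt_of_ne fun h' => ?_
          rw [h'] at h
          exact h.ne' hσy
        obtain ⟨s', hs', hs'y⟩ := intermediate_value_Icc ht.1
          (hLre.mono ((Icc_subset_Icc_right ht.2).trans hσsub))
          (show y ∈ Icc (L 0).re (L t).re from ⟨by rwa [hL0], h.le⟩)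
        exact hσmin s' hs'.1 (hs'.2.trans_lt htσ) hs'y
      refine ⟨σ, hσ, ?_, ?_⟩
      · have : (L σ).re = y := hσy
        rw [this, abs_le]
        rcases min_choice ω.re (-10 * T.δ n) with h | h
        · rw [hy, h]
          constructor <;> linarith
        · have h2 := min_le_left ω.re (-10 * T.δ n)
          rw [hy]
          constructor <;> linarith
      · refine (T.arm_barrier (hL.mono hσsub) (fun t ht => ?_)
          (fun t ht => (hle t ht).trans (min_le_right _ _)) (by rwa [hL0]) (fun t ht0 ht => ?_) σ
          (right_mem_Icc.2 hσ.1)).le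
        · rw [Real.log_le_iff_le_exp hδ, hLn t (hσsub ht)]
          exact (hwδ t (hσsub ht)).le
        · have ht' : t ∈ Icc 0 τ := hσsub ⟨ht0.le, ht⟩
          rw [hLe t ht', (hw t ht').2]
          exact hpK t ht0 (ht'.2.trans hτ.2)
  have hLt : (L t).re ≤ 0 := by
    rw [← Real.exp_le_one_iff, hLn t ht]
    exact (hw t ht).1
  have h1 := norm_exp_sub_exp_le_of_arm st.κ_pos.le hω0.le hLt hd hωk.le harm
  have h2 : T.δ n / T.q n ≤ 1 / T.q n := by
    gcongr
    linarith
  have h3 := st.width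
  have h4 : (11 : ℝ) / T.q n = 1 / T.q n + 10 / T.q n := by ring
  have h5 := T.norm_h_sub_lt (n := n) (v := exp ω) (w := exp (L t))
    (by rw [norm_exp, Real.exp_le_one_iff]; exact hω0.le)
    (by rw [norm_exp, Real.exp_le_one_iff]; exact hLt) (by linarith)
  rw [hLe t ht, (hw t ht).2] at h5
  have h6 := hpc t (hsub ht)
  have h7 := norm_sub_le_norm_sub_add_norm_sub ((T.S n).h (exp ω)) (p t) (p 0)
  linarith

end SpiralTower

theorem isOpen_exp_image {V : Set ℂ} (hV : IsOpen V) : IsOpen (exp '' V) :=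
  isOpen_image_of_deriv_ne_zero isOpen_univ Complex.differentiable_exp.differentiableOn
    (fun z _ => by rw [Complex.deriv_exp]; exact exp_ne_zero z) hV (subset_univ V)

theorem modEq_of_exp_eq_of_arm {κ δ : ℝ} {q : ℕ} (hq : 1 ≤ q) (hδ : δ ≤ 1) {k j : ℤ} {z w : ℂ}
    (h : exp z = exp w) (hz : |z.im - κ * z.re - 2 * Real.pi * k / q| < δ / q)
    (hw : |w.im - κ * w.re - 2 * Real.pi * j / q| < δ / q) : j ≡ k [ZMOD q] := by
  have hpi := Real.pi_gt_three
  have hq0 : (0 : ℝ) < q := by exact_mod_cast hq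
  obtain ⟨l, rfl⟩ := Complex.exp_eq_exp_iff_exists_int.1 h
  have e1 : (w + l * (2 * Real.pi * I)).re = w.re := by simp
  have e2 : (w + l * (2 * Real.pi * I)).im = w.im + 2 * Real.pi * l := by simp; ring
  rw [e1, e2] at hz
  have h1 := abs_sub (w.im + 2 * Real.pi * l - κ * w.re - 2 * Real.pi * k / q)
    (w.im - κ * w.re - 2 * Real.pi * j / q)
  have e3 : w.im + 2 * Real.pi * l - κ * w.re - 2 * Real.pi * k / q
      - (w.im - κ * w.re - 2 * Real.pi * j / q) = 2 * Real.pi * ((q * l - k + j : ℤ) : ℝ) / q := by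
    push_cast
    field_simp
    ring
  rw [e3, abs_div, abs_of_pos hq0, abs_mul, abs_of_pos Real.two_pi_pos] at h1
  have h2 : 2 * Real.pi * |((q * l - k + j : ℤ) : ℝ)| / q < (2 * δ) / q := by
    have : 2 * δ / q = δ / q + δ / q := by ring
    linarith
  rw [div_lt_div_iff_of_pos_right hq0] at h2
  have h3 : |((q * l - k + j : ℤ) : ℝ)| < 1 := by nlinarith [abs_nonneg ((q * l - k + j : ℤ) : ℝ)]
  have h4 : |q * l - k + j| < 1 := by exact_mod_cast h3
  rw [Int.abs_lt_one_iff] at h4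
  exact (Int.modEq_iff_dvd.2 ⟨l, by linarith⟩)

theorem exists_arm_lift_of_modEq {κ : ℝ} {q : ℕ} (hq : 1 ≤ q) {k j : ℤ} (h : j ≡ k [ZMOD q])
    (z : ℂ) : ∃ w : ℂ, exp w = exp z ∧ w.re = z.re ∧
      w.im - κ * w.re - 2 * Real.pi * k / q = z.im - κ * z.re - 2 * Real.pi * j / q := by
  have hq0 : (0 : ℝ) < q := by exact_mod_cast hq
  obtain ⟨l, hl⟩ := Int.modEq_iff_dvd.1 h
  have e1 : (z + l * (2 * Real.pi * I)).re = z.re := by simp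
  have e2 : (z + l * (2 * Real.pi * I)).im = z.im + 2 * Real.pi * l := by simp; ring
  refine ⟨z + l * (2 * Real.pi * I), Complex.exp_eq_exp_iff_exists_int.2 ⟨l, rfl⟩, e1, ?_⟩
  have h1 : (k : ℝ) = j + q * l := by
    have : k = j + q * l := by linarith
    exact_mod_cast this
  rw [e1, e2, h1]
  field_simp
  ring

theorem crossCut_reverse {K : Set ℂ} {γ : ℝ → ℂ} (hγ : CrossCut K γ) :
    CrossCut K (fun t => γ (1 - t)) := by
  obtain ⟨h1, h2, h3, h4, h5, h6⟩ := hγ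
  have hm : ∀ t ∈ Icc (0 : ℝ) 1, 1 - t ∈ Icc (0 : ℝ) 1 := fun t ht =>
    ⟨by linarith [ht.2], by linarith [ht.1]⟩
  refine ⟨h1.comp (by fun_prop) hm, fun s hs t ht h => ?_, by simpa, by simpa, by simpa using h5.symm,
    fun t ht => h6 _ ⟨by linarith [ht.2], by linarith [ht.1]⟩⟩
  linarith [h2 (hm s hs) (hm t ht) h]

theorem crossCutRegion_reverse (K : Set ℂ) (γ : ℝ → ℂ) :
    CrossCutRegion K (fun t => γ (1 - t)) = CrossCutRegion K γ := by
  have : (fun t => γ (1 - t)) '' Icc 0 1 = γ '' Icc 0 1 := by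
    rw [show (fun t => γ (1 - t)) = γ ∘ fun t => 1 - t from rfl, image_comp, image_const_sub_Icc]
    simp
  rw [CrossCutRegion, CrossCutRegion, this]

namespace SpiralTower

variable (T : SpiralTower)

theorem eventually_exists_arm_near_endpoint {p : ℝ → ℂ} {c : ℝ} (hp : ContinuousOn p (Icc 0 1))
    (ha : p 0 ∈ T.hull) (hpK : ∀ t ∈ Ioo (0 : ℝ) 1, p t ∉ T.hull) (hc0 : 0 < c)
    (hc : 2 * c ≤ ‖p 0‖) : ∀ᶠ n in atTop, ∃ (k : ℤ) (ωa : ℂ), (T.S n).h (exp ωa) = p 0 ∧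
      ωa.re < 0 ∧ Real.log (T.δ n) ≤ ωa.re ∧
      |ωa.im - T.κ n * ωa.re - 2 * Real.pi * k / T.q n| < T.δ n / T.q n ∧
      ∀ ω : ℂ, ωa.re ≤ ω.re → ω.re < 0 →
        |ω.im - T.κ n * ω.re - 2 * Real.pi * k / T.q n| < T.δ n / T.q n →
        ‖(T.S n).h (exp ω) - p 0‖ < 2 * c := by
  obtain ⟨η, hη, hηc⟩ := Metric.continuousOn_iff.1 hp 0 (left_mem_Icc.2 zero_le_one) c hc0
  obtain ⟨t₁, ht₁, ht₁'⟩ := exists_between (lt_min hη one_pos)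
  have ht1 : t₁ < 1 := ht₁'.trans_le (min_le_right _ _)
  have hsub : Icc 0 t₁ ⊆ Icc 0 1 := Icc_subset_Icc_right ht1.le
  obtain ⟨N, hN⟩ : ∃ N, p t₁ ∉ (T.S N).disk := by
    have := hpK t₁ ⟨ht₁, ht1⟩
    simpa [hull] using this
  have h1 := tendsto_one_div_add_atTop_nhds_zero_nat (𝕜 := ℝ)
  filter_upwards [h1.eventually_le_const hc0, eventually_ge_atTop N] with n hn hnN
  refine T.exists_arm_near_endpoint ht₁.le (hp.mono hsub) ha (fun t ht => ?_)
    (fun t h0 ht => hpK t ⟨h0, ht.trans_lt ht1⟩) (fun h => hN (T.antitone_disk hnN h)) hn hc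
  rw [← dist_eq_norm]
  refine hηc t (hsub ht) ?_
  rw [Real.dist_eq, sub_zero, abs_of_nonneg ht.1]
  exact ht.2.trans_lt (ht₁'.trans_le (min_le_left _ _))

theorem exists_log_off_hull {a b : ℂ} (ha : a ∈ T.hull) (hb : b ∈ T.hull) :
    ∃ L, ContinuousOn L T.hullᶜ ∧ (∀ z ∉ T.hull, exp (L z) = (z - a) / (z - b)) ∧
      ∃ R, ∀ z, R < ‖z‖ → z ∉ T.hull ∧ ‖L z‖ < 1 :=
  exists_log_off_inter T.antitone_disk (fun n => (T.S n).isCompact_disk)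
    (fun n => (T.S n).isPathConnected_disk) (fun n => (T.S n).isConnected_compl_disk)
    (mem_iInter.1 ha) (mem_iInter.1 hb)

theorem ball_inter_crossCutRegion_nonempty {γ : ℝ → ℂ} (hγ : CrossCut T.hull γ) (hγ0 : γ 0 ≠ 0)
    {z₀ : ℂ} (hz₀ : z₀ ∈ T.hull) (h0 : z₀ ≠ γ 0) (h1 : z₀ ≠ γ 1) {ε : ℝ} (hε : 0 < ε) :
    (ball z₀ ε ∩ CrossCutRegion T.hull γ).Nonempty := by
  have hcc := hγ
  obtain ⟨hγc, -, ha, hb, hab, hγK⟩ := hγ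
  obtain ⟨c, hc, hcε, hcab, hca, hcb, hca0, hcb0⟩ : ∃ c > 0, c ≤ ε ∧ 4 * c ≤ ‖γ 0 - γ 1‖ ∧
      3 * c ≤ ‖z₀ - γ 0‖ ∧ 3 * c ≤ ‖z₀ - γ 1‖ ∧ 2 * c ≤ ‖γ 0‖ ∧ (γ 1 = 0 ∨ 2 * c ≤ ‖γ 1‖) := by
    have key : ∀ x : ℝ, 0 < x → ∀ᶠ c : ℝ in nhdsWithin 0 (Ioi 0), 4 * c ≤ x := by
      intro x hx
      filter_upwards [Ioo_mem_nhdsGT (show (0 : ℝ) < x / 4 by positivity)] with c hc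
      linarith [hc.2]
    have hb0 : ∀ᶠ c : ℝ in nhdsWithin 0 (Ioi 0), γ 1 = 0 ∨ 4 * c ≤ ‖γ 1‖ := by
      by_cases h : γ 1 = 0
      · exact Eventually.of_forall fun _ => Or.inl h
      · exact (key _ (norm_pos_iff.2 h)).mono fun _ => Or.inr
    obtain ⟨c, h1, h2, h3, h4, h5, h6, h7⟩ := ((key ε hε).and ((key _ (norm_pos_iff.2
      (sub_ne_zero.2 hab))).and ((key _ (norm_pos_iff.2 (sub_ne_zero.2 h0))).and
      ((key _ (norm_pos_iff.2 (sub_ne_zero.2 h1))).and ((key _ (norm_pos_iff.2 hγ0)).and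
      (hb0.and self_mem_nhdsWithin)))))).exists
    have h7 : 0 < c := h7
    refine ⟨c, h7, by linarith, h2, by linarith, by linarith, by linarith,
      h6.imp_right fun h => by linarith⟩
  have hB : ∀ᶠ n in atTop, γ 1 = 0 ∨ ∃ (k : ℤ) (ωb : ℂ), (T.S n).h (exp ωb) = γ 1 ∧
      ωb.re < 0 ∧ Real.log (T.δ n) ≤ ωb.re ∧
      |ωb.im - T.κ n * ωb.re - 2 * Real.pi * k / T.q n| < T.δ n / T.q n ∧
      ∀ ω : ℂ, ωb.re ≤ ω.re → ω.re < 0 →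
        |ω.im - T.κ n * ω.re - 2 * Real.pi * k / T.q n| < T.δ n / T.q n →
        ‖(T.S n).h (exp ω) - γ 1‖ < 2 * c := by
    rcases hcb0 with h | h
    · exact Eventually.of_forall fun _ => Or.inl h
    · obtain ⟨hrc, -, hra, -, -, hrK⟩ := crossCut_reverse hcc
      have := T.eventually_exists_arm_near_endpoint hrc hra hrK hc (by simpa using h)
      simp only [sub_zero] at this
      exact this.mono fun _ => Or.inr
  obtain ⟨n, ⟨k, ωa, hωa, hωa0, hωaδ, hak, hanear⟩, hB, hn⟩ :=
    ((T.eventually_exists_arm_near_endpoint hγc ha hγK hc hca0).and (hB.and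
      ((tendsto_one_div_add_atTop_nhds_zero_nat (𝕜 := ℝ)).eventually_le_const hc))).exists
  have st := T.step n
  have hδ := st.δ_pos
  have hδ1 := T.δ_le_one n
  have hq : (0 : ℝ) < T.q n := by exact_mod_cast st.one_le_q
  have hq1 : (1 : ℝ) ≤ T.q n := by exact_mod_cast st.one_le_q
  have hδq : T.δ n / T.q n ≤ T.δ n := div_le_self hδ.le hq1
  have hδq0 : 0 < T.δ n / T.q n := by positivity
  obtain ⟨v₀, hv₀, hv₀z, -⟩ := T.exists_mem_arm_of_mem_hull (n := n) hz₀
  obtain ⟨x, hx, hxv⟩ := st.near v₀ (mem_closedBall_zero_iff.2 hv₀.le) k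
  have hx0 : x < 0 := by linarith [hx.2]
  obtain ⟨C, hCre, hCarm, hCx⟩ : ∃ C : ℝ → ℂ, (∀ y, (C y).re = y) ∧
      (∀ y, (C y).im - T.κ n * (C y).re - 2 * Real.pi * k / T.q n = 0) ∧
      ‖exp (C x) - v₀‖ ≤ T.μ n / 2 := by
    refine ⟨fun y => (1 + T.κ n * I) * y + (2 * Real.pi * k / T.q n : ℝ) * I, ?_, ?_, hxv⟩
    · intro y; simp
    · intro y; simp
  have hsection : ∀ ω : ℂ, ω.re = x →
      |ω.im - T.κ n * ω.re - 2 * Real.pi * k / T.q n| < T.δ n / T.q n →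
      ‖(T.S n).h (exp ω) - z₀‖ < c := by
    intro ω hω hωk
    have h2 := norm_exp_sub_exp_le_of_arm st.κ_pos.le (z := ω) (w := C x) (by linarith)
      (by rw [hCre]; exact hx0.le) (d := 0) (by rw [hω, hCre, sub_self, abs_zero]) hωk.le
      (b := 0) (by rw [hCarm, abs_zero])
    have h3 := norm_sub_le_norm_sub_add_norm_sub (exp ω) (exp (C x)) v₀
    have h4 := st.δ_le
    rw [← hv₀z]
    refine (T.norm_h_sub_lt ?_ hv₀.le (by linarith)).trans_le hn
    rw [norm_exp, Real.exp_le_one_iff, hω]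
    exact hx0.le
  have hxa : x < ωa.re := by
    by_contra! h
    have hk0 : |(C x).im - T.κ n * (C x).re - 2 * Real.pi * k / T.q n| < T.δ n / T.q n := by
      rw [hCarm, abs_zero]; exact hδq0
    have h2 := hanear (C x) (by rwa [hCre]) (by rwa [hCre]) hk0
    have h3 := hsection (C x) (hCre x) hk0
    have h4 := norm_sub_le_norm_sub_add_norm_sub z₀ ((T.S n).h (exp (C x))) (γ 0)
    rw [norm_sub_rev z₀ ((T.S n).h _)] at h4
    linarith
  set V₁ : Set ℂ := {ω | (x < ω.re ∧ ω.re < 0) ∧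
    |ω.im - T.κ n * ω.re - 2 * Real.pi * k / T.q n| < T.δ n / T.q n} with hV₁
  set V₂ : Set ℂ := ⋃ j : ℤ, {ω | (ω.re < 0 ∧ (¬ j ≡ k [ZMOD T.q n] ∨ ω.re < x)) ∧
    |ω.im - T.κ n * ω.re - 2 * Real.pi * j / T.q n| < T.δ n / T.q n} with hV₂
  have harm : ∀ j : ℤ,
      IsOpen {ω : ℂ | |ω.im - T.κ n * ω.re - 2 * Real.pi * j / T.q n| < T.δ n / T.q n} :=
    fun j => isOpen_lt (((continuous_im.sub (continuous_const.mul continuous_re)).sub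
      continuous_const).abs) continuous_const
  have hV₁o : IsOpen V₁ :=
    ((isOpen_lt continuous_const continuous_re).inter
      (isOpen_lt continuous_re continuous_const)).inter (harm k)
  have hV₂o : IsOpen V₂ :=
    isOpen_iUnion fun j => ((isOpen_lt continuous_re continuous_const).inter
      (isOpen_const.union (isOpen_lt continuous_re continuous_const))).inter (harm j)
  have hexp : ∀ ω : ℂ, ω.re < 0 → exp ω ∈ ball (0 : ℂ) (T.S n).R := fun ω hω => by
    rw [mem_ball_zero_iff, norm_exp]
    exact (Real.exp_lt_one_iff.2 hω).trans (T.S n).one_lt_R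
  have hW₁R : exp '' V₁ ⊆ ball (0 : ℂ) (T.S n).R := by
    rintro _ ⟨ω, hω, rfl⟩
    exact hexp ω hω.1.2
  have hW₂R : ball (0 : ℂ) (T.δ n) ∪ exp '' V₂ ⊆ ball (0 : ℂ) (T.S n).R := by
    refine union_subset (ball_subset_ball (by linarith [(T.S n).one_lt_R])) ?_
    rintro _ ⟨ω, hω, rfl⟩
    obtain ⟨j, hj⟩ := mem_iUnion.1 hω
    exact hexp ω hj.1.1
  have hdisj : Disjoint (exp '' V₁) (ball (0 : ℂ) (T.δ n) ∪ exp '' V₂) := by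
    rw [Set.disjoint_left]
    rintro _ ⟨ω, hω, rfl⟩ (h | ⟨ω', hω', h⟩)
    · rw [mem_ball_zero_iff, norm_exp, ← Real.lt_log_iff_exp_lt hδ] at h
      linarith [hx.1, hω.1.1]
    · obtain ⟨j, hj⟩ := mem_iUnion.1 hω'
      have hre : ω'.re = ω.re := by
        rw [← Real.exp_eq_exp, ← norm_exp, ← norm_exp, h]
      rcases hj.1.2 with h' | h'
      · exact h' (modEq_of_exp_eq_of_arm st.one_le_q (by linarith) h.symm hω.2 hj.2)
      · linarith [hω.1.1]
  obtain ⟨L, hL, hLe, hLi⟩ := T.exists_log_off_hull ha hb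
  refine (crossCutRegion_inter_nonempty T.isCompact_hull hcc hL hLe hLi (B := ball z₀ c)
    (O₁ := (T.S n).h '' (exp '' V₁)) (O₂ := (T.S n).h '' (ball 0 (T.δ n) ∪ exp '' V₂)) isOpen_ball
    ((T.S n).isOpen_image_h (isOpen_exp_image hV₁o) hW₁R)
    ((T.S n).isOpen_image_h (isOpen_ball.union (isOpen_exp_image hV₂o)) hW₂R) ?_ ?_ ?_ ?_).mono
    (inter_subset_inter_left _ (ball_subset_ball hcε))
  · rw [Set.disjoint_left]
    rintro _ ⟨v, hv, rfl⟩ ⟨w, hw, hvw⟩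
    rw [(T.S n).injOn_h (hW₂R hw) (hW₁R hv) hvw] at hw
    exact Set.disjoint_left.1 hdisj hv hw
  · rintro z ⟨hz, hzB⟩
    obtain ⟨v, hv, rfl, hfac⟩ := T.exists_mem_arm_of_mem_hull (n := n) hz
    rcases hfac with h | ⟨j, ω, rfl, hω⟩
    · exact Or.inr ⟨v, Or.inl (mem_ball_zero_iff.2 h), rfl⟩
    · have hω0 : ω.re < 0 := by rwa [norm_exp, Real.exp_lt_one_iff] at hv
      by_cases hj : j ≡ k [ZMOD T.q n]
      · obtain ⟨ω', h2, h3, h4⟩ := exists_arm_lift_of_modEq (κ := T.κ n) st.one_le_q hj ω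
        rcases lt_trichotomy ω.re x with h | h | h
        · exact Or.inr ⟨_, Or.inr ⟨ω, mem_iUnion.2 ⟨j, ⟨hω0, Or.inr h⟩, hω⟩, rfl⟩, rfl⟩
        · refine (hzB ?_).elim
          rw [mem_ball, dist_eq_norm, ← h2]
          exact hsection ω' (h3.trans h) (by rwa [h4])
        · refine Or.inl ⟨_, ⟨ω', ⟨⟨?_, ?_⟩, ?_⟩, h2⟩, rfl⟩
          · rwa [h3]
          · rwa [h3]
          · rwa [h4]
      · exact Or.inr ⟨_, Or.inr ⟨ω, mem_iUnion.2 ⟨j, ⟨hω0, Or.inl hj⟩, hω⟩, rfl⟩, rfl⟩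
  · refine ⟨⟨_, ⟨ωa, ⟨⟨hxa, hωa0⟩, hak⟩, rfl⟩, hωa⟩, fun h => ?_⟩
    rw [mem_ball, dist_eq_norm, norm_sub_rev] at h
    linarith
  · refine ⟨?_, fun h => ?_⟩
    · rcases hB with h | ⟨j, ωb, hωb, hωb0, -, hbj, hbnear⟩
      · exact ⟨0, Or.inl (mem_ball_self hδ), by rw [(T.S n).h_zero, h]⟩
      · refine ⟨_, Or.inr ⟨ωb, mem_iUnion.2 ⟨j, ⟨hωb0, Or.inl fun hjk => ?_⟩, hbj⟩, rfl⟩, hωb⟩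
        set y := max ωa.re ωb.re with hy
        have hy0 : y < 0 := max_lt hωa0 hωb0
        have h2 := hanear (C y) (by rw [hCre]; exact le_max_left _ _) (by rwa [hCre])
          (by rw [hCarm, abs_zero]; exact hδq0)
        obtain ⟨ω', h3, h4, h5⟩ := exists_arm_lift_of_modEq (κ := T.κ n) st.one_le_q hjk.symm (C y)
        have h6 := hbnear ω' (by rw [h4, hCre]; exact le_max_right _ _) (by rwa [h4, hCre])
          (by rw [h5, hCarm, abs_zero]; exact hδq0)
        rw [h3] at h6
        have h7 := norm_sub_le_norm_sub_add_norm_sub (γ 0) ((T.S n).h (exp (C y))) (γ 1)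
        rw [norm_sub_rev (γ 0) ((T.S n).h (exp (C y)))] at h7
        linarith
    · rw [mem_ball, dist_eq_norm, norm_sub_rev] at h
      linarith

theorem hull_subset_closure_crossCutRegion {γ : ℝ → ℂ} (hγ : CrossCut T.hull γ) :
    T.hull ⊆ closure (CrossCutRegion T.hull γ) := by
  have key : T.hull \ {γ 0, γ 1} ⊆ closure (CrossCutRegion T.hull γ) := by
    rintro z ⟨hz, hz'⟩
    simp only [mem_insert_iff, mem_singleton_iff, not_or] at hz'
    refine (mem_closure_iff_nhds_basis' nhds_basis_ball).2 fun ε hε => ?_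
    by_cases h0 : γ 0 = 0
    · have h1 : γ (1 - 0) ≠ 0 := by
        rw [sub_zero, ← h0]
        exact hγ.2.2.2.2.1.symm
      rw [← crossCutRegion_reverse]
      exact T.ball_inter_crossCutRegion_nonempty (crossCut_reverse hγ) h1 hz (by simpa using hz'.2)
        (by simpa using hz'.1) hε
    · exact T.ball_inter_crossCutRegion_nonempty hγ h0 hz hz'.1 hz'.2 hε
  have hcl : T.hull ⊆ closure (T.hull \ {γ 0, γ 1}) := by
    intro z hz
    rw [mem_closure_iff_nhds]
    intro t ht
    have hf : ({γ 0, γ 1} \ {z} : Set ℂ).Finite := (Set.toFinite {γ 0, γ 1}).sdiff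
    obtain ⟨y, ⟨hyt, hy⟩, hyz⟩ := accPt_iff_nhds.1 (T.preperfect_hull z hz)
      (t ∩ ({γ 0, γ 1} \ {z})ᶜ) (inter_mem ht (hf.isClosed.isOpen_compl.mem_nhds fun h => h.2 rfl))
    exact ⟨y, hyt.1, hy, fun h => hyt.2 ⟨h, hyz⟩⟩
  exact hcl.trans (closure_minimal key isClosed_closure)

end SpiralTower

/-- There exists a non-linearizable germ with a hedgehog `K` such that for every
cross-cut `γ` of `ℂ ∖ K` one has `K ⊆ closure (G(γ))` (i.e. the impression of every
prime end of the complement of `K` is all of `K`). -/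
theorem exists_hedgehog_full_impressions :
    ∃ (α r : ℝ) (f : ℂ → ℂ) (U K : Set ℂ),
      Irrational α ∧ 0 < r ∧
      IsOpen U ∧ Metric.closedBall (0 : ℂ) r ⊆ U ∧
      DifferentiableOn ℂ f U ∧ Set.InjOn f U ∧
      f 0 = 0 ∧ deriv f 0 = Complex.exp (2 * Real.pi * Complex.I * α) ∧
      ¬ Linearizable α f ∧
      IsHedgehog r f K ∧
      ∀ γ : ℝ → ℂ, CrossCut K γ → K ⊆ closure (CrossCutRegion K γ) := by
  obtain ⟨T⟩ := nonempty_spiralTower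
  obtain ⟨α, hα, hαT⟩ := T.exists_irrational
  obtain ⟨f, hf⟩ := T.exists_limit_map
  obtain ⟨z₁, hz₁, hz₁0⟩ := T.exists_ne_zero_mem_hull
  obtain ⟨z₂, hz₂, hmax⟩ := T.isCompact_hull.exists_isMaxOn ⟨0, T.zero_mem_hull⟩
    continuous_norm.continuousOn
  have hr : 0 < ‖z₂‖ := (norm_pos_iff.2 hz₁0).trans_le (hmax hz₁)
  have hfK := SpiralTower.image_hull hf
  refine ⟨α, ‖z₂‖, f, ball 0 1, T.hull, hα, hr, isOpen_ball,
    closedBall_subset_ball (mem_ball_zero_iff.1 (T.hull_subset_ball hz₂)),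
    (SpiralTower.differentiableOn_limit hf).mono (ball_subset_ball one_le_two),
    SpiralTower.injOn_limit hf, SpiralTower.limit_zero hf, SpiralTower.deriv_limit hf hαT,
    fun hlin => T.hull_notMem_nhds (mem_nhds_of_linearizable hα hlin T.isCompact_hull.isClosed
      T.isConnected_hull.isPreconnected T.zero_mem_hull ⟨z₁, hz₁, hz₁0⟩
      fun z hz => hfK ▸ mem_image_of_mem f hz),
    ⟨T.isCompact_hull, T.isConnected_hull, T.zero_mem_hull,
      fun z hz => mem_closedBall_zero_iff.2 (hmax hz), ⟨z₂, hz₂, mem_sphere_zero_iff_norm.2 rfl⟩,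
      hfK, T.isConnected_compl_hull⟩,
    fun γ hγ => T.hull_subset_closure_crossCutRegion hγ⟩
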